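/- arXiv:2302.09811 — 4 statements merged into one kernel-verified Lean document; each statement's English description precedes it below -/
import Mathlib

section
/- Let H = A∗_C be the HNN extension associated to injections i_P, i_N : C → A with images C_P, C_N. Let w = a_1 t⁻¹ b_1 t a_2 t⁻¹ b_2 t ⋯ a_m t⁻¹ b_m t x t ∈ H, where m ≥ 1, x ∈ A, a_i ∈ A \ C_P and b_i ∈ A \ C_N for all 1 ≤ i ≤ m. Suppose a_1 is ∞-RF relative to C_P, b_m is ∞-RF relative to C_N, each a_i is ∞-RTF relative to C_P, and each b_i is ∞-RTF relative to C_N. Then the natural homomorphism A → H/⟪w⟫ is injective. -/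
/-- An element `a ∈ A \ C` is *length-`n` relatively free* (`n`-RF) relative to the subgroup `C`
if every product `a^{e 0} * c 0 * a^{e 1} * c 1 * ⋯` of length `k ≥ 1` with `e i = ±1`, `c i ∈ C`,
`c i ≠ 1` whenever `e i = -e (i+1)` (indices cyclic), and with fewer than `n` of the `e i`
equal to `+1` and fewer than `n` equal to `-1`, is nontrivial. -/
def IsRF {A : Type} [Group A] (C : Subgroup A) (n : ℕ∞) (a : A) : Prop :=
  ∀ (k : ℕ) (e : Fin (k + 1) → ℤ) (c : Fin (k + 1) → A),
    (∀ i, e i = 1 ∨ e i = -1) → (∀ i, c i ∈ C) →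
    (∀ i, e i = -(e (i + 1)) → c i ≠ 1) →
    ((Finset.univ.filter (fun i => e i = 1)).card : ℕ∞) < n →
    ((Finset.univ.filter (fun i => e i = -1)).card : ℕ∞) < n →
    (List.ofFn fun i => a ^ e i * c i).prod ≠ 1

/-- An element `a ∈ A \ C` is *`n`-relatively torsion-free* (`n`-RTF) relative to `C` if
`a * c 0 * a * c 1 * ⋯ * a * c (k-1) ≠ 1` for all `c i ∈ C` and all lengths `1 ≤ k < n`. -/
def IsRTF {A : Type} [Group A] (C : Subgroup A) (n : ℕ∞) (a : A) : Prop :=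
  ∀ (k : ℕ), ((k + 1 : ℕ) : ℕ∞) < n → ∀ (c : Fin (k + 1) → A), (∀ i, c i ∈ C) →
    (List.ofFn fun i => a * c i).prod ≠ 1

section HNNSetup

variable {C A : Type} [Group C] [Group A] (iP iN : C →* A)
  (hiP : Function.Injective iP) (hiN : Function.Injective iN)

/-- The isomorphism `i_P(C) ≃* i_N(C)` sending `i_P c` to `i_N c`; the associated HNN extension
`HNNExtension A iP.range iN.range (hnnφ iP iN hiP hiN)` is `⟨A, t ∣ i_N c = t (i_P c) t⁻¹⟩`. -/
noncomputable def hnnφ : (iP.range : Subgroup A) ≃* (iN.range : Subgroup A) :=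
  (MonoidHom.ofInjective hiP).symm.trans (MonoidHom.ofInjective hiN)

/-- The projection `p : A ∗_C → ℤ` with `p t = 1` and `p a = 0` for `a ∈ A`. -/
noncomputable def hnnProj :
    HNNExtension A iP.range iN.range (hnnφ iP iN hiP hiN) →* Multiplicative ℤ :=
  HNNExtension.lift 1 (Multiplicative.ofAdd 1) (fun a => by simp)

end HNNSetup

namespace KL

/-- Indicator of a decidable proposition, as an integer. -/
def ind (p : Prop) [Decidable p] : ℤ := if p then 1 else 0

/-- Winding number of a list of time intervals, from time `y` to time `z`. -/
def jl : ℤ → List (ℤ × ℤ) → ℤ → ℤ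
  | y, [], z => -ind (y < z)
  | y, (s, e) :: l, z => -ind (y < s) + ind (e < s) + jl e l z

/-- Cyclic winding number. -/
def J : List (ℤ × ℤ) → ℤ
  | [] => 0
  | (s, e) :: l => ind (e < s) + jl e l s

theorem jl_append (y : ℤ) (l1 : List (ℤ × ℤ)) (s e : ℤ) (l2 : List (ℤ × ℤ)) (z : ℤ) :
    jl y (l1 ++ (s, e) :: l2) z = jl y l1 s + ind (e < s) + jl e l2 z := by
  induction l1 generalizing y with
  | nil => simp [jl]
  | cons p l ih =>
    obtain ⟨s', e'⟩ := p
    simp only [List.cons_append, jl, ih]; ring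

theorem jl_form (e : ℤ) (l : List (ℤ × ℤ)) : ∃ w K, ∀ z, jl e l z = K - ind (w < z) := by
  induction l generalizing e with
  | nil => exact ⟨e, 0, fun z => by simp [jl]⟩
  | cons p l ih =>
    obtain ⟨s', e'⟩ := p
    obtain ⟨w, K, h⟩ := ih e'
    exact ⟨w, -ind (e < s') + ind (e' < s') + K, fun z => by simp only [jl, h]; ring⟩

theorem J_rot (l1 l2 : List (ℤ × ℤ)) : J (l1 ++ l2) = J (l2 ++ l1) := by
  rcases l1 with _ | ⟨⟨s1, e1⟩, k1⟩
  · simp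
  rcases l2 with _ | ⟨⟨s2, e2⟩, k2⟩
  · simp
  simp only [List.cons_append, J, jl_append]; ring

theorem ind_nonneg (p : Prop) [Decidable p] : 0 ≤ ind p := by
  unfold ind; split_ifs <;> omega

theorem ind_le_one (p : Prop) [Decidable p] : ind p ≤ 1 := by
  unfold ind; split_ifs <;> omega

theorem ind_true {p : Prop} [Decidable p] (h : p) : ind p = 1 := by simp [ind, h]

theorem ind_false {p : Prop} [Decidable p] (h : ¬ p) : ind p = 0 := by simp [ind, h]

theorem key_ineq (s e s' e' a a' w w' : ℤ) (hd : e < s' ∨ e' < s) :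
    ind (w' < a) + ind (w < a') ≤
      1 + ind (e < a) + ind (w < s) + ind (e' < a') + ind (w' < s') := by
  have h1 := ind_le_one (w' < a)
  have h2 := ind_le_one (w < a')
  have h3 := ind_nonneg (e < a)
  have h4 := ind_nonneg (w < s)
  have h5 := ind_nonneg (e' < a')
  have h6 := ind_nonneg (w' < s')
  by_cases q1 : w' < a
  swap
  · rw [ind_false q1]; omega
  by_cases q2 : w < a'
  swap
  · rw [ind_false q2]; omega
  by_cases q3 : e < a
  · rw [ind_true q3]; omega
  by_cases q4 : w < s
  · rw [ind_true q4]; omega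
  by_cases q5 : e' < a'
  · rw [ind_true q5]; omega
  by_cases q6 : w' < s'
  · rw [ind_true q6]; omega
  omega

theorem J_merge (s e s' e' : ℤ) (m m' : List (ℤ × ℤ)) (h : 1 ≤ J ((s, e) :: m))
    (h' : 1 ≤ J ((s', e') :: m')) (hs : s < e) (hs' : s' < e') (hd : e < s' ∨ e' < s) :
    1 ≤ J (m' ++ m) := by
  have q1 : ind (e < s) = 0 := ind_false (by omega)
  have q2 : ind (e' < s') = 0 := ind_false (by omega)
  rcases m with _ | ⟨⟨a, b⟩, k⟩
  · simp only [J, jl, q1] at h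
    have := ind_nonneg (e < s); omega
  rcases m' with _ | ⟨⟨a', b'⟩, k'⟩
  · simp only [J, jl, q2] at h'
    have := ind_nonneg (e' < s'); omega
  obtain ⟨w, K, hk⟩ := jl_form b k
  obtain ⟨w', K', hk'⟩ := jl_form b' k'
  have := key_ineq s e s' e' a a' w w' hd
  simp only [List.cons_append, J, jl_append, jl, hk, hk', q1, q2] at h h' ⊢
  omega

theorem J_fold (s e s' e' : ℤ) (L R : List (ℤ × ℤ)) (h : 1 ≤ J ((s, e) :: (L ++ (s', e') :: R)))
    (hs : s < e) (hs' : s' < e') (hd : e < s' ∨ e' < s) (hL : L = [] ∨ J L ≤ -1) :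
    1 ≤ J R := by
  have q1 : ind (e < s) = 0 := ind_false (by omega)
  have q2 : ind (e' < s') = 0 := ind_false (by omega)
  have p1 := ind_nonneg (e < s')
  have p2 := ind_nonneg (e' < s)
  rcases L with _ | ⟨⟨a, b⟩, k⟩
  · rcases R with _ | ⟨⟨a', b'⟩, k'⟩
    · simp only [J, jl, List.nil_append, q1, q2] at h; omega
    obtain ⟨w', K', hk'⟩ := jl_form b' k'
    simp only [List.nil_append, J, jl, hk', q1, q2] at h ⊢
    have h1 := ind_le_one (w' < a')
    have h2 := ind_nonneg (e' < a')
    have h3 := ind_nonneg (w' < s)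
    by_cases c1 : w' < a'
    swap
    · rw [ind_false c1]; omega
    by_cases c2 : e < s'
    · rw [ind_true c2] at h; omega
    by_cases c3 : e' < a'
    · rw [ind_true c3] at h; omega
    by_cases c4 : w' < s
    · rw [ind_true c4] at h; omega
    omega
  · have hL := hL.resolve_left (by simp)
    obtain ⟨w, K, hk⟩ := jl_form b k
    have h1 := ind_nonneg (e < a)
    have h2 := ind_nonneg (w < s')
    have h3 := ind_le_one (w < a)
    rcases R with _ | ⟨⟨a', b'⟩, k'⟩
    · simp only [J, jl_append, jl, hk, List.cons_append, q1, q2] at h hL ⊢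
      omega
    obtain ⟨w', K', hk'⟩ := jl_form b' k'
    have := key_ineq s' e s e' a a' w' w
    have h4 := key_ineq s e s' e' a a' w' w
    simp only [List.cons_append, J, jl_append, jl, hk, hk', q1, q2] at h hL ⊢
    have := h4 hd
    omega

end KL

namespace KL
set_option linter.unusedSectionVars false

/-- Products of exactly `n` conjugates of `w` or its inverse. -/
inductive E {H : Type} [Group H] (w : H) : ℕ → H → Prop
  | one : E w 0 1
  | pos (n : ℕ) (h g : H) : E w n h → E w (n + 1) (g * w * g⁻¹ * h)
  | neg (n : ℕ) (h g : H) : E w n h → E w (n + 1) (g * w⁻¹ * g⁻¹ * h)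

section E
variable {H : Type} [Group H] {w : H}

theorem E.mul {m n : ℕ} {g h : H} (hg : E w m g) (hh : E w n h) : E w (m + n) (g * h) := by
  induction hg with
  | one => simpa using hh
  | pos m k g _ ih =>
    have := E.pos _ _ g ih
    rw [show m + 1 + n = m + n + 1 by omega]
    simpa only [mul_assoc] using this
  | neg m k g _ ih =>
    have := E.neg _ _ g ih
    rw [show m + 1 + n = m + n + 1 by omega]
    simpa only [mul_assoc] using this

theorem E.conj {n : ℕ} {h : H} (hh : E w n h) (x : H) : E w n (x * h * x⁻¹) := by
  induction hh with
  | one => simpa using E.one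
  | pos m k g _ ih =>
    have := E.pos _ _ (x * g) ih
    convert this using 1; group
  | neg m k g _ ih =>
    have := E.neg _ _ (x * g) ih
    convert this using 1; group

theorem E.comm {n : ℕ} {g h : H} (hh : E w n (g * h)) : E w n (h * g) := by
  have := hh.conj g⁻¹
  convert this using 1; group

theorem E.of_mem {h : H} (hh : h ∈ Subgroup.normalClosure {w}) : ∃ n, E w n h := by
  unfold Subgroup.normalClosure at hh
  induction hh using Subgroup.closure_induction with
  | mem x hx =>
    obtain ⟨y, hy, hc⟩ := Group.mem_conjugatesOfSet_iff.1 hx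
    obtain rfl : y = w := by simpa using hy
    obtain ⟨g, rfl⟩ := isConj_iff.1 hc
    exact ⟨1, by simpa using E.pos 0 1 g E.one⟩
  | one => exact ⟨0, E.one⟩
  | mul x y _ _ ihx ihy =>
    obtain ⟨m, hm⟩ := ihx
    obtain ⟨n, hn⟩ := ihy
    exact ⟨_, hm.mul hn⟩
  | inv x _ ih =>
    obtain ⟨m, hm⟩ := ih
    refine ⟨m, ?_⟩
    clear * - hm
    induction hm with
    | one => simpa using E.one
    | pos m k g _ ih =>
      have : E w 1 (g * w⁻¹ * g⁻¹) := by simpa using E.neg 0 1 g E.one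
      have := ih.mul this
      convert this using 1; group
    | neg m k g _ ih =>
      have : E w 1 (g * w * g⁻¹) := by simpa using E.pos 0 1 g E.one
      have := ih.mul this
      convert this using 1; group

end E

section letters
open HNNExtension
variable {G : Type} [Group G] {A B : Subgroup G} (φ : A ≃* B)

/-- Evaluation of a letter. -/
noncomputable def evl : G ⊕ ℤˣ → HNNExtension G A B φ
  | .inl g => of g
  | .inr ε => t ^ (ε : ℤ)

/-- Evaluation of a word. -/
noncomputable def ev (l : List (G ⊕ ℤˣ)) : HNNExtension G A B φ := (l.map (evl φ)).prod

@[simp] theorem ev_nil : ev φ [] = 1 := by simp [ev]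
@[simp] theorem ev_cons (x : G ⊕ ℤˣ) (l) : ev φ (x :: l) = evl φ x * ev φ l := by simp [ev]
@[simp] theorem ev_append (l l') : ev φ (l ++ l') = ev φ l * ev φ l' := by simp [ev]
@[simp] theorem evl_inl (g : G) : evl φ (.inl g) = of g := rfl
@[simp] theorem ev_map_inl (gs : List G) : ev φ (gs.map Sum.inl) = of gs.prod := by
  induction gs with
  | nil => simp
  | cons g gs ih => simp [ih]

theorem evl_inr (ε : ℤˣ) : evl φ (.inr ε) = t ^ (ε : ℤ) := rfl

@[simp] theorem evl_inr_neg (ε : ℤˣ) : evl φ (.inr (-ε)) = (evl φ (.inr ε))⁻¹ := by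
  simp [evl_inr]

/-- The relation `t^ε c = d t^ε`. -/
def Cr (ε : ℤˣ) (c d : G) : Prop :=
  ∃ h : c ∈ toSubgroup A B ε, (toSubgroupEquiv φ ε ⟨c, h⟩ : G) = d

variable {φ}

theorem Cr.mem {ε : ℤˣ} {c d : G} (h : Cr φ ε c d) : c ∈ toSubgroup A B ε := h.1

theorem Cr.mem' {ε : ℤˣ} {c d : G} (h : Cr φ ε c d) : d ∈ toSubgroup A B (-ε) := by
  obtain ⟨h, rfl⟩ := h; exact Subtype.prop _

theorem Cr.exists {ε : ℤˣ} {c : G} (h : c ∈ toSubgroup A B ε) : ∃ d, Cr φ ε c d := ⟨_, h, rfl⟩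

theorem Cr.inv {ε : ℤˣ} {c d : G} (h : Cr φ ε c d) : Cr φ ε c⁻¹ d⁻¹ := by
  obtain ⟨h, rfl⟩ := h
  exact ⟨inv_mem h, by
    have := map_inv (toSubgroupEquiv φ ε) ⟨c, h⟩
    exact congrArg Subtype.val this⟩

theorem Cr.symm {ε : ℤˣ} {c d : G} (h : Cr φ ε c d) : Cr φ (-ε) d c := by
  obtain ⟨h, rfl⟩ := h
  refine ⟨Subtype.prop _, ?_⟩
  have := toSubgroupEquiv_neg_apply φ ε ⟨c, h⟩
  exact this

theorem Cr.ev {ε : ℤˣ} {c d : G} (h : Cr φ ε c d) :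
    evl φ (.inr ε) * of c = of d * evl φ (.inr ε) := by
  obtain ⟨h, rfl⟩ := h
  rw [evl_inr]
  rcases Int.units_eq_one_or ε with rfl | rfl
  · have := t_mul_of (φ := φ) ⟨c, h⟩
    rw [Units.val_one, zpow_one]; exact this
  · have := inv_t_mul_of (φ := φ) ⟨c, h⟩
    rw [Units.val_neg, Units.val_one, zpow_neg, zpow_one]; exact this

variable (φ)

/-- Normalisation. -/
def nrm : List (G ⊕ ℤˣ) → G × List (ℤˣ × G)
  | [] => (1, [])
  | .inl g :: l => (g * (nrm l).1, (nrm l).2)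
  | .inr ε :: l => (1, (ε, (nrm l).1) :: (nrm l).2)

theorem ev_nrm (l : List (G ⊕ ℤˣ)) : ev φ l =
    of (nrm l).1 * ((nrm l).2.map fun x => t ^ (x.1 : ℤ) * of x.2).prod := by
  induction l with
  | nil => simp [nrm]
  | cons x l ih =>
    rcases x with g | ε
    · simp [nrm, ih, mul_assoc]
    · simp [nrm, ih, mul_assoc, evl_inr]

theorem nrm_nil (l : List (G ⊕ ℤˣ)) (h : (nrm l).2 = []) : ∃ gs : List G, l = gs.map Sum.inl := by
  induction l with
  | nil => exact ⟨[], rfl⟩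
  | cons x l ih =>
    rcases x with g | ε
    · obtain ⟨gs, rfl⟩ := ih h
      exact ⟨g :: gs, rfl⟩
    · simp [nrm] at h

theorem nrm_head (l : List (G ⊕ ℤˣ)) (ε : ℤˣ) (g : G) (r) (h : (nrm l).2 = (ε, g) :: r) :
    ∃ (gs : List G) (q : List (G ⊕ ℤˣ)), l = gs.map Sum.inl ++ .inr ε :: q ∧
      gs.prod = (nrm l).1 := by
  induction l with
  | nil => simp [nrm] at h
  | cons x l ih =>
    rcases x with g' | ε'
    · obtain ⟨gs, q, rfl, h2⟩ := ih h
      exact ⟨g' :: gs, q, rfl, by simp only [nrm, List.prod_cons]; rw [h2]⟩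
    · simp [nrm] at h
      obtain ⟨⟨rfl, -⟩, -⟩ := h
      exact ⟨[], l, rfl, rfl⟩

theorem nrm_chain (l : List (G ⊕ ℤˣ)) :
    (∃ p ε, ∃ gs : List G, ∃ q, l = p ++ .inr ε :: (gs.map Sum.inl ++ .inr (-ε) :: q) ∧
      gs.prod ∈ toSubgroup A B ε) ∨
    (nrm l).2.IsChain (fun a b => a.2 ∈ toSubgroup A B a.1 → a.1 = b.1) := by
  induction l with
  | nil => right; simp [nrm]
  | cons x l ih =>
    rcases ih with ⟨p, ε, gs, q, rfl, h⟩ | ih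
    · exact .inl ⟨x :: p, ε, gs, q, rfl, h⟩
    rcases x with g' | ε'
    · exact .inr ih
    · rcases hl : (nrm l).2 with _ | ⟨⟨ε, g⟩, r⟩
      · right; simp [nrm, hl]
      · obtain ⟨gs, q, h1, h2⟩ := nrm_head l ε g r hl
        by_cases hc : (nrm l).1 ∈ toSubgroup A B ε' ∧ ε' ≠ ε
        · left
          have : ε = -ε' := by
            rcases Int.units_eq_one_or ε with rfl | rfl <;>
            rcases Int.units_eq_one_or ε' with rfl | rfl <;> simp_all
          exact ⟨[], ε', gs, q, by rw [h1, this]; rfl, by rw [h2]; exact hc.1⟩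
        · right
          simp only [nrm, hl]
          rw [List.isChain_cons_cons]
          refine ⟨?_, hl ▸ ih⟩
          intro h; by_contra h3; exact hc ⟨h, h3⟩

theorem pinch_or (l : List (G ⊕ ℤˣ)) (y : G) (hl : ev φ l = of y) :
    (∃ p ε, ∃ gs : List G, ∃ q, l = p ++ .inr ε :: (gs.map Sum.inl ++ .inr (-ε) :: q) ∧
      gs.prod ∈ toSubgroup A B ε) ∨ ∃ gs : List G, l = gs.map Sum.inl := by
  rcases nrm_chain (A := A) (B := B) l with h | h
  · exact .inl h
  right
  apply nrm_nil
  let w : NormalWord.ReducedWord G A B := ⟨(nrm l).1, (nrm l).2, h⟩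
  have := ReducedWord.toList_eq_nil_of_mem_of_range φ w ⟨y, by
    rw [← hl, ev_nrm]; rfl⟩
  exact this

/-- The number of `t`-letters. -/
def nt (l : List (G ⊕ ℤˣ)) : ℕ := l.countP Sum.isRight

@[simp] theorem nt_append (l l' : List (G ⊕ ℤˣ)) : nt (l ++ l') = nt l + nt l' := by simp [nt]
@[simp] theorem nt_inr (ε : ℤˣ) (l : List (G ⊕ ℤˣ)) : nt (.inr ε :: l) = nt l + 1 := by
  simp [nt, List.countP_cons]
@[simp] theorem nt_inl (g : G) (l : List (G ⊕ ℤˣ)) : nt (.inl g :: l) = nt l := by simp [nt]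
@[simp] theorem nt_nil : nt ([] : List (G ⊕ ℤˣ)) = 0 := by simp [nt]
@[simp] theorem nt_map (gs : List G) : nt (gs.map Sum.inl) = 0 := by
  induction gs <;> simp_all

theorem nt_eq_zero (l : List (G ⊕ ℤˣ)) (h : nt l = 0) : ∃ gs : List G, l = gs.map Sum.inl := by
  induction l with
  | nil => exact ⟨[], rfl⟩
  | cons x l ih =>
    rcases x with g | ε
    · obtain ⟨gs, rfl⟩ := ih (by simpa using h)
      exact ⟨g :: gs, rfl⟩
    · simp at h

end letters
end KL

namespace KL
set_option linter.unusedSectionVars false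
section RF
variable {G : Type} [Group G] {C : Subgroup G} {d : G}

theorem rtf_list (h : IsRTF C ⊤ d) (cs : List G) (h0 : cs ≠ []) (hc : ∀ c ∈ cs, c ∈ C) :
    (cs.map (d * ·)).prod ≠ 1 := by
  rcases hn : cs.length with _ | k
  · simp at hn; exact absurd hn h0
  have := h k (by exact_mod_cast ENat.natCast_lt_top _) (fun i => cs[i.1]'(by omega))
    (fun i => hc _ (List.getElem_mem _))
  convert this using 2
  apply List.ext_getElem
  · simp [hn]
  · intro i h1 h2
    simp only [List.getElem_ofFn, List.getElem_map]

theorem rtf_form (gs : List G) (hg : ∀ g ∈ gs, g ∈ C ∨ g = d) :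
    ∃ c0 ∈ C, ∃ cs : List G, (∀ c ∈ cs, c ∈ C) ∧ gs.prod = c0 * (cs.map (d * ·)).prod ∧
      (cs = [] → ∀ g ∈ gs, g ∈ C) := by
  induction gs with
  | nil => exact ⟨1, one_mem _, [], by simp, by simp, by simp⟩
  | cons g gs ih =>
    obtain ⟨c0, h0, cs, h1, h2, h3⟩ := ih (fun g hg' => hg g (List.mem_cons_of_mem _ hg'))
    rcases hg g (List.mem_cons_self) with h | rfl
    · refine ⟨g * c0, mul_mem h h0, cs, h1, by simp [h2, mul_assoc], ?_⟩
      intro h4 g' hg'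
      rcases List.mem_cons.1 hg' with rfl | h5
      · exact h
      · exact h3 h4 _ h5
    · refine ⟨1, one_mem _, c0 :: cs, ?_, by simp [h2, mul_assoc], by simp⟩
      simpa using ⟨h0, h1⟩

theorem rtf_pos (h : IsRTF C ⊤ d) (gs : List G) (hg : ∀ g ∈ gs, g ∈ C ∨ g = d)
    (hd : d ∈ gs) (hp : gs.prod ∈ C) : False := by
  have hdC : d ∉ C := by
    intro hd'
    have := rtf_list h [d⁻¹] (by simp) (by simpa using hd')
    simp at this
  obtain ⟨c0, h0, cs, h1, h2, h3⟩ := rtf_form gs hg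
  rcases List.eq_nil_or_concat cs with rfl | ⟨cs, cl, rfl⟩
  · exact hdC (h3 rfl _ hd)
  have hcl : cl ∈ C := h1 _ (by simp)
  have hq : ((cs ++ [cl]).map (d * ·)).prod = c0⁻¹ * gs.prod := by
    rw [h2]; simp
  refine rtf_list h (cs ++ [cl * (c0⁻¹ * gs.prod)⁻¹]) (by simp) ?_ ?_
  · intro c hc
    rcases List.mem_append.1 hc with hc | hc
    · exact h1 _ (by simp [hc])
    · obtain rfl := List.mem_singleton.1 hc
      exact mul_mem hcl (inv_mem (mul_mem (inv_mem h0) hp))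
  · rw [← hq]
    simp [mul_assoc]

theorem rtf_neg (h : IsRTF C ⊤ d) (gs : List G) (hg : ∀ g ∈ gs, g ∈ C ∨ g = d⁻¹)
    (hd : d⁻¹ ∈ gs) (hp : gs.prod ∈ C) : False := by
  refine rtf_pos h (gs.map (·⁻¹)).reverse ?_ ?_ ?_
  · intro g h1
    simp at h1
    rcases hg _ h1 with h2 | h2
    · left; simpa using h2
    · right; simpa using h2
  · simpa using hd
  · rw [← List.prod_inv_reverse]; exact inv_mem hp

/-- `d` or its inverse. -/
def sg (d : G) (s : Bool) : G := if s then d else d⁻¹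

theorem rf_list (h : IsRF C ⊤ d) (ps : List (Bool × G)) (h0 : ps ≠ []) (hc : ∀ p ∈ ps, p.2 ∈ C)
    (hp : (ps.map fun p => sg d p.1 * p.2).prod = 1) :
    (∃ l1 s c s' c' l2, ps = l1 ++ (s, c) :: (s', c') :: l2 ∧ s ≠ s' ∧ c = 1) ∨
    (∃ s' c' l s c, ps = (s', c') :: (l ++ [(s, c)]) ∧ s ≠ s' ∧ c = 1) := by
  rcases hn : ps.length with _ | k
  · simp at hn; exact absurd hn h0
  by_contra hcon
  push Not at hcon
  obtain ⟨hc1, hc2⟩ := hcon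
  let q : Fin (k + 1) → Bool × G := fun i => ps[i.1]'(by omega)
  refine h k (fun i => if (q i).1 then 1 else -1) (fun i => (q i).2) ?_ ?_ ?_
    (by exact_mod_cast ENat.natCast_lt_top _) (by exact_mod_cast ENat.natCast_lt_top _) ?_
  · intro i; split_ifs <;> simp
  · exact fun i => hc _ (List.getElem_mem _)
  · intro i hi h1
    have hne : (q i).1 ≠ (q (i + 1)).1 := by
      intro h2; rw [h2] at hi; split_ifs at hi <;> simp at hi
    by_cases hik : i.1 < k
    · have e1 : (i + 1).1 = i.1 + 1 := by
        rw [Fin.val_add_one]; split_ifs with h3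
        · rw [h3] at hik; simp at hik
        · rfl
      have hd1 : ps = ps.take i.1 ++ q i :: q (i + 1) :: ps.drop (i.1 + 2) := by
        have w1 : ps.drop i.1 = ps[i.1]'(by omega) :: ps.drop (i.1 + 1) :=
          List.drop_eq_getElem_cons (by omega)
        have w2 : ps.drop (i.1 + 1) = ps[i.1 + 1]'(by omega) :: ps.drop (i.1 + 2) :=
          List.drop_eq_getElem_cons (by omega)
        conv_lhs => rw [← List.take_append_drop i.1 ps, w1, w2]
        simp only [q, e1]
      exact hc1 _ _ _ _ _ _ hd1 hne h1
    · have hi' : i = Fin.last k := by ext; simp; omega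
      subst hi'
      have e1 : Fin.last k + 1 = 0 := by simp
      rw [e1] at hne
      have hk : 0 < k := by
        rcases Nat.eq_zero_or_pos k with rfl | hk
        · exact absurd rfl hne
        · exact hk
      obtain ⟨p0, pt, rfl⟩ := List.exists_cons_of_ne_nil h0
      rcases List.eq_nil_or_concat pt with rfl | ⟨l, pl, rfl⟩
      · simp at hn; omega
      · simp at hn
        have a1 : q 0 = p0 := rfl
        have a2 : q (Fin.last k) = pl := by
          simp only [q, Fin.val_last, ← hn]
          simp
        rw [a1, a2] at hne
        rw [a2] at h1
        exact hc2 p0.1 p0.2 l pl.1 pl.2 (by simp) hne h1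
  · rw [← hp]
    congr 1
    apply List.ext_getElem
    · simp [hn]
    · intro i h1 h2
      simp only [List.getElem_ofFn, List.getElem_map, q, sg]
      split_ifs <;> simp
end RF
end KL

namespace KL
set_option linter.unusedSectionVars false

/-- Kinds of corners. -/
inductive Kd
  | a (i : ℕ) (s : Bool)
  | b (i : ℕ) (s : Bool)
  | x (s : Bool)

noncomputable instance : DecidableEq Kd := Classical.decEq _

namespace Kd

/-- Validity of a corner. -/
def val (M : ℕ) : Kd → Prop
  | a i _ => i ≤ M
  | b i _ => i ≤ M
  | x _ => True

/-- Arrival time. -/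
def arr (M : ℕ) : Kd → ℤ
  | a i s => if i = 0 then 16 * M + 7 else if s then 8 * i - 1 else 16 * M - 8 * i + 7
  | b i s => if s then 8 * i + 3 else 16 * M - 8 * i + 3
  | x s => if s then 8 * M + 6 else 2

/-- Departure time. -/
def dep (M : ℕ) : Kd → ℤ
  | a i s => if i = 0 then 1 else if s then 8 * i + 1 else 16 * M - 8 * i + 9
  | b i s => if s then 8 * i + 5 else 16 * M - 8 * i + 5
  | x s => if s then 16 * M + 6 else 8 * M + 2

/-- Source side. -/
def src : Kd → ℤˣ
  | a _ _ => 1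
  | b _ _ => -1
  | x s => if s then 1 else -1

/-- Target side. -/
def tgt : Kd → ℤˣ
  | a _ _ => 1
  | b _ _ => -1
  | x s => if s then -1 else 1

/-- Sign. -/
def sgn : Kd → Bool
  | a _ s => s
  | b _ s => s
  | x s => s

/-- First `a` corner. -/
def isA0 : Kd → Prop
  | a i _ => i = 0
  | _ => False

/-- Last `b` corner. -/
def isBM (M : ℕ) : Kd → Prop
  | b i _ => i = M
  | _ => False

/-- Time interval. -/
def tm (M : ℕ) (k : Kd) : ℤ × ℤ := (k.arr M, k.dep M)

/-- Step relation. -/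
def step (M : ℕ) (k k' : Kd) : Prop := k'.val M ∧ (k'.isA0 ∨ k'.arr M ≤ k.dep M)

theorem dep_lt {M : ℕ} {k : Kd} (h : k.val M) : k.dep M < 16 * M + 7 := by
  rcases k with ⟨i, s⟩ | ⟨i, s⟩ | s <;> simp only [val, dep] at * <;> split_ifs <;> omega

theorem arr_a0 {M : ℕ} {k : Kd} (h : k.isA0) : k.arr M = 16 * M + 7 := by
  rcases k with ⟨i, s⟩ | ⟨i, s⟩ | s <;> simp only [isA0, arr] at *
  rw [if_pos h]

theorem dep_a0 {M : ℕ} {k : Kd} (h : k.isA0) : k.dep M = 1 := by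
  rcases k with ⟨i, s⟩ | ⟨i, s⟩ | s <;> simp only [isA0, dep] at *
  rw [if_pos h]

theorem arr_le_dep {M : ℕ} {k : Kd} (h : ¬ k.isA0) : k.arr M ≤ k.dep M := by
  rcases k with ⟨i, s⟩ | ⟨i, s⟩ | s <;> simp only [isA0, arr, dep] at * <;>
    split_ifs <;> omega

theorem two_le_arr {M : ℕ} {k : Kd} (h : k.val M) : 2 ≤ k.arr M := by
  rcases k with ⟨i, s⟩ | ⟨i, s⟩ | s <;> simp only [val, arr] at * <;> split_ifs <;> omega

theorem low_step {M : ℕ} {k : Kd} (h : k.val M) (h0 : ¬ k.isA0) (h1 : k.arr M < 8 * M + 6) :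
    k.dep M < 8 * M + 6 := by
  rcases k with ⟨i, s⟩ | ⟨i, s⟩ | s <;> simp only [val, arr, dep, isA0] at * <;>
    split_ifs at * <;> omega

theorem step_f {M : ℕ} {y : ℤ} {k : Kd} (hy : y < 16 * M + 7) :
    ind (k.dep M < k.arr M) - ind (y < k.arr M) ≤ 0 ∧
    (0 ≤ ind (k.dep M < k.arr M) - ind (y < k.arr M) → k.isA0 ∨ k.arr M ≤ y) := by
  by_cases h : k.isA0
  · rw [arr_a0 h, ind_true hy]
    have := ind_le_one (k.dep M < 16 * M + 7)
    exact ⟨by omega, fun _ => .inl h⟩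
  · rw [ind_false (not_lt.2 (arr_le_dep h))]
    have := ind_nonneg (y < k.arr M)
    refine ⟨by omega, fun h2 => .inr ?_⟩
    by_contra h3
    rw [ind_true (not_le.1 h3)] at h2; omega

theorem chain_J {M : ℕ} (ks : List Kd) (k k0 : Kd) (hk : k.val M) (h0 : k0.val M)
    (hv : ∀ k ∈ ks, k.val M) :
    jl (k.dep M) (ks.map (tm M)) (k0.arr M) + ind (k0.dep M < k0.arr M) ≤ 0 ∧
    (0 ≤ jl (k.dep M) (ks.map (tm M)) (k0.arr M) + ind (k0.dep M < k0.arr M) →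
      (k :: (ks ++ [k0])).IsChain (step M)) := by
  induction ks generalizing k with
  | nil =>
    have := step_f (M := M) (k := k0) (dep_lt hk)
    simp only [List.map_nil, jl, List.nil_append]
    refine ⟨by omega, fun h => ?_⟩
    simpa using ⟨h0, this.2 (by omega)⟩
  | cons k' ks ih =>
    have h1 := step_f (M := M) (k := k') (dep_lt hk)
    have hk' : k'.val M := hv _ List.mem_cons_self
    have h2 := ih k' hk' (fun k h => hv k (List.mem_cons_of_mem _ h))
    simp only [List.map_cons, tm, jl, List.cons_append] at *
    refine ⟨by omega, fun h => ?_⟩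
    rw [List.isChain_cons_cons]
    exact ⟨⟨hk', h1.2 (by omega)⟩, h2.2 (by omega)⟩

theorem fwd {α : Type} {R : α → α → Prop} {P : α → Prop} (hP : ∀ x y, P x → R x y → P y)
    (x : α) (l : List α) (hc : (x :: l).IsChain R) (hx : P x) : ∀ y ∈ l, P y := by
  induction l generalizing x with
  | nil => simp
  | cons z l ih =>
    rw [List.isChain_cons_cons] at hc
    have hz := hP _ _ hx hc.1
    intro y hy
    rcases List.mem_cons.1 hy with rfl | hy
    · exact hz
    · exact ih z hc.2 hz y hy

theorem cyc {α : Type} {R : α → α → Prop} {P : α → Prop} (hP : ∀ x y, P x → R x y → P y)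
    (x : α) (l : List α) (hc : (x :: (l ++ [x])).IsChain R) (y : α) (hy : y ∈ x :: l) (hPy : P y) :
    ∀ z ∈ x :: l, P z := by
  have hx : P x := by
    rcases List.mem_cons.1 hy with rfl | hy
    · exact hPy
    · obtain ⟨s, t, rfl⟩ := List.append_of_mem hy
      have : (y :: (t ++ [x])).IsChain R := by
        have h2 : (x :: (s ++ y :: t ++ [x])) = (x :: s) ++ (y :: (t ++ [x])) := by simp
        rw [h2] at hc
        exact (List.isChain_append.1 hc).2.1
      exact fwd hP y _ this hPy x (by simp)
  intro z hz
  rcases List.mem_cons.1 hz with rfl | hz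
  · exact hx
  · exact fwd hP x _ hc hx z (by simp [hz])

/-- The classification of degenerate corner cycles. -/
theorem classify {M : ℕ} (k0 : Kd) (ks : List Kd) (hv : ∀ k ∈ k0 :: ks, k.val M)
    (hJ : 0 ≤ J ((k0 :: ks).map (tm M)))
    (hcnt : (k0 :: ks).count (x true) = (k0 :: ks).count (x false)) :
    (∀ k ∈ k0 :: ks, k.isA0) ∨ ((∀ k ∈ k0 :: ks, k ≠ x true ∧ k ≠ x false) ∧
      ((∀ k ∈ k0 :: ks, k.src = k0.src) →
      ((∀ k ∈ k0 :: ks, k.isBM M) ∨ (∀ k ∈ k0 :: ks, k = k0)))) := by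
  have hk0 := hv _ List.mem_cons_self
  have hC := (chain_J ks k0 k0 hk0 hk0 (fun k h => hv k (List.mem_cons_of_mem _ h))).2 (by
    simp only [List.map_cons, tm, J] at hJ ⊢
    omega)
  by_cases hA : ∃ k ∈ k0 :: ks, k.isA0
  · left
    obtain ⟨k, hk, hka⟩ := hA
    refine cyc (P := isA0) ?_ k0 ks hC k hk hka
    intro x y hx hy
    rcases hy.2 with h | h
    · exact h
    · rw [dep_a0 hx] at h
      have := two_le_arr hy.1
      omega
  right
  push Not at hA
  have hC' : (k0 :: (ks ++ [k0])).IsChain (fun k k' => k'.val M ∧ ¬ k'.isA0 ∧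
      k'.arr M ≤ k.dep M) := by
    refine (List.isChain_iff_getElem.2 fun i hi => ?_)
    have := List.isChain_iff_getElem.1 hC i hi
    have hm : (k0 :: (ks ++ [k0]))[i + 1] ∈ k0 :: ks := by
      have : (k0 :: (ks ++ [k0]))[i + 1] ∈ (k0 :: (ks ++ [k0])) := List.getElem_mem _
      simp only [List.mem_cons, List.mem_append, List.mem_nil_iff, or_false] at this ⊢
      tauto
    exact ⟨this.1, hA _ hm, this.2.resolve_left (hA _ hm)⟩
  have hnox : x true ∉ k0 :: ks := by
    intro h1
    have h2 : x false ∈ k0 :: ks := by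
      rw [← List.count_pos_iff] at h1 ⊢
      omega
    have := cyc (P := fun k => k.dep M < (8 * M + 6 : ℤ)) ?_ k0 ks hC' _ h2 (by simp [dep]) _ h1
    · simp only [dep, if_true] at this; omega
    · intro x y hx hy
      exact low_step hy.1 hy.2.1 (by omega)
  have hnox' : x false ∉ k0 :: ks := by
    intro h1
    rw [← List.count_pos_iff] at h1
    apply hnox
    rw [← List.count_pos_iff]; omega
  refine ⟨fun k hk => ⟨fun h => hnox (h ▸ hk), fun h => hnox' (h ▸ hk)⟩, fun hs => ?_⟩
  have harr : ∀ k ∈ k0 :: ks, k.arr M = k0.arr M := by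
    have hC2 : (k0 :: (ks ++ [k0])).IsChain (fun k k' => k'.arr M ≤ k.arr M) := by
      refine (List.isChain_iff_getElem.2 fun i hi => ?_)
      have := List.isChain_iff_getElem.1 hC' i hi
      have hm : ∀ j, ∀ h : j < (k0 :: (ks ++ [k0])).length,
          (k0 :: (ks ++ [k0]))[j] ∈ k0 :: ks := by
        intro j h
        have : (k0 :: (ks ++ [k0]))[j] ∈ (k0 :: (ks ++ [k0])) := List.getElem_mem _
        simp only [List.mem_cons, List.mem_append, List.mem_nil_iff, or_false] at this ⊢
        tauto
      have m1 := hm i (by omega)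
      have m2 := hm (i + 1) (by omega)
      revert m1 m2 this
      generalize (k0 :: (ks ++ [k0]))[i] = k
      generalize (k0 :: (ks ++ [k0]))[i + 1] = k'
      intro h m1 m2
      have s1 := (hs _ m1).trans (hs _ m2).symm
      have n1 := hA _ m1
      have n2 := hA _ m2
      have x1 : k ≠ x true := fun h => hnox (h ▸ m1)
      have x2 : k ≠ x false := fun h => hnox' (h ▸ m1)
      have x3 : k' ≠ x true := fun h => hnox (h ▸ m2)
      have x4 : k' ≠ x false := fun h => hnox' (h ▸ m2)
      have h := h.2.2
      clear * - s1 n1 n2 x1 x2 x3 x4 h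
      rcases k with ⟨i, s⟩ | ⟨i, s⟩ | s
      · rcases k' with ⟨j, r⟩ | ⟨j, r⟩ | r
        · simp only [isA0, arr, dep] at *
          rw [if_neg n1] at *; rw [if_neg n2] at *
          split_ifs at * <;> omega
        · simp [src] at s1
        · cases r <;> simp at x3 x4
      · rcases k' with ⟨j, r⟩ | ⟨j, r⟩ | r
        · simp [src] at s1
        · simp only [arr, dep] at *
          split_ifs at * <;> omega
        · cases r <;> simp at x3 x4
      · cases s <;> simp at x1 x2
    intro k hk
    apply le_antisymm
    · exact cyc (P := fun k => k.arr M ≤ k0.arr M) (fun x y hx hy => le_trans hy hx) k0 ks hC2 k0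
        (by simp) le_rfl k hk
    · exact cyc (P := fun k' => k'.arr M ≤ k.arr M) (fun x y hx hy => le_trans hy hx) k0 ks hC2 k
        hk le_rfl k0 (by simp)
  by_cases hB : k0.isBM M
  · left
    intro k hk
    have e1 := harr k hk
    have e2 := hs k hk
    have e3 := hv k hk
    have x1 : k ≠ x true := fun h => hnox (h ▸ hk)
    have x2 : k ≠ x false := fun h => hnox' (h ▸ hk)
    clear * - hB e1 e2 e3 x1 x2
    rcases k0 with ⟨i, s⟩ | ⟨i, s⟩ | s
    · simp [isBM] at hB
    · rcases k with ⟨j, r⟩ | ⟨j, r⟩ | r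
      · simp [src] at e2
      · simp only [isBM, arr, val] at *
        split_ifs at * <;> omega
      · cases r <;> simp at x1 x2
    · simp [isBM] at hB
  · right
    intro k hk
    have e1 := harr k hk
    have e2 := hs k hk
    have e3 := hv k hk
    have x1 : k ≠ x true := fun h => hnox (h ▸ hk)
    have x2 : k ≠ x false := fun h => hnox' (h ▸ hk)
    have x3 : k0 ≠ x true := fun h => hnox (h ▸ by simp)
    have x4 : k0 ≠ x false := fun h => hnox' (h ▸ by simp)
    have n1 := hA _ hk
    have n2 := hA k0 (by simp)
    clear * - hB e1 e2 e3 x1 x2 x3 x4 hk0 n1 n2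
    rcases k0 with ⟨i, s⟩ | ⟨i, s⟩ | s
    · rcases k with ⟨j, r⟩ | ⟨j, r⟩ | r
      · simp only [isA0, arr, val] at *
        rw [if_neg n1, if_neg n2] at e1
        cases s <;> cases r <;> simp at e1 <;> simp <;> omega
      · simp [src] at e2
      · cases r <;> simp at x1 x2
    · rcases k with ⟨j, r⟩ | ⟨j, r⟩ | r
      · simp [src] at e2
      · simp only [isBM, arr, val] at *
        cases s <;> cases r <;> simp at e1 <;> simp <;> omega
      · cases r <;> simp at x1 x2
    · cases s <;> simp at x3 x4

theorem J_nonpos {M : ℕ} (k0 : Kd) (ks : List Kd) (hv : ∀ k ∈ k0 :: ks, k.val M) :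
    J ((k0 :: ks).map (tm M)) ≤ 0 := by
  have hk0 := hv _ List.mem_cons_self
  have hC := (chain_J ks k0 k0 hk0 hk0 (fun k h => hv k (List.mem_cons_of_mem _ h))).1
  simp only [List.map_cons, tm, J] at hC ⊢
  omega

end Kd
end KL

namespace KL
set_option linter.unusedSectionVars false
open HNNExtension

/-- The data of the problem. -/
structure Dat (G : Type) [Group G] where
  A : Subgroup G
  B : Subgroup G
  φ : A ≃* B
  M : ℕ
  a : ℕ → G
  b : ℕ → G
  x : G

/-- Tokens: decorated letters. -/
inductive Tk (G : Type)
  | edge (ε : ℤˣ) (s e : ℤ)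
  | cst (σ : ℤˣ) (c : G)
  | cor (k : Kd)

namespace Tk
variable {G : Type}
/-- Source side. -/
def src : Tk G → ℤˣ
  | edge ε _ _ => -ε
  | cst σ _ => σ
  | cor k => k.src
/-- Target side. -/
def tgt : Tk G → ℤˣ
  | edge ε _ _ => ε
  | cst σ _ => σ
  | cor k => k.tgt
/-- Underlying kind, if any. -/
def kd : Tk G → Option Kd
  | cor k => some k
  | _ => none
/-- Not an edge. -/
def ne : Tk G → Prop
  | edge _ _ _ => False
  | _ => True
end Tk

section path
variable {G : Type}
/-- Side-compatible sequences of tokens. -/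
def path : ℤˣ → List (Tk G) → ℤˣ → Prop
  | σ, [], σ' => σ = σ'
  | σ, k :: u, σ' => k.src = σ ∧ path k.tgt u σ'

theorem path_append (σ σ' : ℤˣ) (u v : List (Tk G)) :
    path σ (u ++ v) σ' ↔ ∃ τ, path σ u τ ∧ path τ v σ' := by
  induction u generalizing σ with
  | nil => simp [path]
  | cons k u ih => simp [path, ih, and_assoc]

theorem path_cnt (σ σ' : ℤˣ) (L : List (Tk G)) (hp : path σ L σ') (hn : ∀ τ ∈ L, τ.ne) :
    (σ' : ℤ) + 2 * (L.filterMap Tk.kd).count (Kd.x true) =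
      σ + 2 * (L.filterMap Tk.kd).count (Kd.x false) := by
  induction L generalizing σ with
  | nil => simp only [path] at hp; simp [hp]
  | cons k u ih =>
    obtain ⟨rfl, h2⟩ := hp
    have := ih _ h2 (fun τ h => hn τ (List.mem_cons_of_mem _ h))
    rcases k with ⟨ε, s, e⟩ | ⟨σ, c⟩ | k
    · exact absurd (hn _ List.mem_cons_self) (by simp [Tk.ne])
    · have e : (Tk.cst σ c :: u).filterMap Tk.kd = u.filterMap Tk.kd := rfl
      rw [e]; exact this
    · rcases k with ⟨i, s⟩ | ⟨i, s⟩ | s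
      · simpa [Tk.kd, Tk.src, Tk.tgt, Kd.src, Kd.tgt, List.count_cons] using this
      · simpa [Tk.kd, Tk.src, Tk.tgt, Kd.src, Kd.tgt, List.count_cons] using this
      · cases s <;>
          simp [Tk.kd, Tk.src, Tk.tgt, Kd.src, Kd.tgt, List.count_cons] at this ⊢ <;> omega

theorem path_const (σ σ' : ℤˣ) (L : List (Tk G)) (hp : path σ L σ') (hn : ∀ τ ∈ L, τ.ne)
    (hx : ∀ k, Tk.cor k ∈ L → k ≠ .x true ∧ k ≠ .x false) : ∀ τ ∈ L, τ.src = σ := by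
  induction L generalizing σ with
  | nil => simp
  | cons k u ih =>
    obtain ⟨rfl, h2⟩ := hp
    have hk : k.tgt = k.src := by
      rcases k with ⟨ε, s, e⟩ | ⟨σ, c⟩ | k
      · exact absurd (hn _ List.mem_cons_self) (by simp [Tk.ne])
      · rfl
      · have := hx k (by simp)
        rcases k with ⟨i, s⟩ | ⟨i, s⟩ | s
        · rfl
        · rfl
        · cases s <;> simp at this
    have := ih _ h2 (fun τ h => hn τ (List.mem_cons_of_mem _ h))
      (fun k h => hx k (List.mem_cons_of_mem _ h))
    intro τ hτ
    rcases List.mem_cons.1 hτ with rfl | hτ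
    · rfl
    · rw [this τ hτ, hk]

end path

namespace Dat
variable {G : Type} [Group G] (D : Dat G)

/-- The HNN extension. -/
abbrev H := HNNExtension G D.A D.B D.φ

/-- The associated subgroup on a side. -/
abbrev Sb (σ : ℤˣ) : Subgroup G := toSubgroup D.A D.B σ

/-- Label of a corner. -/
def lab : Kd → G
  | .a i s => sg (D.a i) s
  | .b i s => sg (D.b i) s
  | .x s => sg D.x s

/-- Letter of a token. -/
def lt : Tk G → G ⊕ ℤˣ
  | .edge ε _ _ => .inr ε
  | .cst _ c => .inl c
  | .cor k => .inl (D.lab k)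

/-- Validity of tokens. -/
def ok : Tk G → Prop
  | .edge ε s e => s < e ∧ ∃ j : ℤ, if ε = 1 then 8 * j + 5 ≤ s ∧ e ≤ 8 * j + 7
      else 8 * j + 1 ≤ s ∧ e ≤ 8 * j + 3
  | .cst σ c => c ∈ D.Sb σ
  | .cor k => k.val D.M

/-- Time interval of a token. -/
def tm : Tk G → Option (ℤ × ℤ)
  | .edge _ s e => some (s, e)
  | .cst _ _ => none
  | .cor k => some (k.tm D.M)

/-- Time intervals of a list of tokens. -/
def times (u : List (Tk G)) : List (ℤ × ℤ) := u.filterMap D.tm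

@[simp] theorem times_nil : D.times [] = [] := rfl
@[simp] theorem times_append (u v) : D.times (u ++ v) = D.times u ++ D.times v := by simp [times]
@[simp] theorem times_edge (ε s e u) : D.times (.edge ε s e :: u) = (s, e) :: D.times u := rfl
@[simp] theorem times_cst (σ c u) : D.times (.cst σ c :: u) = D.times u := rfl
@[simp] theorem times_cor (k u) : D.times (.cor k :: u) = k.tm D.M :: D.times u := rfl

theorem ok_disj {ε : ℤˣ} {s e s' e' : ℤ} (h : D.ok (.edge ε s e)) (h' : D.ok (.edge (-ε) s' e')) :
    e < s' ∨ e' < s := by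
  obtain ⟨h1, j, h2⟩ := h
  obtain ⟨h1', j', h2'⟩ := h'
  rcases Int.units_eq_one_or ε with rfl | rfl
  · simp at h2 h2'
    omega
  · simp at h2 h2'
    omega

/-- Evaluation of a token list. -/
noncomputable def evt (u : List (Tk G)) : D.H := ev D.φ (u.map D.lt)

@[simp] theorem evt_nil : D.evt [] = 1 := by simp [evt]
@[simp] theorem evt_cons (τ u) : D.evt (τ :: u) = evl D.φ (D.lt τ) * D.evt u := by simp [evt]
@[simp] theorem evt_append (u v) : D.evt (u ++ v) = D.evt u * D.evt v := by simp [evt]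

/-- Partial products of the relator. -/
noncomputable def S : ℕ → D.H
  | 0 => of (D.a 0) * t⁻¹ * of (D.b 0)
  | i + 1 => S i * t * of (D.a (i + 1)) * t⁻¹ * of (D.b (i + 1))

/-- The relator. -/
noncomputable def W : D.H := D.S D.M * t * of D.x * t
/-- Conjugate of the relator at the first `a`. -/
noncomputable def Va : D.H := (of (D.a 0))⁻¹ * D.W * of (D.a 0)
/-- Conjugate of the relator at the last `b`. -/
noncomputable def Vb : D.H := (t * of D.x * t) * D.W * (t * of D.x * t)⁻¹

/-- Deletion value. -/
noncomputable def dv (d : G) (V : D.H) (s : Bool) : D.H :=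
  if s then of d * V⁻¹ else V * (of d)⁻¹

/-- Deletion value of a corner. -/
noncomputable def del : Kd → D.H
  | .a i s => D.dv (D.a i) D.Va s
  | .b i s => D.dv (D.b i) D.Vb s
  | .x _ => 1

/-- Special corners. -/
def spec (k : Kd) : Prop := k.isA0 ∨ k.isBM D.M

/-- Marked evaluations. -/
inductive Mk : List (Tk G) → ℕ → ℕ → D.H → Prop
  | nil : Mk [] 0 0 1
  | keep (τ u i j h) : Mk u i j h → Mk (τ :: u) i j (evl D.φ (D.lt τ) * h)
  | pos (k u i j h) : D.spec k → k.sgn = true → Mk u i j h →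
      Mk (.cor k :: u) (i + 1) j (D.del k * h)
  | neg (k u i j h) : D.spec k → k.sgn = false → Mk u i j h →
      Mk (.cor k :: u) i (j + 1) (D.del k * h)

variable {D}

theorem Mk.append {u v i j h i' j' h'} (hu : D.Mk u i j h) (hv : D.Mk v i' j' h') :
    D.Mk (u ++ v) (i + i') (j + j') (h * h') := by
  induction hu with
  | nil => simpa using hv
  | keep τ u i j h _ ih => rw [mul_assoc]; exact Mk.keep _ _ _ _ _ ih
  | pos k u i j h h1 h2 _ ih =>
    rw [mul_assoc, show i + 1 + i' = i + i' + 1 by omega]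
    exact Mk.pos _ _ _ _ _ h1 h2 ih
  | neg k u i j h h1 h2 _ ih =>
    rw [mul_assoc, show j + 1 + j' = j + j' + 1 by omega]
    exact Mk.neg _ _ _ _ _ h1 h2 ih

theorem Mk.split {u v i j h} (hu : D.Mk (u ++ v) i j h) :
    ∃ i1 j1 h1 i2 j2 h2, D.Mk u i1 j1 h1 ∧ D.Mk v i2 j2 h2 ∧ i = i1 + i2 ∧ j = j1 + j2 ∧
      h = h1 * h2 := by
  induction u generalizing i j h with
  | nil => exact ⟨0, 0, 1, i, j, h, .nil, hu, by simp, by simp, by simp⟩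
  | cons τ u ih =>
    rw [List.cons_append] at hu
    cases hu with
    | keep _ _ _ _ h' hu =>
      obtain ⟨i1, j1, h1, i2, j2, h2, a1, a2, rfl, rfl, rfl⟩ := ih hu
      exact ⟨_, _, _, _, _, _, .keep _ _ _ _ _ a1, a2, rfl, rfl, by rw [mul_assoc]⟩
    | pos k _ _ _ h' s1 s2 hu =>
      obtain ⟨i1, j1, h1, i2, j2, h2, a1, a2, rfl, rfl, rfl⟩ := ih hu
      exact ⟨_, _, _, _, _, _, .pos _ _ _ _ _ s1 s2 a1, a2, by omega, rfl, by rw [mul_assoc]⟩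
    | neg k _ _ _ h' s1 s2 hu =>
      obtain ⟨i1, j1, h1, i2, j2, h2, a1, a2, rfl, rfl, rfl⟩ := ih hu
      exact ⟨_, _, _, _, _, _, .neg _ _ _ _ _ s1 s2 a1, a2, rfl, by omega, by rw [mul_assoc]⟩

theorem Mk.all (u : List (Tk G)) : D.Mk u 0 0 (D.evt u) := by
  induction u with
  | nil => simpa using Mk.nil
  | cons τ u ih => rw [evt_cons]; exact Mk.keep _ _ _ _ _ ih

theorem Mk.sandwich (p q : List (Tk G)) {Y i j} (h : D.Mk Y i j (D.evt Y)) :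
    D.Mk (p ++ Y ++ q) i j (D.evt (p ++ Y ++ q)) := by
  have := ((Mk.all p).append h).append (Mk.all q)
  simpa [mul_assoc] using this

/-- Tokens without marks. -/
theorem Mk.plain {u : List (Tk G)} (hu : ∀ τ ∈ u, τ.kd = none) {i j h} (hm : D.Mk u i j h) :
    i = 0 ∧ j = 0 ∧ h = D.evt u := by
  induction hm with
  | nil => simp
  | keep τ u i j h _ ih =>
    obtain ⟨rfl, rfl, rfl⟩ := ih (fun τ h => hu τ (List.mem_cons_of_mem _ h))
    simp
  | pos k u i j h _ _ _ _ => have := hu (.cor k) (by simp); simp [Tk.kd] at this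
  | neg k u i j h _ _ _ _ => have := hu (.cor k) (by simp); simp [Tk.kd] at this

/-- Admissible corner for the element `d`. -/
def Adm (D : Dat G) (d : G) (V : D.H) (k : Kd) : Prop :=
  D.spec k ∧ D.lab k = sg d k.sgn ∧ D.del k = D.dv d V k.sgn

theorem pair_mark {d : G} {V : D.H} {k k' : Kd} (hk : Adm D d V k) (hk' : Adm D d V k')
    (hs : k.sgn ≠ k'.sgn) (Y : List (Tk G)) (hY : D.evt Y = 1) :
    D.Mk (.cor k :: Y ++ [.cor k']) 1 1 (D.evt (.cor k :: Y ++ [.cor k'])) := by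
  obtain ⟨h1, h2, h3⟩ := hk
  obtain ⟨h1', h2', h3'⟩ := hk'
  have e1 : D.evt (.cor k :: Y ++ [.cor k']) = 1 := by
    simp only [evt_append, evt_cons, hY, evt_nil, lt, h2, h2', evl_inl, mul_one]
    rw [← map_mul]
    have : sg d k.sgn * sg d k'.sgn = 1 := by
      cases hh : k.sgn <;> cases hh' : k'.sgn <;> simp_all [sg]
    rw [this, map_one]
  rw [e1]
  have e2 : D.del k * D.del k' = 1 := by
    rw [h3, h3']
    cases hh : k.sgn <;> cases hh' : k'.sgn <;> simp_all [dv]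
  have hY' := Mk.all (D := D) Y
  rw [hY] at hY'
  cases hh : k.sgn
  · have hh' : k'.sgn = true := by cases hq : k'.sgn <;> simp_all
    have m1 := Mk.neg k [] 0 0 1 h1 hh .nil
    have m2 := Mk.pos k' [] 0 0 1 h1' hh' .nil
    have := (m1.append hY').append m2
    simpa [e2] using this
  · have hh' : k'.sgn = false := by cases hq : k'.sgn <;> simp_all
    have m1 := Mk.pos k [] 0 0 1 h1 hh .nil
    have m2 := Mk.neg k' [] 0 0 1 h1' hh' .nil
    have := (m1.append hY').append m2
    simpa [e2] using this

/-- Concatenated blocks. -/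
def blk (qs : List (Kd × List (Tk G) × G)) : List (Tk G) :=
  qs.flatMap fun q => .cor q.1 :: q.2.1

theorem blk_append (p q : List (Kd × List (Tk G) × G)) : blk (p ++ q) = blk p ++ blk q := by
  simp [blk]

/-- Good block. -/
def GB (D : Dat G) (C : Subgroup G) (d : G) (V : D.H) (q : Kd × List (Tk G) × G) : Prop :=
  Adm D d V q.1 ∧ q.2.2 ∈ C ∧ D.evt q.2.1 = of q.2.2

theorem blk_decomp {C : Subgroup G} {d : G} {V : D.H} (L : List (Tk G))
    (hL : ∀ τ ∈ L, (∃ σ c, τ = .cst σ c ∧ c ∈ C) ∨ ∃ k, τ = .cor k ∧ Adm D d V k) :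
    ∃ K0 c0 qs, L = K0 ++ blk qs ∧ c0 ∈ C ∧ D.evt K0 = of c0 ∧ (∀ q ∈ qs, GB D C d V q) ∧
      (qs = [] → ∀ k, Tk.cor k ∉ L) := by
  induction L with
  | nil => exact ⟨[], 1, [], by simp [blk], one_mem _, by simp, by simp, by simp⟩
  | cons τ L ih =>
    obtain ⟨K0, c0, qs, rfl, h1, h2, h3, h4⟩ := ih (fun τ h => hL τ (List.mem_cons_of_mem _ h))
    rcases hL τ List.mem_cons_self with ⟨σ, c, rfl, hc⟩ | ⟨k, rfl, hk⟩
    · refine ⟨.cst σ c :: K0, c * c0, qs, rfl, mul_mem hc h1, by simp [lt, h2], h3, ?_⟩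
      intro h5 k hk
      simp only [List.mem_cons, reduceCtorEq, false_or] at hk
      exact h4 h5 k hk
    · refine ⟨[], 1, (k, K0, c0) :: qs, by simp [blk], one_mem _, by simp, ?_, by simp⟩
      intro q hq
      rcases List.mem_cons.1 hq with rfl | hq
      · exact ⟨hk, h1, h2⟩
      · exact h3 q hq

theorem blk_ev {C : Subgroup G} {d : G} {V : D.H} (qs : List (Kd × List (Tk G) × G))
    (h : ∀ q ∈ qs, GB D C d V q) :
    D.evt (blk qs) = of (qs.map fun q => sg d q.1.sgn * q.2.2).prod := by
  induction qs with
  | nil => simp [blk]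
  | cons q qs ih =>
    have h1 := h q List.mem_cons_self
    have h2 := ih (fun q hq => h q (List.mem_cons_of_mem _ hq))
    have : blk (q :: qs) = (.cor q.1 :: q.2.1) ++ blk qs := by simp [blk]
    rw [this]
    simp [h2, lt, h1.1.2.1, h1.2.2, mul_assoc]

theorem rf_mark {C : Subgroup G} {d : G} {V : D.H} (hRF : IsRF C ⊤ d) (L : List (Tk G))
    (hL : ∀ τ ∈ L, (∃ σ c, τ = .cst σ c ∧ c ∈ C) ∨ ∃ k, τ = .cor k ∧ Adm D d V k)
    (hcor : ∃ k, Tk.cor k ∈ L) (e : G) (he : e ∈ C) (hev : D.evt L = of e) :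
    D.Mk L 1 1 (D.evt L) := by
  obtain ⟨K0, c0, qs, rfl, h1, h2, h3, h4⟩ := blk_decomp L hL
  rcases List.eq_nil_or_concat' qs with rfl | ⟨qs, ql, rfl⟩
  · obtain ⟨k, hk⟩ := hcor
    exact absurd hk (h4 rfl k)
  have hq := fun q (hq : q ∈ qs) => h3 q (by simp [hq])
  have hql : GB D C d V ql := h3 ql (by simp)
  have hE : c0 * ((qs.map fun q => sg d q.1.sgn * q.2.2).prod * (sg d ql.1.sgn * ql.2.2)) = e := by
    rw [evt_append, h2, blk_ev _ h3, ← map_mul] at hev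
    have := of_injective (φ := D.φ) hev
    simpa using this
  have hrf := rf_list hRF (qs.map (fun q => (q.1.sgn, q.2.2)) ++
    [(ql.1.sgn, ql.2.2 * e⁻¹ * c0)]) (by simp) (by
      intro p hp
      rcases List.mem_append.1 hp with hp | hp
      · obtain ⟨q, hq', rfl⟩ := List.mem_map.1 hp
        exact (hq q hq').2.1
      · obtain rfl := List.mem_singleton.1 hp
        exact mul_mem (mul_mem hql.2.1 (inv_mem he)) h1) (by
      rw [← hE]
      simp [Function.comp_def, mul_assoc])
  rcases hrf with ⟨l1, s, c, s', c', l2, e1, hs, rfl⟩ | ⟨s', c', l, s, c, e1, hs, rfl⟩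
  · have : ∃ r1 q q' r2, qs ++ [ql] = r1 ++ q :: q' :: r2 ∧ q.1.sgn ≠ q'.1.sgn ∧ q.2.2 = 1 := by
      rcases List.eq_nil_or_concat' l2 with rfl | ⟨l2, z, rfl⟩
      · rw [show l1 ++ [(s, 1), (s', c')] = (l1 ++ [(s, 1)]) ++ [(s', c')] by simp] at e1
        obtain ⟨e2, e3⟩ := List.append_inj' e1 rfl
        obtain ⟨r1, r2, rfl, e4, e5⟩ := List.map_eq_append_iff.1 e2
        obtain ⟨q, r3, rfl, e6, e7⟩ := List.map_eq_cons_iff.1 e5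
        obtain rfl := List.map_eq_nil_iff.1 e7
        simp only [Prod.mk.injEq, List.cons.injEq] at e3 e6
        exact ⟨r1, q, ql, [], by simp, by rw [e6.1, e3.1.1]; exact hs, e6.2⟩
      · rw [show l1 ++ (s, 1) :: (s', c') :: (l2 ++ [z]) =
          (l1 ++ (s, 1) :: (s', c') :: l2) ++ [z] by simp] at e1
        obtain ⟨e2, e3⟩ := List.append_inj' e1 rfl
        obtain ⟨r1, r2, rfl, e4, e5⟩ := List.map_eq_append_iff.1 e2
        obtain ⟨q, r3, rfl, e6, e7⟩ := List.map_eq_cons_iff.1 e5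
        obtain ⟨q', r4, rfl, e8, e9⟩ := List.map_eq_cons_iff.1 e7
        simp only [Prod.mk.injEq] at e6 e8
        exact ⟨r1, q, q', r4 ++ [ql], by simp, by rw [e6.1, e8.1]; exact hs, e6.2⟩
    obtain ⟨r1, q, q', r2, e2, e3, e4⟩ := this
    rw [e2] at h3 ⊢
    have g1 := h3 q (by simp)
    have g2 := h3 q' (by simp)
    have hm := pair_mark g1.1 g2.1 e3 q.2.1 (by rw [g1.2.2, e4, map_one])
    have := Mk.sandwich (K0 ++ blk r1) (q'.2.1 ++ blk r2) hm
    have e5 : K0 ++ blk r1 ++ (Tk.cor q.1 :: q.2.1 ++ [Tk.cor q'.1]) ++ (q'.2.1 ++ blk r2) =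
        K0 ++ blk (r1 ++ q :: q' :: r2) := by simp [blk]
    rwa [e5] at this
  · rw [← List.cons_append] at e1
    obtain ⟨e2, e3⟩ := List.append_inj' e1 rfl
    obtain ⟨q, r, rfl, e4, e5⟩ := List.map_eq_cons_iff.1 e2
    simp only [Prod.mk.injEq, List.cons.injEq] at e3 e4
    have g1 := hq q (by simp)
    have hsg : q.1.sgn ≠ ql.1.sgn := by rw [e4.1, e3.1.1]; exact fun h => hs h.symm
    have hY : D.evt (q.2.1 ++ blk r) = 1 := by
      have hr : ∀ q ∈ r, GB D C d V q := fun q h => hq q (List.mem_cons_of_mem _ h)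
      rw [evt_append, g1.2.2, blk_ev _ hr, ← map_mul]
      rw [List.map_cons, List.prod_cons] at hE
      have hss : sg d ql.1.sgn = (sg d q.1.sgn)⁻¹ := by
        cases hh : q.1.sgn <;> cases hh' : ql.1.sgn <;> simp_all [sg]
      have h5 := e3.1.2
      rw [hss] at hE
      generalize (r.map fun q => sg d q.1.sgn * q.2.2).prod = P at *
      generalize sg d q.1.sgn = f at *
      have h6 : e = c0 * ql.2.2 := by
        have : ql.2.2 * e⁻¹ * c0 = 1 := h5
        have h7 : e⁻¹ = ql.2.2⁻¹ * c0⁻¹ := by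
          calc e⁻¹ = ql.2.2⁻¹ * (ql.2.2 * e⁻¹ * c0) * c0⁻¹ := by group
            _ = _ := by rw [this]; group
        rw [← inv_inv e, h7]; group
      have h8 : q.2.2 * P = 1 := by
        calc q.2.2 * P = f⁻¹ * c0⁻¹ * (c0 * (f * q.2.2 * P * (f⁻¹ * ql.2.2))) * ql.2.2⁻¹ * f := by
              group
          _ = 1 := by rw [hE, h6]; group
      rw [h8, map_one]
    have hm := pair_mark g1.1 hql.1 hsg _ hY
    have := Mk.sandwich K0 ql.2.1 hm
    have e5 : K0 ++ (Tk.cor q.1 :: (q.2.1 ++ blk r) ++ [Tk.cor ql.1]) ++ ql.2.1 =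
        K0 ++ blk (q :: r ++ [ql]) := by simp [blk]
    rwa [e5] at this

/-- The hypotheses on the data. -/
structure Good (D : Dat G) : Prop where
  a0 : IsRF (D.Sb 1) ⊤ (D.a 0)
  bM : IsRF (D.Sb (-1)) ⊤ (D.b D.M)
  aR : ∀ i ≤ D.M, IsRTF (D.Sb 1) ⊤ (D.a i)
  bR : ∀ i ≤ D.M, IsRTF (D.Sb (-1)) ⊤ (D.b i)

theorem times_ne (L : List (Tk G)) (hn : ∀ τ ∈ L, τ.ne) :
    D.times L = (L.filterMap Tk.kd).map (Kd.tm D.M) := by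
  induction L with
  | nil => rfl
  | cons τ L ih =>
    have := ih (fun τ h => hn τ (List.mem_cons_of_mem _ h))
    rcases τ with ⟨ε, s, e⟩ | ⟨σ, c⟩ | k
    · exact absurd (hn _ List.mem_cons_self) (by simp [Tk.ne])
    · have e : (Tk.cst σ c :: L).filterMap Tk.kd = L.filterMap Tk.kd := rfl
      rw [e, times_cst]; exact this
    · simpa [Tk.kd] using this

theorem rtf_crash {C : Subgroup G} {d : G} (hR : IsRTF C ⊤ d) (s : Bool) (gs : List G)
    (hg : ∀ g ∈ gs, g ∈ C ∨ g = sg d s) (hd : sg d s ∈ gs) (hp : gs.prod ∈ C) : False := by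
  cases s
  · exact rtf_neg hR gs (by simpa [sg] using hg) (by simpa [sg] using hd) hp
  · exact rtf_pos hR gs (by simpa [sg] using hg) (by simpa [sg] using hd) hp

theorem mem_kds (L : List (Tk G)) (k : Kd) : k ∈ L.filterMap Tk.kd ↔ Tk.cor k ∈ L := by
  rw [List.mem_filterMap]
  constructor
  · rintro ⟨τ, h, h2⟩
    rcases τ with ⟨ε, s, e⟩ | ⟨σ, c⟩ | k' <;> simp [Tk.kd] at h2
    rwa [← h2]
  · exact fun h => ⟨_, h, rfl⟩

theorem crash (hD : D.Good) (ε : ℤˣ) (L : List (Tk G)) (gs : List G)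
    (hgs : L.map D.lt = gs.map Sum.inl) (hp : path ε L ε) (hok : ∀ τ ∈ L, D.ok τ)
    (hc : gs.prod ∈ D.Sb ε) :
    (D.times L = [] ∨ J (D.times L) ≤ -1) ∨ D.Mk L 1 1 (D.evt L) := by
  have hn : ∀ τ ∈ L, τ.ne := by
    intro τ hτ
    rcases τ with ⟨ε, s, e⟩ | ⟨σ, c⟩ | k
    · have : D.lt (.edge ε s e) ∈ L.map D.lt := List.mem_map_of_mem hτ
      rw [hgs] at this; simp [lt] at this
    · trivial
    · trivial
  have hev : D.evt L = of gs.prod := by rw [evt, hgs, ev_map_inl]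
  rw [times_ne L hn]
  have hmem := mem_kds L
  have hcnt := path_cnt ε ε L hp hn
  rcases hk : L.filterMap Tk.kd with _ | ⟨k0, ks⟩
  · left; left; simp
  rw [hk] at hmem hcnt
  have hval : ∀ k ∈ k0 :: ks, k.val D.M := fun k h => hok _ ((hmem k).1 h)
  by_cases hJ : J ((k0 :: ks).map (Kd.tm D.M)) ≤ -1
  · exact .inl (.inr hJ)
  right
  have hk0 : Tk.cor k0 ∈ L := (hmem k0).1 (by simp)
  rcases Kd.classify k0 ks hval (by omega) (by omega) with hA | ⟨hx, hcl⟩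
  · have hsrc := path_const ε ε L hp hn (fun k h => by
      have := hA k ((hmem k).2 h)
      constructor <;> rintro rfl <;> simp [Kd.isA0] at this)
    have hε : ε = 1 := by
      have h1 := hsrc _ hk0
      have h2 := hA k0 (by simp)
      rcases k0 with ⟨i, s⟩ | ⟨i, s⟩ | s
      · exact h1.symm
      · simp [Kd.isA0] at h2
      · simp [Kd.isA0] at h2
    subst hε
    refine rf_mark (C := D.Sb 1) (d := D.a 0) (V := D.Va) hD.a0 L ?_ ⟨k0, hk0⟩ _ hc hev
    intro τ hτ
    have h1 := hsrc τ hτ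
    have h2 := hok τ hτ
    rcases τ with ⟨ε, s, e⟩ | ⟨σ, c⟩ | k
    · exact absurd (hn _ hτ) (by simp [Tk.ne])
    · left
      simp only [Tk.src] at h1
      subst h1
      exact ⟨_, c, rfl, h2⟩
    · right
      refine ⟨k, rfl, ?_⟩
      have h3 := hA k ((hmem k).2 hτ)
      refine ⟨.inl h3, ?_⟩
      rcases k with ⟨i, s⟩ | ⟨i, s⟩ | s
      · obtain rfl : i = 0 := h3
        exact ⟨rfl, rfl⟩
      · simp [Kd.isA0] at h3
      · simp [Kd.isA0] at h3
  · have hsrc := path_const ε ε L hp hn (fun k h => hx k ((hmem k).2 h))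
    have hs' : ∀ k ∈ k0 :: ks, k.src = ε := fun k h => hsrc _ ((hmem k).1 h)
    rcases hcl (fun k h => (hs' k h).trans (hs' k0 (by simp)).symm) with hB | hK
    · have hε : ε = -1 := by
        have h1 := hsrc _ hk0
        have h2 := hB k0 (by simp)
        rcases k0 with ⟨i, s⟩ | ⟨i, s⟩ | s
        · simp [Kd.isBM] at h2
        · exact h1.symm
        · simp [Kd.isBM] at h2
      subst hε
      refine rf_mark (C := D.Sb (-1)) (d := D.b D.M) (V := D.Vb) hD.bM L ?_ ⟨k0, hk0⟩ _ hc hev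
      intro τ hτ
      have h1 := hsrc τ hτ
      have h2 := hok τ hτ
      rcases τ with ⟨ε, s, e⟩ | ⟨σ, c⟩ | k
      · exact absurd (hn _ hτ) (by simp [Tk.ne])
      · left
        simp only [Tk.src] at h1
        subst h1
        exact ⟨_, c, rfl, h2⟩
      · right
        refine ⟨k, rfl, ?_⟩
        have h3 := hB k ((hmem k).2 hτ)
        refine ⟨.inr h3, ?_⟩
        rcases k with ⟨i, s⟩ | ⟨i, s⟩ | s
        · simp [Kd.isBM] at h3
        · obtain rfl : i = D.M := h3
          exact ⟨rfl, rfl⟩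
        · simp [Kd.isBM] at h3
    · exfalso
      have key : ∀ g ∈ gs, g ∈ D.Sb ε ∨ g = D.lab k0 := by
        intro g hg
        have : (Sum.inl g : G ⊕ ℤˣ) ∈ L.map D.lt := by rw [hgs]; exact List.mem_map_of_mem hg
        obtain ⟨τ, hτ, h5⟩ := List.mem_map.1 this
        have h1 := hsrc τ hτ
        have h2 := hok τ hτ
        rcases τ with ⟨ε, s, e⟩ | ⟨σ, c⟩ | k
        · simp [lt] at h5
        · left
          simp only [Tk.src] at h1
          subst h1
          simp only [lt, Sum.inl.injEq] at h5
          rw [← h5]; exact h2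
        · right
          simp only [lt, Sum.inl.injEq] at h5
          rw [← h5, hK k ((hmem k).2 hτ)]
      have key2 : D.lab k0 ∈ gs := by
        have : D.lt (.cor k0) ∈ L.map D.lt := List.mem_map_of_mem hk0
        rw [hgs] at this
        simpa [lt] using this
      have hs0 := hs' k0 (by simp)
      have hx0 := hx k0 (by simp)
      have hv0 := hval k0 (by simp)
      rcases k0 with ⟨i, s⟩ | ⟨i, s⟩ | s
      · obtain rfl : 1 = ε := hs0
        exact rtf_crash (hD.aR i hv0) s gs key key2 hc
      · obtain rfl : -1 = ε := hs0
        exact rtf_crash (hD.bR i hv0) s gs key key2 hc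
      · cases s <;> simp at hx0

end Dat
end KL

namespace KL
set_option linter.unusedSectionVars false
set_option linter.unusedSimpArgs false
open HNNExtension

theorem split_inl {G : Type} (gs gs' : List G) (a b : ℤˣ) (m m' : List (G ⊕ ℤˣ))
    (h : gs.map Sum.inl ++ Sum.inr a :: m = gs'.map Sum.inl ++ Sum.inr b :: m') :
    gs = gs' ∧ a = b ∧ m = m' := by
  induction gs generalizing gs' with
  | nil =>
    cases gs' with
    | nil => simpa using h
    | cons g gs' => simp at h
  | cons g gs ih =>
    cases gs' with
    | nil => simp at h
    | cons g' gs' =>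
      simp only [List.map_cons, List.cons_append, List.cons.injEq, Sum.inl.injEq] at h
      obtain ⟨h1, h2, h3⟩ := ih gs' h.2
      exact ⟨by rw [h.1, h1], h2, h3⟩

namespace Dat
variable {G : Type} [Group G] (D : Dat G)

/-- Control of the marked evaluations. -/
def Rem (n : ℕ) (u : List (Tk G)) : Prop :=
  ∀ i j h, i ≤ 1 → j ≤ 1 → D.Mk u i j h → ∃ k, k + i + j = n ∧ E D.W k h

/-- Real nodes, as token lists. -/
def Real (n : ℕ) (u : List (Tk G)) : Prop :=
  ∃ σ, path σ u σ ∧ (∀ τ ∈ u, D.ok τ) ∧ 1 ≤ J (D.times u) ∧ D.Rem n u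

/-- Nodes without stable letters. -/
def TA (X : List (G ⊕ ℤˣ)) : Prop := ∃ gs : List G, X = gs.map Sum.inl ∧ gs.prod = 1

/-- Trivial nodes. -/
def TT (X : List (G ⊕ ℤˣ)) : Prop :=
  ∃ (ε : ℤˣ) (P K Q : List G),
    X = P.map Sum.inl ++ Sum.inr ε :: (K.map Sum.inl ++ Sum.inr (-ε) :: Q.map Sum.inl) ∧
    (∀ g ∈ P, g ∈ D.Sb (-ε)) ∧ (∀ g ∈ K, g ∈ D.Sb ε) ∧ (∀ g ∈ Q, g ∈ D.Sb (-ε)) ∧ ev D.φ X = 1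

/-- Nodes. -/
def Dn (n : ℕ) (X : List (G ⊕ ℤˣ)) : Prop :=
  (n = 0 ∧ TA X) ∨ (n = 0 ∧ D.TT X) ∨ ∃ u, u.map D.lt = X ∧ D.Real n u

variable {D}

theorem Dn.rot1 {n z l} (h : D.Dn n (z :: l)) : D.Dn n (l ++ [z]) := by
  rcases h with ⟨rfl, gs, h1, h2⟩ | ⟨rfl, ε, P, K, Q, h1, hP, hK, hQ, h2⟩ | ⟨u, h1, σ, hp, hok, hJ, hR⟩
  · left
    cases gs with
    | nil => simp at h1
    | cons g gs =>
      simp only [List.map_cons, List.cons.injEq] at h1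
      refine ⟨rfl, gs ++ [g], by simp [h1.1, h1.2], ?_⟩
      simp only [List.prod_cons] at h2
      simp [(mul_eq_one_iff_eq_inv.1 h2)]
  · right; left
    have hev : ev D.φ (l ++ [z]) = 1 := by
      rw [ev_cons] at h2
      simp [(mul_eq_one_iff_eq_inv.1 h2)]
    cases P with
    | nil =>
      simp only [List.map_nil, List.nil_append, List.cons.injEq] at h1
      refine ⟨rfl, -ε, K, Q, [], ?_, ?_, hQ, by simp, hev⟩
      · simp [h1.1, h1.2]
      · simpa using hK
    | cons p P =>
      simp only [List.map_cons, List.cons_append, List.cons.injEq] at h1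
      refine ⟨rfl, ε, P, K, Q ++ [p], ?_, ?_, hK, ?_, hev⟩
      · simp [h1.1, h1.2]
      · exact fun g hg => hP g (List.mem_cons_of_mem _ hg)
      · intro g hg
        rcases List.mem_append.1 hg with hg | hg
        · exact hQ g hg
        · exact hP g (by simp_all)
  · right; right
    cases u with
    | nil => simp at h1
    | cons τ u =>
      simp only [List.map_cons, List.cons.injEq] at h1
      refine ⟨u ++ [τ], by simp [h1.1, h1.2], τ.tgt, ?_, ?_, ?_, ?_⟩
      · obtain ⟨h3, h4⟩ := hp
        rw [path_append]
        exact ⟨σ, h4, h3, rfl⟩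
      · intro τ' h; apply hok
        simp at h ⊢; tauto
      · rw [times_append, J_rot, ← times_append]; exact hJ
      · intro i j h hi hj hm
        obtain ⟨i1, j1, h1, i2, j2, h2, a1, a2, rfl, rfl, rfl⟩ := hm.split
        obtain ⟨k, hk, hE⟩ := hR _ _ _ (by omega) (by omega) (a2.append a1)
        exact ⟨k, by omega, hE.comm⟩

theorem Dn.rot {n x y} (h : D.Dn n (x ++ y)) : D.Dn n (y ++ x) := by
  induction x generalizing y with
  | nil => simpa using h
  | cons z x ih =>
    have h2 : D.Dn n (z :: (x ++ y)) := h
    have := h2.rot1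
    rw [List.append_assoc] at this
    simpa using ih this

theorem Dn.toE {n X} (h : D.Dn n X) : E D.W n (ev D.φ X) := by
  rcases h with ⟨rfl, gs, rfl, h2⟩ | ⟨rfl, ε, P, K, Q, h1, hP, hK, hQ, h2⟩ | ⟨u, rfl, σ, hp, hok, hJ, hR⟩
  · simpa [h2] using E.one
  · rw [h2]; exact E.one
  · obtain ⟨k, hk, hE⟩ := hR 0 0 _ (by omega) (by omega) (Mk.all u)
    have : k = n := by omega
    subst this; exact hE

theorem lt_inl_ne {τ : Tk G} {g} (h : D.lt τ = Sum.inl g) : τ.ne := by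
  rcases τ with ⟨ε, s, e⟩ | ⟨σ, c⟩ | k <;> simp [lt, Tk.ne] at *

theorem lt_inr {τ : Tk G} {ε} (h : D.lt τ = Sum.inr ε) : ∃ s e, τ = .edge ε s e := by
  rcases τ with ⟨ε, s, e⟩ | ⟨σ, c⟩ | k <;> simp [lt] at *
  exact h

theorem Dn.noT {n} {gs : List G} (h : D.Dn n (gs.map Sum.inl)) : n = 0 ∧ gs.prod = 1 := by
  rcases h with ⟨rfl, gs', h1, h2⟩ | ⟨rfl, ε, P, K, Q, h1, -⟩ | ⟨u, h1, σ, hp, hok, hJ, hR⟩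
  · rw [List.map_injective_iff.2 Sum.inl_injective h1]; exact ⟨rfl, h2⟩
  · exfalso
    have : nt (gs.map Sum.inl : List (G ⊕ ℤˣ)) = 0 := nt_map _
    rw [h1] at this; simp at this
  · exfalso
    have hne : ∀ τ ∈ u, τ.ne := by
      intro τ hτ
      have : D.lt τ ∈ u.map D.lt := List.mem_map_of_mem hτ
      rw [h1] at this
      obtain ⟨g, -, hg⟩ := List.mem_map.1 this
      exact lt_inl_ne hg.symm
    rw [times_ne u hne] at hJ
    have hv : ∀ k ∈ u.filterMap Tk.kd, k.val D.M := by
      intro k hk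
      exact hok _ ((mem_kds _ _).1 hk)
    rcases hk : u.filterMap Tk.kd with _ | ⟨k0, ks⟩
    · rw [hk] at hJ; simp [J] at hJ
    · rw [hk] at hJ hv
      have := Kd.J_nonpos k0 ks hv
      simp only [List.map_cons] at this hJ
      omega

theorem Dn.fold (hD : D.Good) {n ε m d} {gs : List G}
    (h : D.Dn n (.inr ε :: (gs.map Sum.inl ++ .inr (-ε) :: m))) (hc : Cr D.φ ε gs.prod d) :
    (∃ k, k < n ∧ E D.W k (ev D.φ (.inr ε :: (gs.map Sum.inl ++ .inr (-ε) :: m)))) ∨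
      D.Dn n (.inl d :: m) := by
  have hcev := hc.ev
  rcases h with ⟨rfl, gs', h1, h2⟩ | ⟨rfl, ε', P, K, Q, h1, hP, hK, hQ, h2⟩ |
      ⟨u, h1, σ, hp, hok, hJ, hR⟩
  · cases gs' <;> simp at h1
  · right; left
    have h3 := split_inl [] P ε ε' _ _ (by simpa using h1)
    obtain ⟨rfl, rfl, h4⟩ := h3
    obtain ⟨rfl, -, rfl⟩ := split_inl _ _ _ _ _ _ h4
    refine ⟨rfl, d :: Q, by simp, ?_⟩
    apply of_injective (φ := D.φ)
    simp only [ev_cons, ev_append, ev_map_inl, evl_inr_neg] at h2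
    rw [map_one, ← h2, List.prod_cons, map_mul, ← mul_assoc, hcev]; group
  · obtain ⟨τ, u1, rfl, e1, e2⟩ := List.map_eq_cons_iff.1 h1
    obtain ⟨s, e, rfl⟩ := lt_inr e1
    obtain ⟨L, u2, rfl, e3, e4⟩ := List.map_eq_append_iff.1 e2
    obtain ⟨τ', R, rfl, e5, rfl⟩ := List.map_eq_cons_iff.1 e4
    obtain ⟨s', e', rfl⟩ := lt_inr e5
    simp only [path, Tk.src, Tk.tgt] at hp
    obtain ⟨rfl, hp⟩ := hp
    obtain ⟨τ, hp1, hp2, hp3⟩ := (path_append _ _ _ _).1 hp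
    simp only [Tk.src, neg_neg] at hp2
    subst hp2
    have ok1 := hok (.edge ε s e) (by simp)
    have ok2 := hok (.edge (-ε) s' e') (by simp)
    rcases crash hD ε L gs e3 hp1 (fun τ h => hok τ (by simp [h])) hc.mem with hh | hh
    · right; right; right
      refine ⟨.cst (-ε) d :: R, by simp [lt], -ε, ⟨rfl, hp3⟩, ?_, ?_, ?_⟩
      · intro τ h
        rcases List.mem_cons.1 h with rfl | h
        · exact hc.mem'
        · exact hok τ (by simp [h])
      · rw [times_cst]
        simp only [times_edge, times_append] at hJ
        exact J_fold _ _ _ _ _ _ hJ ok1.1 ok2.1 (D.ok_disj ok1 ok2) hh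
      · intro i j h hi hj hm
        obtain ⟨i1, j1, h1, i2, j2, h2, a1, a2, rfl, rfl, rfl⟩ :=
          Mk.split (u := [Tk.cst (-ε) d]) (v := R) hm
        obtain ⟨rfl, rfl, rfl⟩ := a1.plain (by simp [Tk.kd])
        have := (Mk.all ([Tk.edge ε s e] ++ L ++ [Tk.edge (-ε) s' e'])).append a2
        simp only [List.append_assoc, List.cons_append, List.nil_append] at this
        obtain ⟨k, hk, hE⟩ := hR _ _ _ (by omega) (by omega) this
        refine ⟨k, by omega, ?_⟩
        convert hE using 1
        have eL : D.evt L = of gs.prod := by rw [evt, e3, ev_map_inl]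
        simp only [evt_cons, evt_append, evt_nil, lt, eL, evl_inl, evl_inr_neg, mul_one]
        rw [← mul_assoc (evl D.φ _), hcev]; group
    · left
      have := Mk.sandwich [Tk.edge ε s e] (Tk.edge (-ε) s' e' :: R) hh
      simp only [List.append_assoc, List.cons_append, List.nil_append] at this
      obtain ⟨k, hk, hE⟩ := hR _ _ _ le_rfl le_rfl this
      refine ⟨k, by omega, ?_⟩
      rw [← h1]; exact hE

theorem TT.head {ε m} (h : D.TT (.inr ε :: m)) : ∃ K Q : List G,
    m = K.map Sum.inl ++ Sum.inr (-ε) :: Q.map Sum.inl ∧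
    (∀ g ∈ K, g ∈ D.Sb ε) ∧ (∀ g ∈ Q, g ∈ D.Sb (-ε)) ∧
    of K.prod * (evl D.φ (.inr ε))⁻¹ * of Q.prod = (evl D.φ (.inr ε))⁻¹ := by
  obtain ⟨ε', P, K, Q, h1, hP, hK, hQ, h2⟩ := h
  obtain ⟨rfl, rfl, h4⟩ := split_inl [] P ε ε' _ _ (by simpa using h1)
  refine ⟨K, Q, h4, hK, hQ, ?_⟩
  simp only [h4, ev_cons, ev_append, ev_map_inl, evl_inr_neg] at h2
  rw [← mul_assoc (of K.prod)] at h2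
  exact eq_inv_of_mul_eq_one_right h2

theorem path_cst (σ : ℤˣ) (K : List G) : path σ (K.map (Tk.cst σ)) σ := by
  induction K with
  | nil => rfl
  | cons c K ih => exact ⟨rfl, ih⟩

theorem times_csts (σ : ℤˣ) (K : List G) : D.times (K.map (Tk.cst σ)) = [] := by
  induction K with
  | nil => rfl
  | cons c K ih => simpa using ih

theorem lt_csts (σ : ℤˣ) (K : List G) : (K.map (Tk.cst σ)).map D.lt = K.map Sum.inl := by
  simp [Function.comp_def, lt]

theorem evt_csts (σ : ℤˣ) (K : List G) : D.evt (K.map (Tk.cst σ)) = of K.prod := by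
  rw [evt, lt_csts, ev_map_inl]

theorem merge_TR {ε k n m m' c d} (h : D.TT (.inr ε :: m)) (hk : k = 0)
    (h' : ∃ u, u.map D.lt = .inr (-ε) :: m' ∧ D.Real n u)
    (hc : Cr D.φ ε c d) : D.Dn (k + n) (.inl d :: (m' ++ .inl c⁻¹ :: m)) := by
  subst hk
  obtain ⟨K, Q, rfl, hK, hQ, hev⟩ := h.head
  obtain ⟨u, h1, σ, hp, hok, hJ, hR⟩ := h'
  obtain ⟨τ, u1, rfl, e1, rfl⟩ := List.map_eq_cons_iff.1 h1
  obtain ⟨s, e, rfl⟩ := lt_inr e1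
  simp only [path, Tk.src, Tk.tgt, neg_neg] at hp
  obtain ⟨rfl, hp⟩ := hp
  right; right
  refine ⟨[.cst (-ε) d] ++ (u1 ++ ([.cst ε c⁻¹] ++ K.map (Tk.cst ε) ++ [.edge (-ε) s e] ++
    Q.map (Tk.cst (-ε)))), ?_, -ε, ?_, ?_, ?_, ?_⟩
  · simp only [List.map_append, lt_csts]; simp [lt]
  · rw [path_append]
    refine ⟨-ε, ⟨rfl, rfl⟩, ?_⟩
    rw [path_append]
    refine ⟨ε, hp, ?_⟩
    rw [path_append]
    refine ⟨-ε, ?_, path_cst _ _⟩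
    rw [path_append]
    refine ⟨ε, ?_, by simp [path, Tk.src, Tk.tgt]⟩
    exact ⟨rfl, path_cst _ _⟩
  · intro τ hτ
    simp only [List.mem_append, List.mem_singleton, List.mem_map] at hτ
    rcases hτ with rfl | hτ | ((rfl | ⟨g, hg, rfl⟩) | rfl) | ⟨g, hg, rfl⟩
    · exact hc.mem'
    · exact hok τ (by simp [hτ])
    · exact inv_mem hc.mem
    · exact hK g hg
    · exact hok _ (by simp)
    · exact hQ g hg
  · simp only [times_append, times_csts, times_cst, times_edge, times_nil, List.nil_append,
      List.append_nil]
    rw [J_rot]; exact hJ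
  · intro i j h hi hj hm
    obtain ⟨i1, j1, h1, i2, j2, h2, a1, a2, rfl, rfl, rfl⟩ := Mk.split hm
    obtain ⟨rfl, rfl, rfl⟩ := a1.plain (by simp [Tk.kd])
    obtain ⟨i1, j1, h1, i3, j3, h3, a3, a4, rfl, rfl, rfl⟩ := Mk.split a2
    obtain ⟨rfl, rfl, rfl⟩ := a4.plain (by
      intro τ hτ
      simp only [List.mem_append, List.mem_singleton, List.mem_map] at hτ
      rcases hτ with ((rfl | ⟨g, hg, rfl⟩) | rfl) | ⟨g, hg, rfl⟩ <;> rfl)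
    obtain ⟨k, hk, hE⟩ := hR _ _ _ (by omega) (by omega) (Mk.keep (Tk.edge (-ε) s e) _ _ _ _ a3)
    refine ⟨k, by omega, ?_⟩
    have := hE.comm.conj (of d)
    convert this using 1
    have hcc := hc.ev
    simp only [evt_cons, evt_append, evt_nil, lt, evl_inl, evl_inr_neg, mul_one, evt_csts]
    have h5 : of c⁻¹ * (evl D.φ (.inr ε))⁻¹ = (evl D.φ (.inr ε))⁻¹ * (of d)⁻¹ := by
      rw [map_inv, ← mul_inv_rev, hcc, mul_inv_rev]
    rw [mul_assoc (of c⁻¹), mul_assoc (of c⁻¹), hev, h5]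
    group

theorem Dn.merge {ε k n m m' c d} (h : D.Dn k (.inr ε :: m)) (h' : D.Dn n (.inr (-ε) :: m'))
    (hc : Cr D.φ ε c d) : D.Dn (k + n) (.inl d :: (m' ++ .inl c⁻¹ :: m)) := by
  rcases h with ⟨-, gs', h1, -⟩ | ⟨hk, h⟩ | ⟨u, h1, hu⟩
  · cases gs' <;> simp at h1
  · rcases h' with ⟨-, gs', h1, -⟩ | ⟨rfl, h'⟩ | h'
    · cases gs' <;> simp at h1
    · subst hk
      obtain ⟨K, Q, rfl, hK, hQ, hev⟩ := h.head
      obtain ⟨K', Q', rfl, hK', hQ', hev'⟩ := h'.head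
      right; left
      simp only [neg_neg, evl_inr_neg, inv_inv] at *
      refine ⟨trivial, ε, d :: K', Q' ++ c⁻¹ :: K, Q, by simp, ?_, ?_, hQ, ?_⟩
      · intro g hg
        rcases List.mem_cons.1 hg with rfl | hg
        · exact hc.mem'
        · exact hK' g hg
      · intro g hg
        simp only [List.mem_append, List.mem_cons] at hg
        rcases hg with hg | rfl | hg
        · exact hQ' g hg
        · exact inv_mem hc.mem
        · exact hK g hg
      · simp only [ev_cons, ev_append, ev_map_inl, evl_inl, evl_inr_neg, ← mul_assoc] at *
        have h5 : evl D.φ (.inr ε) * of c⁻¹ = of d⁻¹ * evl D.φ (.inr ε) := hc.inv.ev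
        calc _ = of d * (of K'.prod * evl D.φ (.inr ε) * of Q'.prod) * of c⁻¹ *
              (of K.prod * (evl D.φ (.inr ε))⁻¹ * of Q.prod) := by group
          _ = _ := by
            rw [hev, hev', mul_assoc (of d), h5, map_inv]; group
    · exact merge_TR h hk h' hc
  · rcases h' with ⟨-, gs', h1, -⟩ | ⟨rfl, h'⟩ | ⟨u', h1', hu'⟩
    · cases gs' <;> simp at h1
    · have := merge_TR (k := 0) h' rfl ⟨u, by rw [neg_neg]; exact h1, hu⟩ hc.symm.inv
      rw [inv_inv] at this
      have := Dn.rot (x := .inl c⁻¹ :: m) (y := .inl d :: m') (by simpa using this)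
      simpa using this
    · right; right
      obtain ⟨σ, hp, hok, hJ, hR⟩ := hu
      obtain ⟨σ', hp', hok', hJ', hR'⟩ := hu'
      obtain ⟨τ, u1, rfl, e1, rfl⟩ := List.map_eq_cons_iff.1 h1
      obtain ⟨s, e, rfl⟩ := lt_inr e1
      obtain ⟨τ, u1', rfl, e1', rfl⟩ := List.map_eq_cons_iff.1 h1'
      obtain ⟨s', e', rfl⟩ := lt_inr e1'
      simp only [path, Tk.src, Tk.tgt, neg_neg] at hp hp'
      obtain ⟨rfl, hp⟩ := hp
      obtain ⟨rfl, hp'⟩ := hp'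
      have ok1 := hok (.edge ε s e) (by simp)
      have ok2 := hok' (.edge (-ε) s' e') (by simp)
      refine ⟨[.cst (-ε) d] ++ (u1' ++ ([.cst ε c⁻¹] ++ u1)), by simp [lt], -ε, ?_, ?_, ?_, ?_⟩
      · refine ⟨rfl, ?_⟩
        exact (path_append _ _ u1' _).2 ⟨ε, hp', rfl, hp⟩
      · intro τ hτ
        simp only [List.mem_append, List.mem_singleton] at hτ
        rcases hτ with rfl | hτ | rfl | hτ
        · exact hc.mem'
        · exact hok' τ (by simp [hτ])
        · exact inv_mem hc.mem
        · exact hok τ (by simp [hτ])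
      · simp only [times_append, times_cst, times_edge, times_nil, List.nil_append] at *
        exact J_merge _ _ _ _ _ _ hJ hJ' ok1.1 ok2.1 (D.ok_disj ok1 ok2)
      · intro i j h hi hj hm
        obtain ⟨i1, j1, h1, i2, j2, h2, a1, a2, rfl, rfl, rfl⟩ := Mk.split hm
        obtain ⟨rfl, rfl, rfl⟩ := a1.plain (by simp [Tk.kd])
        obtain ⟨i1, j1, h1, i3, j3, h3, a3, a4, rfl, rfl, rfl⟩ := Mk.split a2
        obtain ⟨i4, j4, h4, i5, j5, h5, a5, a6, rfl, rfl, rfl⟩ := Mk.split a4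
        obtain ⟨rfl, rfl, rfl⟩ := a5.plain (by simp [Tk.kd])
        obtain ⟨k1, hk1, hE1⟩ := hR' _ _ _ (by omega) (by omega)
          (Mk.keep (Tk.edge (-ε) s' e') _ _ _ _ a3)
        obtain ⟨k2, hk2, hE2⟩ := hR _ _ _ (by omega) (by omega)
          (Mk.keep (Tk.edge ε s e) _ _ _ _ a6)
        refine ⟨k1 + k2, by omega, ?_⟩
        have := (hE1.conj (of d * evl D.φ (.inr ε))).mul hE2
        convert this using 1
        have h6 : of c⁻¹ = (evl D.φ (.inr ε))⁻¹ * (of d)⁻¹ * evl D.φ (.inr ε) := by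
          have := hc.inv.ev
          rw [mul_assoc, ← map_inv, ← this]; group
        simp only [evt_cons, evt_nil, lt, evl_inl, evl_inr_neg, mul_one]
        rw [h6]; group

end Dat
end KL

namespace KL
set_option linter.unusedSectionVars false
set_option linter.unusedSimpArgs false
open HNNExtension

theorem cons_split {α : Type} {p r m1 m2 : List α} {z : α} (h : p ++ z :: r = m1 ++ m2) :
    (∃ r1, m1 = p ++ z :: r1 ∧ r = r1 ++ m2) ∨ (∃ p2, p = m1 ++ p2 ∧ m2 = p2 ++ z :: r) := by
  rcases List.append_eq_append_iff.1 h with ⟨a, h1, h2⟩ | ⟨a, h1, h2⟩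
  · cases a with
    | nil => right; exact ⟨[], by simpa using h1.symm, by simpa using h2.symm⟩
    | cons y a =>
      simp only [List.cons_append, List.cons.injEq] at h2
      obtain ⟨rfl, rfl⟩ := h2
      exact .inl ⟨a, h1, rfl⟩
  · right; exact ⟨a, h1, h2⟩

theorem map_split {G : Type} {gs : List G} {x y : List (G ⊕ ℤˣ)}
    (h : gs.map Sum.inl = x ++ y) : ∃ g1 g2 : List G, gs = g1 ++ g2 ∧ x = g1.map Sum.inl ∧
      y = g2.map Sum.inl := by
  obtain ⟨g1, g2, h1, h2, h3⟩ := List.map_eq_append_iff.1 h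
  exact ⟨g1, g2, h1, h2.symm, h3.symm⟩

namespace Dat
variable {G : Type} [Group G] (D : Dat G)

/-- Planar nestings of nodes. -/
inductive P : ℕ → List (G ⊕ ℤˣ) → Prop
  | nil : P 0 []
  | ins (n k m1 X m2) : P n (m1 ++ m2) → D.Dn k X → P (n + k) (m1 ++ (X ++ m2))
  | del (n m1) (hs : List G) (m2) : P n (m1 ++ (hs.map Sum.inl ++ m2)) → hs.prod = 1 →
      P n (m1 ++ m2)

/-- Reducibility. -/
def Red (n : ℕ) (h : D.H) : Prop := ∃ k, k < n ∧ E D.W k h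

variable {D}

theorem P.toE {n W} (h : D.P n W) : E D.W n (ev D.φ W) := by
  induction h with
  | nil => simpa using E.one
  | ins n k m1 X m2 _ hX ih =>
    have := (hX.toE.conj (ev D.φ m1)).mul ih
    rw [add_comm]
    convert this using 1
    simp only [ev_append]; group
  | del n m1 hs m2 _ hp ih =>
    simpa [hp] using ih

theorem Red.ins {n k m1 X m2} (h : D.Red n (ev D.φ (m1 ++ m2))) (hX : D.Dn k X) :
    D.Red (n + k) (ev D.φ (m1 ++ (X ++ m2))) := by
  obtain ⟨l, hl, hE⟩ := h
  refine ⟨k + l, by omega, ?_⟩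
  have := (hX.toE.conj (ev D.φ m1)).mul hE
  convert this using 1
  simp only [ev_append]; group

theorem Red.ins' {n k m1 X m2} (h : D.P n (m1 ++ m2)) (hX : D.Red k (ev D.φ X)) :
    D.Red (n + k) (ev D.φ (m1 ++ (X ++ m2))) := by
  obtain ⟨l, hl, hE⟩ := hX
  refine ⟨l + n, by omega, ?_⟩
  have := (hE.conj (ev D.φ m1)).mul h.toE
  convert this using 1
  simp only [ev_append]; group

theorem P.noT {n W} (h : D.P n W) (h0 : nt W = 0) : ev D.φ W = 1 := by
  induction h with
  | nil => simp
  | ins n k m1 X m2 _ hX ih =>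
    simp only [nt_append] at h0
    have := ih (by simp only [nt_append]; omega)
    obtain ⟨gs, rfl⟩ := nt_eq_zero X (by omega)
    have h2 := hX.noT.2
    simpa [h2] using this
  | del n m1 hs m2 _ hp ih =>
    have := ih (by simpa using h0)
    simpa [hp] using this

theorem P.absorb {n k W} (h : D.P n W) {p r x' c d} {ε : ℤˣ} (hW : p ++ .inr ε :: r = W)
    (hX : D.Dn k (.inr (-ε) :: x')) (hc : Cr D.φ ε c d) :
    D.P (n + k) (p ++ .inl d :: (x' ++ .inl c⁻¹ :: r)) := by
  induction h generalizing p r with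
  | nil => simp at hW
  | ins n k1 m1 X m2 hP hX1 ih =>
    rw [show n + k1 + k = n + k + k1 by omega]
    rcases cons_split hW with ⟨r1, rfl, rfl⟩ | ⟨p2, rfl, h2⟩
    · have := ih (p := p) (r := r1 ++ m2) (by simp)
      have := P.ins _ _ (p ++ .inl d :: (x' ++ .inl c⁻¹ :: r1)) X m2 (by simpa using this) hX1
      simpa using this
    rcases cons_split h2.symm with ⟨r1, rfl, rfl⟩ | ⟨p3, rfl, rfl⟩
    · have h3 := Dn.rot hX1
      rw [List.cons_append] at h3
      have h4 := h3.merge hX hc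
      have h5 := Dn.rot (x := .inl d :: (x' ++ .inl c⁻¹ :: r1)) (y := p2) (by simpa using h4)
      have := P.ins _ _ m1 _ m2 hP h5
      rw [show n + k + k1 = n + (k1 + k) by omega]
      simpa using this
    · have := ih (p := m1 ++ p3) (r := r) (by simp)
      have := P.ins _ _ m1 X (p3 ++ .inl d :: (x' ++ .inl c⁻¹ :: r)) (by simpa using this) hX1
      simpa using this
  | del n m1 hs m2 hP hp ih =>
    rcases cons_split hW with ⟨r1, rfl, rfl⟩ | ⟨p2, rfl, rfl⟩
    · have := ih (p := p) (r := r1 ++ (hs.map Sum.inl ++ m2)) (by simp)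
      have := P.del _ (p ++ .inl d :: (x' ++ .inl c⁻¹ :: r1)) hs m2 (by simpa using this) hp
      simpa using this
    · have := ih (p := m1 ++ (hs.map Sum.inl ++ p2)) (r := r) (by simp)
      have := P.del _ m1 hs (p2 ++ .inl d :: (x' ++ .inl c⁻¹ :: r)) (by simpa using this) hp
      simpa using this

theorem P.pinch (hD : D.Good) {n W} (h : D.P n W) {p q d} {ε : ℤˣ} {gs : List G}
    (hW : p ++ .inr ε :: (gs.map Sum.inl ++ .inr (-ε) :: q) = W)
    (hc : Cr D.φ ε gs.prod d) :
    D.Red n (ev D.φ W) ∨ D.P n (p ++ .inl d :: q) := by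
  induction h generalizing p gs q with
  | nil => simp at hW
  | ins n k m1 X m2 hP hX ih =>
    rcases cons_split hW with ⟨r1, rfl, h1⟩ | ⟨p2, rfl, h2⟩
    · rcases cons_split h1 with ⟨q1, rfl, rfl⟩ | ⟨p2, h3, h4⟩
      · rcases ih (p := p) (gs := gs) (q := q1 ++ m2) (by simp) hc with h | h
        · exact .inl (h.ins hX)
        · right
          have := P.ins _ _ (p ++ .inl d :: q1) X m2 (by simpa using h) hX
          simpa using this
      · rcases cons_split h4.symm with ⟨x2, rfl, rfl⟩ | ⟨p3, rfl, rfl⟩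
        · obtain ⟨g1, g2, rfl, rfl, rfl⟩ := map_split h3
          right
          have h5 := Dn.rot hX
          rw [List.cons_append] at h5
          have h6 := hP.absorb (p := p) (r := g1.map Sum.inl ++ m2) (by simp) h5 hc
          have h7 := P.del _ (p ++ .inl d :: x2) (g2 ++ (g1 ++ g2).prod⁻¹ :: g1) m2
            (by simpa using h6) (by simp)
          simpa using h7
        · obtain ⟨g1, g2, rfl, rfl, h5⟩ := map_split h3
          obtain ⟨g2, g3, rfl, rfl, rfl⟩ := map_split h5.symm
          obtain ⟨rfl, hk⟩ := hX.noT
          rcases ih (p := p) (gs := g1 ++ g3) (q := q) (by simp) (by simpa [hk] using hc) with h | h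
          · left; exact h.ins hX
          · right; exact h
    · rcases cons_split h2.symm with ⟨x2, rfl, h3⟩ | ⟨p3, rfl, rfl⟩
      · rcases cons_split h3 with ⟨q1, rfl, rfl⟩ | ⟨p3, h4, rfl⟩
        · have h5 := Dn.rot hX
          simp only [List.cons_append, List.append_assoc] at h5
          rcases h5.fold hD hc with ⟨l, hl, hE⟩ | h
          · left
            refine Red.ins' hP ⟨l, hl, ?_⟩
            have : E D.W l (ev D.φ (.inr ε :: (gs.map Sum.inl ++ .inr (-ε) :: q1)) * ev D.φ p2) := by
              simpa [mul_assoc] using hE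
            have := this.comm
            simpa using this
          · right
            have h6 := Dn.rot (x := .inl d :: q1) (y := p2) (by simpa using h)
            have := P.ins _ _ m1 _ m2 hP h6
            simpa using this
        · obtain ⟨g1, g2, rfl, rfl, rfl⟩ := map_split h4
          right
          have h5 := Dn.rot hX
          rw [List.cons_append] at h5
          have h6 := hP.absorb (p := m1 ++ g2.map Sum.inl) (r := q) (by simp)
            (by rw [neg_neg]; exact h5) hc.symm.inv
          have h7 := P.del _ m1 (g2 ++ (g1 ++ g2).prod⁻¹ :: g1) (p2 ++ .inl d :: q)
            (by simpa using h6) (by simp)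
          simpa using h7
      · rcases ih (p := m1 ++ p3) (gs := gs) (q := q) (by simp) hc with h | h
        · exact .inl (h.ins hX)
        · right
          have := P.ins _ _ m1 X (p3 ++ .inl d :: q) (by simpa using h) hX
          simpa using this
  | del n m1 hs m2 hP hp ih =>
    have hev : ev D.φ (m1 ++ (hs.map Sum.inl ++ m2)) = ev D.φ (m1 ++ m2) := by simp [hp]
    rw [hev] at ih
    rcases cons_split hW with ⟨r1, rfl, h1⟩ | ⟨p2, rfl, rfl⟩
    · rcases cons_split h1 with ⟨q1, rfl, rfl⟩ | ⟨p2, h3, rfl⟩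
      · rcases ih (p := p) (gs := gs) (q := q1 ++ (hs.map Sum.inl ++ m2)) (by simp) hc with h | h
        · exact .inl h
        · right
          have := P.del _ (p ++ .inl d :: q1) hs m2 (by simpa using h) hp
          simpa using this
      · obtain ⟨g1, g2, rfl, rfl, rfl⟩ := map_split h3
        exact ih (p := p) (gs := g1 ++ (hs ++ g2)) (q := q) (by simp) (by simpa [hp] using hc)
    · rcases ih (p := m1 ++ (hs.map Sum.inl ++ p2)) (gs := gs) (q := q) (by simp) hc with h | h
      · exact .inl h
      · right
        have := P.del _ m1 hs (p2 ++ .inl d :: q) (by simpa using h) hp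
        simpa using this

theorem stem (l : List (G ⊕ ℤˣ)) : ∃ l' : List (G ⊕ ℤˣ), ev D.φ l' = (ev D.φ l)⁻¹ ∧
    ∀ n m1 m2, D.P n (m1 ++ m2) → D.P n (m1 ++ l ++ (l' ++ m2)) := by
  induction l with
  | nil => exact ⟨[], by simp, fun n m1 m2 h => by simpa using h⟩
  | cons z l ih =>
    obtain ⟨l', h1, h2⟩ := ih
    have : ∃ z', evl D.φ z' = (evl D.φ z)⁻¹ ∧ D.Dn 0 [z, z'] := by
      rcases z with g | ε
      · exact ⟨.inl g⁻¹, by simp, .inl ⟨rfl, [g, g⁻¹], by simp, by simp⟩⟩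
      · exact ⟨.inr (-ε), by simp, .inr (.inl ⟨rfl, ε, [], [], [], by simp, by simp, by simp,
          by simp, by simp⟩)⟩
    obtain ⟨z', h3, h4⟩ := this
    refine ⟨l' ++ [z'], by simp [h1, h3], ?_⟩
    intro n m1 m2 h
    have h5 := P.ins _ _ m1 _ m2 h h4
    have := h2 _ (m1 ++ [z]) (z' :: m2) (by simpa using h5)
    simpa using this

theorem ev_surj (g : D.H) : ∃ l, ev D.φ l = g := by
  induction g using HNNExtension.induction_on with
  | of g => exact ⟨[.inl g], by simp⟩
  | t => exact ⟨[.inr 1], by simp [evl_inr]⟩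
  | mul x y hx hy =>
    obtain ⟨l, rfl⟩ := hx
    obtain ⟨l', rfl⟩ := hy
    exact ⟨l ++ l', by simp⟩
  | inv x hx =>
    obtain ⟨l, rfl⟩ := hx
    obtain ⟨l', h, -⟩ := stem (D := D) l
    exact ⟨l', h⟩

theorem P.ofE (hp : ∃ X, D.Dn 1 X ∧ ev D.φ X = D.W)
    (hn : ∃ X g, D.Dn 1 X ∧ ev D.φ X = g * D.W⁻¹ * g⁻¹) {n h} (hE : E D.W n h) :
    ∃ W, D.P n W ∧ ev D.φ W = h := by
  induction hE with
  | one => exact ⟨[], .nil, by simp⟩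
  | pos n h g _ ih =>
    obtain ⟨W, h1, rfl⟩ := ih
    obtain ⟨X, hX, hX2⟩ := hp
    obtain ⟨l, rfl⟩ := ev_surj (D := D) g
    obtain ⟨l', h3, h4⟩ := stem (D := D) l
    have := P.ins _ _ l X (l' ++ W) (by simpa using h4 n [] W (by simpa using h1)) hX
    exact ⟨_, this, by simp [h3, hX2, mul_assoc]⟩
  | neg n h g _ ih =>
    obtain ⟨W, h1, rfl⟩ := ih
    obtain ⟨X, g0, hX, hX2⟩ := hn
    obtain ⟨l, hl⟩ := ev_surj (D := D) (g * g0⁻¹)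
    obtain ⟨l', h3, h4⟩ := stem (D := D) l
    have := P.ins _ _ l X (l' ++ W) (by simpa using h4 n [] W (by simpa using h1)) hX
    exact ⟨_, this, by simp [h3, hX2, hl, mul_assoc]⟩

theorem P.main (hD : D.Good) (hp : ∃ X, D.Dn 1 X ∧ ev D.φ X = D.W)
    (hn : ∃ X g, D.Dn 1 X ∧ ev D.φ X = g * D.W⁻¹ * g⁻¹) (n : ℕ) :
    ∀ (N : ℕ) (W : List (G ⊕ ℤˣ)) (y : G), D.P n W → nt W = N → ev D.φ W = of y →
      ev D.φ W = 1 := by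
  induction n using Nat.strong_induction_on with
  | _ n ihn =>
  intro N
  induction N using Nat.strong_induction_on with
  | _ N ihN =>
  intro W y hP hN hy
  rcases pinch_or D.φ W y hy with ⟨p, ε, gs, q, rfl, hm⟩ | ⟨gs, rfl⟩
  · obtain ⟨d, hc⟩ := Cr.exists (φ := D.φ) hm
    rcases hP.pinch hD rfl hc with ⟨k, hk, hE⟩ | h
    · obtain ⟨W', h1, h2⟩ := P.ofE hp hn hE
      rw [← h2]
      exact ihn k hk _ W' y h1 rfl (by rw [h2, hy])
    · have e : ev D.φ (p ++ .inr ε :: (gs.map Sum.inl ++ .inr (-ε) :: q)) =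
          ev D.φ (p ++ .inl d :: q) := by
        simp only [ev_append, ev_cons, ev_map_inl, evl_inr_neg, evl_inl]
        rw [← mul_assoc (evl D.φ _), hc.ev]; group
      rw [e]
      refine ihN _ ?_ _ y h rfl (by rw [← e, hy])
      rw [← hN]; simp
  · exact hP.noT (by simp)

end Dat
end KL

namespace KL
set_option linter.unusedSectionVars false
set_option linter.unusedSimpArgs false
open HNNExtension
namespace Dat
variable {G : Type} [Group G] (D : Dat G)

/-- Control of special corners along a word. -/
def Ch (N : D.H) (s : Bool) : D.H → List (Tk G) → Prop
  | _, [] => True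
  | R, τ :: u => (∀ k, τ = .cor k → D.spec k → k.sgn = s ∧
      R * D.del k = N⁻¹ * (R * of (D.lab k))) ∧ Ch N s (R * evl D.φ (D.lt τ)) u

variable {D}

theorem Ch.append {N : D.H} {s : Bool} {R : D.H} {u v : List (Tk G)} (h : D.Ch N s R u)
    (h' : D.Ch N s (R * D.evt u) v) : D.Ch N s R (u ++ v) := by
  induction u generalizing R with
  | nil => simpa using h'
  | cons τ u ih =>
    refine ⟨h.1, ih h.2 ?_⟩
    simpa [mul_assoc] using h'

theorem Ch.mk {N : D.H} {s : Bool} {R : D.H} {u : List (Tk G)} (h : D.Ch N s R u)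
    {i j g} (hm : D.Mk u i j g) : (s = true → j = 0) ∧ (s = false → i = 0) ∧
      (i + j = 0 → g = D.evt u) ∧ (i + j = 1 → R * g = N⁻¹ * (R * D.evt u)) := by
  induction hm generalizing R with
  | nil => simp
  | keep τ u i j g _ ih =>
    obtain ⟨h1, h2, h3, h4⟩ := ih h.2
    refine ⟨h1, h2, fun e => by rw [h3 e, evt_cons], fun e => ?_⟩
    have := h4 e
    rw [evt_cons, ← mul_assoc, this]; group
  | pos k u i j g hs hg _ ih =>
    obtain ⟨h1, h2, h3, h4⟩ := ih h.2
    obtain ⟨h5, h6⟩ := h.1 k rfl hs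
    refine ⟨h1, fun e => ?_, fun e => by omega, fun e => ?_⟩
    · rw [e, hg] at h5; simp at h5
    · rw [h3 (by omega), ← mul_assoc, h6, evt_cons, lt, evl_inl]; group
  | neg k u i j g hs hg _ ih =>
    obtain ⟨h1, h2, h3, h4⟩ := ih h.2
    obtain ⟨h5, h6⟩ := h.1 k rfl hs
    refine ⟨fun e => ?_, h2, fun e => by omega, fun e => ?_⟩
    · rw [e, hg] at h5; simp at h5
    · rw [h3 (by omega), ← mul_assoc, h6, evt_cons, lt, evl_inl]; group

variable (D) in
/-- Invariant for prefixes of base words. -/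
def Inv (N : D.H) (s : Bool) (u : List (Tk G)) (σ : ℤˣ) (z : ℤ) (g : D.H) : Prop :=
  path 1 u σ ∧ (∀ τ ∈ u, D.ok τ) ∧ D.Ch N s 1 u ∧ D.evt u = g ∧
    ∃ l, D.times u = (16 * (D.M : ℤ) + 7, 1) :: l ∧ ∀ z', jl 1 l z' = -ind (z < z')

theorem Inv.cast {N : D.H} {s : Bool} {u : List (Tk G)} {σ σ' : ℤˣ} {z z' : ℤ} {g g' : D.H}
    (h : D.Inv N s u σ z g) (h1 : σ = σ') (h2 : z = z') (h3 : g = g') :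
    D.Inv N s u σ' z' g' := by subst h1 h2 h3; exact h

theorem Inv.step {N : D.H} {s : Bool} {u : List (Tk G)} {σ : ℤˣ} {z : ℤ} {g : D.H}
    (h : D.Inv N s u σ z g) (τ : Tk G) (e : ℤ) (hs : τ.src = σ) (hok : D.ok τ)
    (ht : D.tm τ = some (z, e)) (hz : z ≤ e)
    (hch : ∀ k, τ = .cor k → D.spec k → k.sgn = s ∧ g * D.del k = N⁻¹ * (g * of (D.lab k))) :
    D.Inv N s (u ++ [τ]) τ.tgt e (g * evl D.φ (D.lt τ)) := by
  obtain ⟨h1, h2, h3, h4, l, h5, h6⟩ := h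
  refine ⟨(path_append _ _ _ _).2 ⟨σ, h1, hs, rfl⟩, ?_, h3.append ⟨?_, trivial⟩, by simp [h4],
    l ++ [(z, e)], ?_, ?_⟩
  · intro τ' h
    rcases List.mem_append.1 h with h | h
    · exact h2 _ h
    · rw [List.mem_singleton.1 h]; exact hok
  · rw [h4, one_mul]; exact hch
  · rw [times_append, h5]; simp [times, ht]
  · intro z'
    rw [jl_append, h6, ind_false (lt_irrefl z), ind_false (not_lt.2 hz)]
    simp [jl]

theorem Inv.edge {N : D.H} {s : Bool} {u : List (Tk G)} {σ : ℤˣ} {z : ℤ} {g : D.H}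
    (h : D.Inv N s u σ z g) (ε : ℤˣ) (e : ℤ) (hs : σ = -ε) (hok : D.ok (.edge ε z e)) :
    D.Inv N s (u ++ [.edge ε z e]) ε e (g * evl D.φ (.inr ε)) :=
  h.step (.edge ε z e) e hs.symm hok rfl hok.1.le (by simp)

theorem Inv.cor {N : D.H} {s : Bool} {u : List (Tk G)} {σ : ℤˣ} {z : ℤ} {g : D.H}
    (h : D.Inv N s u σ z g) (k : Kd) (e : ℤ) (hs : k.src = σ) (hok : k.val D.M)
    (ha : k.arr D.M = z) (he : k.dep D.M = e) (hz : z ≤ e)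
    (hch : D.spec k → k.sgn = s ∧ g * D.del k = N⁻¹ * (g * of (D.lab k))) :
    D.Inv N s (u ++ [.cor k]) k.tgt e (g * of (D.lab k)) :=
  h.step (.cor k) e hs hok (by simp [tm, Kd.tm, ha, he]) hz (by rintro _ ⟨⟩; exact hch)

theorem Inv.start {N : D.H} {s : Bool} (h : D.del (.a 0 s) = N⁻¹ * of (D.lab (.a 0 s))) :
    D.Inv N s [.cor (.a 0 s)] 1 1 (of (D.lab (.a 0 s))) := by
  refine ⟨⟨rfl, rfl⟩, ?_, ⟨?_, trivial⟩, by simp [lt], [], by simp [Kd.tm, Kd.arr, Kd.dep],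
    by simp [jl]⟩
  · intro τ h
    rw [List.mem_singleton.1 h]; simp [ok, Kd.val]
  · rintro k ⟨⟩ -
    exact ⟨rfl, by simpa using h⟩

theorem Inv.real {N : D.H} {s : Bool} {u : List (Tk G)}
    (h : D.Inv N s u 1 (16 * D.M + 7) N) (hN : E D.W 1 N) : D.Real 1 u := by
  obtain ⟨h1, h2, h3, h4, l, h5, h6⟩ := h
  refine ⟨1, h1, h2, ?_, ?_⟩
  · rw [h5, J, h6, ind_false (lt_irrefl _), ind_true (by omega)]; simp
  · intro i j g hi hj hm
    obtain ⟨e1, e2, e3, e4⟩ := h3.mk hm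
    have hij : i + j = 0 ∨ i + j = 1 := by
      cases s
      · have := e2 rfl; omega
      · have := e1 rfl; omega
    rcases hij with hij | hij
    · refine ⟨1, by omega, ?_⟩
      rw [e3 hij, h4]; exact hN
    · refine ⟨0, by omega, ?_⟩
      have := e4 hij
      rw [h4] at this
      simp at this
      rw [this]; exact E.one

theorem S_W : D.W⁻¹ * D.S D.M = (t * of D.x * t)⁻¹ := by
  rw [W]; group

theorem pos_inv (i : ℕ) (hi : i ≤ D.M) :
    ∃ u, D.Inv D.W true u (-1) (8 * i + 5) (D.S i) := by
  have hb : ∀ (i : ℕ) (g : D.H), g * of (D.b i) = D.S i → D.spec (.b i true) →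
      (Kd.b i true).sgn = true ∧
      g * D.del (.b i true) = D.W⁻¹ * (g * of (D.lab (.b i true))) := by
    intro i g hg hs
    refine ⟨rfl, ?_⟩
    obtain rfl : i = D.M := by simpa [spec, Kd.isA0, Kd.isBM] using hs
    have h1 : D.lab (.b D.M true) = D.b D.M := by simp [lab, sg]
    rw [h1, hg, S_W]
    simp only [del, dv, if_true]
    rw [← mul_assoc, hg, Vb]
    have : D.S D.M * (t * of D.x * t) = D.W := by rw [W]; group
    rw [← this]; group
  induction i with
  | zero =>
    have h0 := Inv.start (D := D) (N := D.W) (s := true) (by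
      simp only [del, dv, if_true, lab, sg, Va]; group)
    have h1 := h0.edge (-1) 3 (by simp) ⟨by norm_num, 0, by simp⟩
    have h2 := h1.cor (.b 0 true) 5 rfl (by simp [Kd.val]) (by simp [Kd.arr]) (by simp [Kd.dep])
      (by norm_num) (hb 0 _ (by simp [S, lab, sg, evl_inr]))
    refine ⟨_, h2.cast rfl ?_ ?_⟩
    · simp
    · simp [S, lab, sg, evl_inr]
  | succ i ih =>
    obtain ⟨u, h⟩ := ih (by omega)
    have h1 := h.edge 1 (8 * i + 7) (by simp) ⟨by omega, i, by simp⟩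
    have h2 := h1.cor (.a (i + 1) true) (8 * i + 9) rfl hi (by simp [Kd.arr]; ring)
      (by simp [Kd.dep]; ring) (by omega) (by simp [spec, Kd.isA0, Kd.isBM])
    have h3 := h2.edge (-1) (8 * i + 11) (by simp [Kd.tgt]) ⟨by omega, i + 1, by simp; omega⟩
    have h4 := h3.cor (.b (i + 1) true) (8 * i + 13) rfl hi (by simp [Kd.arr]; ring)
      (by simp [Kd.dep]; ring) (by omega) (hb (i + 1) _ (by simp [S, lab, sg, evl_inr]))
    refine ⟨_, h4.cast rfl ?_ ?_⟩
    · push_cast; ring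
    · simp [S, lab, sg, evl_inr]

theorem pos_node : ∃ X, D.Dn 1 X ∧ ev D.φ X = D.W := by
  obtain ⟨u, h⟩ := pos_inv (D := D) D.M le_rfl
  have h1 := h.edge 1 (8 * D.M + 6) (by simp) ⟨by omega, D.M, by simp⟩
  have h2 := h1.cor (.x true) (16 * D.M + 6) rfl trivial (by simp [Kd.arr])
    (by simp [Kd.dep]) (by omega) (by simp [spec, Kd.isA0, Kd.isBM])
  have h3 := h2.edge 1 (16 * D.M + 7) (by simp [Kd.tgt]) ⟨by omega, 2 * D.M, by simp; omega⟩
  have e : D.S D.M * evl D.φ (.inr 1) * of (D.lab (.x true)) * evl D.φ (.inr 1) = D.W := by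
    simp [W, lab, sg, evl_inr]
  rw [e] at h3
  have hE : E D.W 1 D.W := by simpa using E.pos 0 1 1 (E.one (w := D.W))
  refine ⟨_, .inr (.inr ⟨_, rfl, h3.real hE⟩), h3.2.2.2.1⟩

theorem neg_inv (l : ℕ) (hl : l ≤ D.M) :
    ∃ u, D.Inv ((of (D.a 0))⁻¹ * D.W⁻¹ * of (D.a 0)) false u 1 (8 * D.M + 8 * l + 7)
      ((of (D.a 0))⁻¹ * D.W⁻¹ * (D.S (D.M - l) * (of (D.b (D.M - l)))⁻¹ * t)) := by
  induction l with
  | zero =>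
    have h0 := Inv.start (D := D) (N := (of (D.a 0))⁻¹ * D.W⁻¹ * of (D.a 0)) (s := false) (by
      simp [del, dv, lab, sg, Va]; group)
    have h1 := h0.edge (-1) 2 (by simp) ⟨by norm_num, 0, by simp⟩
    have h2 := h1.cor (.x false) (8 * D.M + 2) rfl trivial (by simp [Kd.arr])
      (by simp [Kd.dep]) (by omega) (by simp [spec, Kd.isA0, Kd.isBM])
    have h3 := h2.edge (-1) (8 * D.M + 3) (by simp [Kd.tgt]) ⟨by omega, D.M, by simp⟩
    have h4 := h3.cor (.b D.M false) (8 * D.M + 5) rfl le_rfl (by simp [Kd.arr]; ring)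
      (by simp [Kd.dep]; ring) (by omega) (by
        intro _
        refine ⟨rfl, ?_⟩
        simp [del, dv, lab, sg, evl_inr, Vb]
        group)
    have h5 := h4.edge 1 (8 * D.M + 7) (by simp [Kd.tgt]) ⟨by omega, D.M, by simp⟩
    refine ⟨_, h5.cast rfl ?_ ?_⟩
    · simp
    · have := S_W (D := D)
      rw [Nat.sub_zero]
      have e : (of (D.a 0))⁻¹ * D.W⁻¹ * (D.S D.M * (of (D.b D.M))⁻¹ * t) =
        (of (D.a 0))⁻¹ * (D.W⁻¹ * D.S D.M) * (of (D.b D.M))⁻¹ * t := by group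
      rw [e, S_W]
      simp [lab, sg, evl_inr, mul_assoc]
  | succ l ih =>
    obtain ⟨u, h⟩ := ih (by omega)
    obtain ⟨r, hr⟩ : ∃ r, D.M = l + 1 + r := ⟨D.M - (l + 1), by omega⟩
    have e1 : D.M - l = r + 1 := by omega
    have e2 : D.M - (l + 1) = r := by omega
    have e3 : (D.M : ℤ) = l + 1 + r := by exact_mod_cast hr
    rw [e1] at h
    rw [e2]
    have h1 := h.cor (.a (r + 1) false) (8 * D.M + 8 * l + 9) rfl (by simp only [Kd.val]; omega)
      (by simp [Kd.arr]; omega) (by simp [Kd.dep]; omega) (by omega)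
      (by simp [spec, Kd.isA0, Kd.isBM])
    have h2 := h1.edge (-1) (8 * D.M + 8 * l + 11) (by simp [Kd.tgt])
      ⟨by omega, D.M + l + 1, by simp; omega⟩
    have h3 := h2.cor (.b r false) (8 * D.M + 8 * l + 13) rfl (by simp only [Kd.val]; omega)
      (by simp [Kd.arr]; omega) (by simp [Kd.dep]; omega) (by omega)
      (by simp [spec, Kd.isA0, Kd.isBM]; omega)
    have h4 := h3.edge 1 (8 * D.M + 8 * l + 15) (by simp [Kd.tgt])
      ⟨by omega, D.M + l + 1, by simp; omega⟩
    refine ⟨_, h4.cast rfl ?_ ?_⟩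
    · push_cast; ring
    · simp [S, lab, sg, evl_inr, mul_assoc]

theorem neg_node : ∃ X g, D.Dn 1 X ∧ ev D.φ X = g * D.W⁻¹ * g⁻¹ := by
  obtain ⟨u, h⟩ := neg_inv (D := D) D.M le_rfl
  have e : (of (D.a 0))⁻¹ * D.W⁻¹ * (D.S (D.M - D.M) * (of (D.b (D.M - D.M)))⁻¹ * t) =
      (of (D.a 0))⁻¹ * D.W⁻¹ * of (D.a 0) := by
    rw [Nat.sub_self, S]; group
  rw [e, show 8 * (D.M : ℤ) + 8 * D.M + 7 = 16 * D.M + 7 by ring] at h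
  have hE : E D.W 1 ((of (D.a 0))⁻¹ * D.W⁻¹ * of (D.a 0)) := by
    simpa using E.neg 0 1 (of (D.a 0))⁻¹ (E.one (w := D.W))
  refine ⟨_, (of (D.a 0))⁻¹, .inr (.inr ⟨_, rfl, h.real hE⟩), ?_⟩
  rw [inv_inv]; exact h.2.2.2.1

theorem final (hD : D.Good) (y : G) (hy : (of y : D.H) ∈ Subgroup.normalClosure {D.W}) :
    y = 1 := by
  obtain ⟨n, hE⟩ := E.of_mem hy
  obtain ⟨W, h1, h2⟩ := P.ofE pos_node neg_node hE
  have := P.main hD pos_node neg_node n _ W y h1 rfl h2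
  rw [h2] at this
  exact of_injective (φ := D.φ) (by rw [this, map_one])

end Dat

theorem W_ofFn {C A : Type} [Group C] [Group A] (iP iN : C →* A)
    (hiP : Function.Injective iP) (hiN : Function.Injective iN) (a b : ℕ → A) (x : A) (M : ℕ) :
    (List.ofFn fun i : Fin (M + 1) =>
            HNNExtension.of (a i) * (HNNExtension.t)⁻¹ * HNNExtension.of (b i) *
              (HNNExtension.t :
                HNNExtension A iP.range iN.range (hnnφ iP iN hiP hiN))).prod =
      Dat.S ⟨iP.range, iN.range, hnnφ iP iN hiP hiN, M, a, b, x⟩ M * t := by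
  have : ∀ i, (List.ofFn fun j : Fin (i + 1) =>
            HNNExtension.of (a j) * (HNNExtension.t)⁻¹ * HNNExtension.of (b j) *
              (HNNExtension.t :
                HNNExtension A iP.range iN.range (hnnφ iP iN hiP hiN))).prod =
      Dat.S ⟨iP.range, iN.range, hnnφ iP iN hiP hiN, M, a, b, x⟩ i * t := by
    intro i
    induction i with
    | zero => simp [Dat.S]
    | succ i ih =>
      rw [List.ofFn_succ', List.prod_concat]
      simp only [Fin.val_castSucc, Fin.val_last]
      rw [ih, Dat.S]
      simp only [mul_assoc]
  exact this M

end KL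

/-- For `w = a₁ t⁻¹ b₁ t ⋯ a_m t⁻¹ b_m t x t` with `aᵢ ∈ A \ i_P(C)`, `bᵢ ∈ A \ i_N(C)`,
`a₁` ∞-RF rel `i_P(C)`, `b_m` ∞-RF rel `i_N(C)`, all `aᵢ` ∞-RTF rel `i_P(C)` and all `bᵢ`
∞-RTF rel `i_N(C)`, the natural map `A → (A ∗_C)/⟪w⟫` is injective. -/
theorem stmt4 {C A : Type} [Group C] [Group A] (iP iN : C →* A)
    (hiP : Function.Injective iP) (hiN : Function.Injective iN)
    (m : ℕ) (hm : 0 < m) (a b : Fin m → A) (x : A)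
    (haC : ∀ i, a i ∉ iP.range) (hbC : ∀ i, b i ∉ iN.range)
    (ha1 : IsRF iP.range ⊤ (a ⟨0, hm⟩))
    (hbm : IsRF iN.range ⊤ (b ⟨m - 1, by omega⟩))
    (haRTF : ∀ i, IsRTF iP.range ⊤ (a i))
    (hbRTF : ∀ i, IsRTF iN.range ⊤ (b i)) :
    Function.Injective ((QuotientGroup.mk' (Subgroup.normalClosure
        {(List.ofFn fun i : Fin m =>
            HNNExtension.of (a i) * (HNNExtension.t)⁻¹ * HNNExtension.of (b i) *
              (HNNExtension.t :
                HNNExtension A iP.range iN.range (hnnφ iP iN hiP hiN))).prod *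
          HNNExtension.of x * HNNExtension.t})).comp
      (HNNExtension.of :
        A →* HNNExtension A iP.range iN.range (hnnφ iP iN hiP hiN))) := by
  obtain ⟨M, rfl⟩ : ∃ M, m = M + 1 := ⟨m - 1, by omega⟩
  obtain ⟨a', ha⟩ : ∃ a' : ℕ → A, ∀ i : Fin (M + 1), a i = a' i :=
    ⟨fun i => if h : i < M + 1 then a ⟨i, h⟩ else 1, fun i => by
      show _ = dite _ _ _
      rw [dif_pos i.2]⟩
  obtain ⟨b', hb⟩ : ∃ b' : ℕ → A, ∀ i : Fin (M + 1), b i = b' i :=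
    ⟨fun i => if h : i < M + 1 then b ⟨i, h⟩ else 1, fun i => by
      show _ = dite _ _ _
      rw [dif_pos i.2]⟩
  let D : KL.Dat A := ⟨iP.range, iN.range, hnnφ iP iN hiP hiN, M, a', b', x⟩
  have hD : D.Good := by
    refine ⟨?_, ?_, ?_, ?_⟩
    · have := ha1
      rw [ha] at this
      exact this
    · have := hbm
      rw [hb] at this
      exact this
    · intro i hi
      have := haRTF ⟨i, Nat.lt_succ_of_le hi⟩
      rw [ha] at this
      exact this
    · intro i hi
      have := hbRTF ⟨i, Nat.lt_succ_of_le hi⟩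
      rw [hb] at this
      exact this
  rw [injective_iff_map_eq_one]
  intro y hy
  apply KL.Dat.final hD y
  have h1 := (QuotientGroup.eq_one_iff _).1 hy
  simp only [ha, hb] at h1
  rw [KL.W_ofFn iP iN hiP hiN a' b' x M] at h1
  exact h1
end

section
/- Let A be a group, C ≤ A a subgroup, and 2 ≤ n ≤ ∞. If a ∈ A \ C is n-RF relative to C, then every element of the double coset CaC = {c a c' : c, c' ∈ C} is n-RF relative to C. Likewise, if a ∈ A \ C is n-RTF relative to C, then every element of CaC is n-RTF relative to C. -/
theorem telescope_aux {A : Type} [Group A] : ∀ (m : ℕ) (l : ℕ → A) (z : Fin m → A),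
    (List.ofFn fun i => l i * z i).prod * l m =
      l 0 * (List.ofFn fun i => z i * l (i + 1)).prod := by
  intro m
  induction m with
  | zero => intro l z; simp
  | succ m ih =>
    intro l z
    have := ih (fun j => l (j + 1)) (fun i => z i.succ)
    simp only [List.ofFn_succ, List.prod_cons, Fin.val_zero, Fin.val_succ, mul_assoc] at this ⊢
    rw [this]

theorem telescope_cyc {A : Type} [Group A] (k : ℕ) (l z : Fin (k + 1) → A)
    (h : (List.ofFn fun i => l i * z i).prod = 1) :
    (List.ofFn fun i => z i * l (i + 1)).prod = 1 := by
  have := telescope_aux (k + 1) (fun j => l (Fin.ofNat (k + 1) j)) z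
  have h1 : ∀ i : Fin (k + 1), Fin.ofNat (k + 1) (i : ℕ) = i := fun i => by simp
  have h2 : ∀ i : Fin (k + 1), Fin.ofNat (k + 1) ((i : ℕ) + 1) = i + 1 := fun i => by
    ext; simp [Fin.val_add]
  have h3 : Fin.ofNat (k + 1) (k + 1) = 0 := by ext; simp
  have h4 : Fin.ofNat (k + 1) 0 = 0 := by ext; simp
  simp only [h1, h2, h3, h4, h, one_mul] at this
  exact (mul_eq_left.mp this.symm)

/-- The `n`-RF and `n`-RTF conditions relative to `C` only depend on the double coset `CaC`. -/
theorem stmt9 {A : Type} [Group A] (C : Subgroup A) (n : ℕ∞) (hn : 2 ≤ n)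
    (a : A) (ha : a ∉ C) :
    (IsRF C n a → ∀ c : A, c ∈ C → ∀ c' : A, c' ∈ C → IsRF C n (c * a * c')) ∧
    (IsRTF C n a → ∀ c : A, c ∈ C → ∀ c' : A, c' ∈ C → IsRTF C n (c * a * c')) := by
  constructor
  · intro H c hc c' hc' k e d he hd hne h1 h2 hp
    set L : ℤ → A := fun s => if s = 1 then c else c'⁻¹ with hL
    have hLC : ∀ s, L s ∈ C := by
      intro s
      simp only [hL]
      split_ifs
      · exact hc
      · exact C.inv_mem hc'
    have key : ∀ i, (c * a * c') ^ e i * d i =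
        L (e i) * (a ^ e i * ((L (-(e i)))⁻¹ * d i)) := by
      intro i
      rcases he i with h | h <;> simp [hL, h, mul_assoc]
    simp only [key] at hp
    have hq := telescope_cyc k (fun i => L (e i)) _ hp
    simp only [mul_assoc] at hq
    refine H k e (fun i => (L (-(e i)))⁻¹ * (d i * L (e (i + 1)))) he ?_ ?_ h1 h2 hq
    · intro i
      exact C.mul_mem (C.inv_mem (hLC _)) (C.mul_mem (hd i) (hLC _))
    · intro i hi h
      apply hne i hi
      have h' : -(e i) = e (i + 1) := by omega
      simp only [h'] at h
      have := inv_mul_eq_one.mp h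
      exact mul_eq_right.mp this.symm
  · intro H c hc c' hc' k hk d hd hp
    simp only [mul_assoc] at hp
    have hq := telescope_cyc k (fun _ => c) _ hp
    simp only [mul_assoc] at hq
    exact H k hk (fun i => c' * (d i * c))
      (fun i => C.mul_mem hc' (C.mul_mem (hd i) hc)) hq
end

section
/- Let G = A ∗_C B be the amalgamated free product of groups A and B over C, via injective homomorphisms φ_A : C → A and φ_B : C → B, with injective canonical maps ι_A : A → G, ι_B : B → G. Suppose for some 2 ≤ n ≤ ∞ that both pairs (A, φ_A(C)) and (B, φ_B(C)) are n-RF. Then the pairs (G, ι_A(A)) and (G, ι_B(B)) are n-RF. -/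
section Amalgam

variable {C A B : Type} [Group C] [Group A] [Group B]

instance condGroup : ∀ b : Bool, Group (cond b A B)
  | true => ‹Group A›
  | false => ‹Group B›

/-- The diagram `C → A`, `C → B` as a family indexed by `Bool`. -/
def amalgamHom (φA : C →* A) (φB : C →* B) : ∀ b : Bool, C →* cond b A B
  | true => φA
  | false => φB

/-- The amalgamated free product `A ∗_C B`, i.e. the pushout of `φA : C → A` and `φB : C → B`. -/
abbrev Amalgam (φA : C →* A) (φB : C →* B) : Type :=
  Monoid.PushoutI (amalgamHom φA φB)

/-- The canonical map `ι_A : A → A ∗_C B`. -/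
def iotaA (φA : C →* A) (φB : C →* B) : A →* Amalgam φA φB :=
  Monoid.PushoutI.of (φ := amalgamHom φA φB) true

/-- The canonical map `ι_B : B → A ∗_C B`. -/
def iotaB (φA : C →* A) (φB : C →* B) : B →* Amalgam φA φB :=
  Monoid.PushoutI.of (φ := amalgamHom φA φB) false

end Amalgam

namespace RFAmalgam

/-- Non-cyclic alternating words `a^{e 0} c 0 a^{e 1} ⋯ c (k-1) a^{e k}`. -/
def prodn {A : Type} [Group A] (a : A) (e : ℕ → ℤ) (c : ℕ → A) : ℕ → A
  | 0 => a ^ e 0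
  | k + 1 => prodn a e c k * c k * a ^ e (k + 1)

theorem prodn_shift {A : Type} [Group A] (a : A) (e : ℕ → ℤ) (c : ℕ → A) (k : ℕ) :
    prodn a e c (k + 1) =
      a ^ e 0 * c 0 * prodn a (fun i => e (i + 1)) (fun i => c (i + 1)) k := by
  induction k with
  | zero => rfl
  | succ k ih =>
    rw [prodn, ih]
    simp only [prodn, mul_assoc]

theorem prodn_congr {A : Type} [Group A] (a : A) (e e' : ℕ → ℤ) (c c' : ℕ → A) (k : ℕ)
    (he : ∀ i ≤ k, e i = e' i) (hc : ∀ i < k, c i = c' i) :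
    prodn a e c k = prodn a e' c' k := by
  induction k with
  | zero => simp [prodn, he 0]
  | succ k ih =>
    rw [prodn, prodn, ih (fun i hi => he i (by omega)) (fun i hi => hc i (by omega)),
      he (k + 1) le_rfl, hc k (by omega)]

theorem ofFn_prodn {A : Type} [Group A] (a : A) (e : ℕ → ℤ) (c : ℕ → A) (k : ℕ) :
    (List.ofFn fun i : Fin (k + 1) => a ^ e i * c i).prod = prodn a e c k * c k := by
  induction k with
  | zero => simp [prodn]
  | succ k ih =>
    rw [List.ofFn_succ']
    simp only [List.concat_eq_append, List.prod_append, Fin.val_castSucc, Fin.val_last]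
    rw [ih]
    simp [prodn, mul_assoc]

/-- number of indices `≤ k` with `e i = s`. -/
def cnt (e : ℕ → ℤ) (s : ℤ) (k : ℕ) : ℕ := ((Finset.range (k + 1)).filter (fun i => e i = s)).card

theorem cnt_fin (e : ℕ → ℤ) (s : ℤ) (k : ℕ) :
    (Finset.univ.filter (fun i : Fin (k + 1) => e i = s)).card = cnt e s k := by
  rw [cnt, Finset.card_filter, Finset.card_filter]
  exact Fin.sum_univ_eq_sum_range (fun i => if e i = s then 1 else 0) (k + 1)

theorem cnt_zero (e : ℕ → ℤ) (s : ℤ) : cnt e s 0 = if e 0 = s then 1 else 0 := by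
  simp only [cnt, Finset.card_filter]
  simp [-Finset.sum_boole]

theorem cnt_succ (e : ℕ → ℤ) (s : ℤ) (k : ℕ) :
    cnt e s (k + 1) = cnt e s k + if e (k + 1) = s then 1 else 0 := by
  simp only [cnt, Finset.card_filter]
  rw [Finset.sum_range_succ]

theorem cnt_shift (e : ℕ → ℤ) (s : ℤ) (k : ℕ) :
    cnt (fun i => e (i + 1)) s k ≤ cnt e s (k + 1) := by
  simp only [cnt, Finset.card_filter]
  rw [Finset.sum_range_succ' _ (k + 1)]
  omega

theorem cnt_congr (e e' : ℕ → ℤ) (s : ℤ) (k : ℕ) (he : ∀ i ≤ k, e i = e' i) :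
    cnt e s k = cnt e' s k := by
  induction k with
  | zero => simp [cnt_zero, he 0]
  | succ k ih =>
    rw [cnt_succ, cnt_succ, ih (fun i hi => he i (by omega)), he (k + 1) le_rfl]

theorem prodn_not_mem {A : Type} [Group A] {C : Subgroup A} {n : ℕ∞} {a : A} (ha : a ∉ C)
    (h : IsRF C n a) : ∀ (k : ℕ) (e : ℕ → ℤ) (c : ℕ → A), (∀ i ≤ k, e i = 1 ∨ e i = -1) →
      (∀ i < k, c i ∈ C) → (∀ i < k, e i = -e (i + 1) → c i ≠ 1) →
      (cnt e 1 k : ℕ∞) < n → (cnt e (-1) k : ℕ∞) < n → prodn a e c k ∉ C := by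
  intro k
  induction k using Nat.strong_induction_on with
  | _ k ih =>
  intro e c he hc hne hp hq hmem
  set x := prodn a e c k with hx
  by_cases hcyc : e k = -e 0 ∧ x = 1
  · obtain ⟨hek, hx1⟩ := hcyc
    match k, ih, he, hc, hne, hp, hq, hx, hek with
    | 0, _, he, _, _, _, _, _, hek =>
      rcases he 0 le_rfl with h0 | h0 <;> rw [h0] at hek <;> norm_num at hek
    | 1, _, he, hc, hne, _, _, hx, hek =>
      apply hne 0 (by omega) (by rw [show (0 : ℕ) + 1 = 1 from rfl, hek]; simp)
      rw [hx] at hx1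
      simp only [prodn, Nat.zero_add, hek, zpow_neg] at hx1
      simpa using conj_eq_one_iff.mp hx1
    | k + 2, ih, he, hc, hne, hp, hq, hx, hek =>
      apply ih k (by omega) (fun i => e (i + 1)) (fun i => c (i + 1))
        (fun i hi => he _ (by omega)) (fun i hi => hc _ (by omega))
        (fun i hi => hne _ (by omega))
      · refine lt_of_le_of_lt ?_ hp
        rw [Nat.cast_le]
        have := cnt_shift e 1 k
        rw [cnt_succ e 1 (k + 1)]; omega
      · refine lt_of_le_of_lt ?_ hq
        rw [Nat.cast_le]
        have := cnt_shift e (-1) k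
        rw [cnt_succ e (-1) (k + 1)]; omega
      · rw [hx, prodn, prodn_shift] at hx1
        rw [show k + 1 + 1 = k + 2 from rfl, hek, zpow_neg] at hx1
        set y := prodn a (fun i => e (i + 1)) (fun i => c (i + 1)) k
        have : c 0 * y * c (k + 1) = 1 := by
          apply conj_eq_one_iff (a := a ^ e 0) |>.mp
          simpa only [mul_assoc] using hx1
        have hy : y = (c 0)⁻¹ * (c (k + 1))⁻¹ := by
          rw [eq_mul_inv_iff_mul_eq]
          exact eq_inv_of_mul_eq_one_right (by rw [← mul_assoc]; exact this)
        rw [hy]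
        exact C.mul_mem (C.inv_mem (hc _ (by omega))) (C.inv_mem (hc _ (by omega)))
  · set c' : ℕ → A := fun i => if i < k then c i else x⁻¹ with hc'
    refine h k (fun i => e i) (fun i => c' i) (fun i => he i (by omega)) ?_ ?_ ?_ ?_ ?_
    · intro i
      simp only [hc']
      split_ifs with hi
      · exact hc _ hi
      · exact C.inv_mem hmem
    · intro i hi
      simp only [hc']
      split_ifs with hik
      · apply hne _ hik
        have : ((i + 1 : Fin (k + 1)) : ℕ) = i + 1 := by
          apply Fin.val_add_one_of_lt
          rw [Fin.lt_def]; simpa using hik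
        rw [this] at hi
        exact hi
      · have hik : i = Fin.last k := by
          apply Fin.ext; simp; omega
        subst hik
        simp only [Fin.last_add_one, Fin.val_last, Fin.val_zero] at hi
        intro hx1
        exact hcyc ⟨hi, inv_eq_one.mp hx1⟩
    · rw [cnt_fin]; exact hp
    · rw [cnt_fin]; exact hq
    · rw [ofFn_prodn, prodn_congr a e e c' c k (fun _ _ => rfl)
        (fun i hi => by simp [hc', hi]), ← hx]
      simp [hc']

/-- Values of non-cyclic words with `p` positive, `q` negative letters and last sign `s`. -/
inductive W {A : Type} [Group A] (C : Subgroup A) (a : A) : ℕ → ℕ → Bool → A → Prop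
  | pos0 : W C a 1 0 true a
  | neg0 : W C a 0 1 false a⁻¹
  | pos {p q s x c} : W C a p q s x → c ∈ C → (s = false → c ≠ 1) →
      W C a (p + 1) q true (x * c * a)
  | neg {p q s x c} : W C a p q s x → c ∈ C → (s = true → c ≠ 1) →
      W C a p (q + 1) false (x * c * a⁻¹)

/-- Non-cyclic version of RF. -/
def RF' {A : Type} [Group A] (C : Subgroup A) (n : ℕ∞) (a : A) : Prop :=
  ∀ p q s x, W C a p q s x → (p : ℕ∞) < n → (q : ℕ∞) < n → x ∉ C

/-- the sign of a Boolean -/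
def sg (s : Bool) : ℤ := if s then 1 else -1

theorem W_fun {A : Type} [Group A] {C : Subgroup A} {a : A} {p q : ℕ} {s : Bool} {x : A}
    (h : W C a p q s x) : ∃ (k : ℕ) (e : ℕ → ℤ) (c : ℕ → A), (∀ i ≤ k, e i = 1 ∨ e i = -1) ∧
      (∀ i < k, c i ∈ C) ∧ (∀ i < k, e i = -e (i + 1) → c i ≠ 1) ∧
      cnt e 1 k = p ∧ cnt e (-1) k = q ∧ prodn a e c k = x ∧ e k = sg s := by
  have key : ∀ (t s : Bool) (x c : A) (p q k : ℕ) (e : ℕ → ℤ) (f : ℕ → A), c ∈ C →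
      (s = !t → c ≠ 1) → (∀ i ≤ k, e i = 1 ∨ e i = -1) →
      (∀ i < k, f i ∈ C) → (∀ i < k, e i = -e (i + 1) → f i ≠ 1) →
      cnt e 1 k = p → cnt e (-1) k = q → prodn a e f k = x → e k = sg s →
      ∃ (k : ℕ) (e : ℕ → ℤ) (c' : ℕ → A), (∀ i ≤ k, e i = 1 ∨ e i = -1) ∧
      (∀ i < k, c' i ∈ C) ∧ (∀ i < k, e i = -e (i + 1) → c' i ≠ 1) ∧
      cnt e 1 k = p + (if t then 1 else 0) ∧ cnt e (-1) k = q + (if t then 0 else 1) ∧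
      prodn a e c' k = x * c * a ^ sg t ∧ e k = sg t := by
    intro t s x c p q k e f hc hs he hf hne hp hq hx hek
    have h1 : ∀ i ≤ k, (fun i => if i ≤ k then e i else sg t) i = e i := by
      intro i hi; simp [hi]
    refine ⟨k + 1, fun i => if i ≤ k then e i else sg t, fun i => if i < k then f i else c,
      ?_, ?_, ?_, ?_, ?_, ?_, ?_⟩
    · intro i hi
      dsimp only
      split_ifs with h
      · exact he i h
      · cases t <;> simp [sg]
    · intro i hi
      dsimp only
      split_ifs with h
      · exact hf i h
      · exact hc
    · intro i hi
      dsimp only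
      rw [if_pos (by omega : i ≤ k)]
      split_ifs with h h' h'
      · exact hne i h
      · omega
      · omega
      · intro h2
        have : i = k := by omega
        subst this
        rw [hek] at h2
        apply hs
        cases s <;> cases t <;> simp [sg] at h2 ⊢
    · rw [cnt_succ, cnt_congr _ e 1 k h1, hp]
      cases t <;> simp [sg]
    · rw [cnt_succ, cnt_congr _ e (-1) k h1, hq]
      cases t <;> simp [sg]
    · rw [prodn, prodn_congr a _ e _ f k h1 (fun i hi => by simp [hi]), hx]
      simp
    · simp
  induction h with
  | pos0 =>
    exact ⟨0, fun _ => 1, fun _ => 1, by simp, by simp, by simp, by simp [cnt_zero],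
      by simp [cnt_zero], by simp [prodn], by simp [sg]⟩
  | neg0 =>
    exact ⟨0, fun _ => -1, fun _ => 1, by simp, by simp, by simp, by simp [cnt_zero],
      by simp [cnt_zero], by simp [prodn], by simp [sg]⟩
  | @pos p q s x c _ hc hs ih =>
    obtain ⟨k, e, f, he, hf, hne, hp, hq, hx, hek⟩ := ih
    simpa [sg] using key true s x c p q k e f hc hs he hf hne hp hq hx hek
  | @neg p q s x c _ hc hs ih =>
    obtain ⟨k, e, f, he, hf, hne, hp, hq, hx, hek⟩ := ih
    simpa [sg] using key false s x c p q k e f hc hs he hf hne hp hq hx hek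

theorem RF'_of_IsRF {A : Type} [Group A] {C : Subgroup A} {n : ℕ∞} {a : A} (ha : a ∉ C)
    (h : IsRF C n a) : RF' C n a := by
  intro p q s x hw hp hq
  obtain ⟨k, e, f, he, hf, hne, rfl, rfl, rfl, hek⟩ := W_fun hw
  exact prodn_not_mem ha h k e f he hf hne hp hq

theorem fun_W {A : Type} [Group A] {C : Subgroup A} {a : A} (e : ℕ → ℤ) (c : ℕ → A) (k : ℕ)
    (he : ∀ i ≤ k, e i = 1 ∨ e i = -1)
    (hc : ∀ i < k, c i ∈ C) (hne : ∀ i < k, e i = -e (i + 1) → c i ≠ 1) :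
    W C a (cnt e 1 k) (cnt e (-1) k) (decide (e k = 1)) (prodn a e c k) := by
  induction k with
  | zero =>
    rcases he 0 le_rfl with h | h
    · simpa [cnt_zero, prodn, h] using W.pos0
    · simpa [cnt_zero, prodn, h] using W.neg0
  | succ k ih =>
    have ih := ih (fun i hi => he i (by omega)) (fun i hi => hc i (by omega))
      (fun i hi => hne i (by omega))
    have hk := he k (by omega)
    have hn := hne k (by omega)
    rcases he (k + 1) le_rfl with h | h
    · have := W.pos ih (hc k (by omega)) (fun h' => hn (by
        rcases hk with h2 | h2 <;> simp [h2, h] at h' ⊢))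
      simpa [cnt_succ, prodn, h] using this
    · have := W.neg ih (hc k (by omega)) (fun h' => hn (by
        rcases hk with h2 | h2 <;> simp [h2, h] at h' ⊢))
      simpa [cnt_succ, prodn, h] using this

theorem IsRF_of_RF' {A : Type} [Group A] {C : Subgroup A} {n : ℕ∞} {a : A}
    (h : RF' C n a) : IsRF C n a := by
  intro k e c he hc hne hp hq hprod
  set e' : ℕ → ℤ := fun i => e (Fin.ofNat (k + 1) i) with he'
  set c' : ℕ → A := fun i => c (Fin.ofNat (k + 1) i) with hc'
  have h1 : ∀ i : Fin (k + 1), e i = e' i := by intro i; simp [he']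
  have h2 : ∀ i : Fin (k + 1), c i = c' i := by intro i; simp [hc']
  simp only [h1, h2] at hprod
  simp only [h1] at hp hq
  rw [cnt_fin] at hp hq
  rw [ofFn_prodn] at hprod
  refine h _ _ _ _ (fun_W e' c' k (fun i _ => he _) (fun i _ => hc _) ?_) hp hq ?_
  · intro i hi h3
    apply hne
    have : Fin.ofNat (k + 1) i + 1 = Fin.ofNat (k + 1) (i + 1) := by
      apply Fin.ext; simp [Fin.val_add]
    rw [this]; exact h3
  · rw [mul_eq_one_iff_eq_inv.mp hprod]
    exact C.inv_mem (hc _)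

theorem W_coset {A : Type} [Group A] {C : Subgroup A} {g u v : A} (hu : u ∈ C) (hv : v ∈ C)
    {p q : ℕ} {s : Bool} {z : A} (h : W C (u * g * v) p q s z) :
    ∃ l ∈ C, ∃ z', W C g p q s z' ∧ z = l * z' * (if s then v else u⁻¹) := by
  induction h with
  | pos0 => exact ⟨u, hu, g, W.pos0, by simp⟩
  | neg0 => exact ⟨v⁻¹, C.inv_mem hv, g⁻¹, W.neg0, by simp [mul_assoc]⟩
  | @pos p q s x c _ hc hs ih =>
    obtain ⟨l, hl, z', hz', rfl⟩ := ih
    refine ⟨l, hl, z' * ((if s then v else u⁻¹) * c * u) * g, W.pos hz' ?_ ?_, ?_⟩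
    · cases s <;> simp [C.mul_mem, *]
    · rintro rfl; simpa [mul_assoc, inv_mul_eq_one] using hs
    · simp [mul_assoc]
  | @neg p q s x c _ hc hs ih =>
    obtain ⟨l, hl, z', hz', rfl⟩ := ih
    refine ⟨l, hl, z' * ((if s then v else u⁻¹) * c * v⁻¹) * g⁻¹, W.neg hz' ?_ ?_, ?_⟩
    · cases s <;> simp [C.mul_mem, *]
    · rintro rfl; simpa using hs
    · simp [mul_assoc]

theorem RF'_coset {A : Type} [Group A] {C : Subgroup A} {g u v : A} {n : ℕ∞}
    (hu : u ∈ C) (hv : v ∈ C) (h : RF' C n g) : RF' C n (u * g * v) := by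
  intro p q s z hz hp hq hm
  obtain ⟨l, hl, z', hz', rfl⟩ := W_coset hu hv hz
  apply h p q s z' hz' hp hq
  rw [C.mul_mem_cancel_right (by cases s <;> simp [*]), C.mul_mem_cancel_left hl] at hm
  exact hm

theorem RF'_malnormal {A : Type} [Group A] {C : Subgroup A} {a c : A} {n : ℕ∞} (hn : 2 ≤ n)
    (h : RF' C n a) (hc : c ∈ C) (h1 : c ≠ 1) : a * c * a⁻¹ ∉ C := by
  have h2 : ((1 : ℕ) : ℕ∞) < n := lt_of_lt_of_le (by norm_num) hn
  exact h 1 1 false _ (W.neg W.pos0 hc (fun _ => h1)) h2 h2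

section Pushout

open Monoid

variable {G : Bool → Type} [∀ b, Group (G b)] {C : Type} [Group C] {φ : ∀ b, C →* G b}

variable (φ) in
/-- Values of nonempty reduced words starting in `G i` and ending in `G j`. -/
inductive S (i : Bool) : Bool → PushoutI φ → Prop
  | single (x : G i) : x ∉ (φ i).range → S i i (PushoutI.of i x)
  | snoc {j k z} (y : G k) : S i j z → j ≠ k → y ∉ (φ k).range → S i k (z * PushoutI.of k y)

variable (φ) in
/-- Palindromic version of `S i i`. -/
inductive T : Bool → PushoutI φ → Prop
  | single {i} (x : G i) : x ∉ (φ i).range → T i (PushoutI.of i x)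
  | wrap {i j r} (x y : G i) : x ∉ (φ i).range → T j r → i ≠ j → y ∉ (φ i).range →
      T i (PushoutI.of i x * r * PushoutI.of i y)

theorem S.mul {i j k l : Bool} {x y : PushoutI φ} (hx : S φ i j x) (hjk : j ≠ k)
    (hy : S φ k l y) : S φ i l (x * y) := by
  induction hy with
  | single y h => exact S.snoc y hx hjk h
  | snoc y _ hne hy ih =>
    rw [← mul_assoc]
    exact S.snoc y ih hne hy

theorem S.inv {i j : Bool} {x : PushoutI φ} (hx : S φ i j x) : S φ j i x⁻¹ := by
  induction hx with
  | single y h => rw [← map_inv]; exact S.single _ (by simpa using h)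
  | snoc y _ hne hy ih =>
    rw [mul_inv_rev, ← map_inv]
    exact (S.single _ (by simpa using hy)).mul hne.symm ih

theorem mem_mul_base {i : Bool} {x : G i} (c : C) (hx : x ∉ (φ i).range) :
    x * φ i c ∉ (φ i).range := by
  rwa [Subgroup.mul_mem_cancel_right _ (MonoidHom.mem_range.mpr ⟨c, rfl⟩)]

theorem S.mul_base {i j : Bool} {x : PushoutI φ} (hx : S φ i j x) (c : C) :
    S φ i j (x * PushoutI.base φ c) := by
  cases hx with
  | single y h =>
    rw [← PushoutI.of_apply_eq_base φ i, ← map_mul]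
    exact S.single _ (mem_mul_base c h)
  | snoc y hz hne hy =>
    rw [← PushoutI.of_apply_eq_base φ j, mul_assoc, ← map_mul]
    exact S.snoc _ hz hne (mem_mul_base c hy)

theorem S.exists_word {i j : Bool} {x : PushoutI φ} (hx : S φ i j x) :
    ∃ w : CoprodI.NeWord G i j, (∀ g ∈ w.toList, g.2 ∉ (φ g.1).range) ∧
      PushoutI.ofCoprodI w.prod = x := by
  have ne1 : ∀ (i : Bool) (x : G i), x ∉ (φ i).range → x ≠ 1 := by
    rintro i x h rfl
    exact h (one_mem _)
  induction hx with
  | single y h =>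
    refine ⟨.singleton y (ne1 _ _ h), ?_, ?_⟩
    · simpa using h
    · simp
  | snoc y _ hne hy ih =>
    obtain ⟨w, hw, hw'⟩ := ih
    refine ⟨.append w hne (.singleton y (ne1 _ _ hy)), ?_, ?_⟩
    · intro g hg
      simp only [CoprodI.NeWord.toList, List.mem_append, List.mem_singleton] at hg
      rcases hg with hg | rfl
      · exact hw g hg
      · exact hy
    · simp [hw']

theorem S.not_mem_base (hφ : ∀ i, Function.Injective (φ i)) {i j : Bool} {x : PushoutI φ}
    (hx : S φ i j x) : x ∉ (PushoutI.base φ).range := by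
  obtain ⟨w, hw, rfl⟩ := hx.exists_word
  intro hm
  have := PushoutI.Reduced.eq_empty_of_mem_range hφ (w := w.toWord) hw hm
  exact w.toList_ne_nil (congrArg CoprodI.Word.toList this)

theorem S.not_mem_of (hφ : ∀ i, Function.Injective (φ i)) {b d : Bool} (hbd : b ≠ d)
    {x : PushoutI φ} (hx : S φ d d x) : x ∉ (PushoutI.of (φ := φ) b).range := by
  rintro ⟨a, rfl⟩
  by_cases ha : a ∈ (φ b).range
  · obtain ⟨c, rfl⟩ := ha
    exact hx.not_mem_base hφ ⟨c, (PushoutI.of_apply_eq_base φ b c).symm⟩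
  · have := hx.mul hbd.symm (S.single _ ha).inv
    apply this.not_mem_base hφ
    simp

theorem exhaust (g : PushoutI φ) :
    g ∈ (PushoutI.base φ).range ∨ ∃ i j, S φ i j g := by
  have key : ∀ x : PushoutI φ, (x ∈ (PushoutI.base φ).range ∨ ∃ i j, S φ i j x) →
      (x * g ∈ (PushoutI.base φ).range ∨ ∃ i j, S φ i j (x * g)) := by
    have hb : ∀ (h : C) (x : PushoutI φ), (x ∈ (PushoutI.base φ).range ∨ ∃ i j, S φ i j x) →
      (x * PushoutI.base φ h ∈ (PushoutI.base φ).range ∨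
        ∃ i j, S φ i j (x * PushoutI.base φ h)) := by
      rintro h x (⟨c, rfl⟩ | ⟨i, j, hx⟩)
      · left; exact ⟨c * h, by simp⟩
      · right; exact ⟨i, j, hx.mul_base h⟩
    have ho : ∀ (i : Bool) (y : G i), (PushoutI.of i y ∈ (PushoutI.base φ).range ∨
        ∃ i' j, S φ i' j (PushoutI.of i y)) := by
      intro i y
      by_cases hy : y ∈ (φ i).range
      · obtain ⟨c, rfl⟩ := hy
        left; exact ⟨c, (PushoutI.of_apply_eq_base φ i c).symm⟩
      · right; exact ⟨i, i, S.single _ hy⟩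
    induction g using PushoutI.induction_on with
    | base h => exact hb h
    | mul x y ihx ihy =>
      intro z hz
      rw [← mul_assoc]
      exact ihy _ (ihx _ hz)
    | of k y =>
      intro x hx
      by_cases hy : y ∈ (φ k).range
      · obtain ⟨c, rfl⟩ := hy
        rw [PushoutI.of_apply_eq_base φ k c]
        exact hb c x hx
      · rcases hx with ⟨c, rfl⟩ | ⟨i, j, hx⟩
        · rw [← PushoutI.of_apply_eq_base φ k c, ← map_mul]
          exact ho _ _
        · by_cases hjk : j = k
          · subst hjk
            cases hx with
            | single x hx => rw [← map_mul]; exact ho _ _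
            | @snoc l _ z y' hz hne hy' =>
              rw [mul_assoc, ← map_mul]
              by_cases hyy : y' * y ∈ (φ j).range
              · obtain ⟨c, hc⟩ := hyy
                rw [← hc, PushoutI.of_apply_eq_base φ j c]
                right; exact ⟨i, l, hz.mul_base c⟩
              · right; exact ⟨i, j, S.snoc _ hz hne hyy⟩
          · right; exact ⟨i, k, S.snoc _ hx hjk hy⟩
  simpa using key 1 (Or.inl (one_mem _))

theorem S.strip {b d : Bool} (hbd : b ≠ d) {i j : Bool} {x : PushoutI φ} (hx : S φ i j x) :
    x ∈ (PushoutI.of (φ := φ) b).range ∨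
      ∃ v ∈ (PushoutI.of (φ := φ) b).range, ∃ z, S φ i d z ∧ x = z * v := by
  by_cases hj : j = d
  · subst hj
    right; exact ⟨1, one_mem _, x, hx, by simp⟩
  · have hjb : j = b := by cases j <;> cases b <;> cases d <;> simp_all
    subst hjb
    cases hx with
    | single y h => left; exact ⟨y, rfl⟩
    | @snoc l _ z y hz hne hy =>
      right
      have hl : l = d := by cases l <;> cases j <;> cases d <;> simp_all
      subst hl
      exact ⟨_, ⟨y, rfl⟩, z, hz, rfl⟩

theorem exists_coset {b d : Bool} (hbd : b ≠ d) {g : PushoutI φ}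
    (hg : g ∉ (PushoutI.of (φ := φ) b).range) :
    ∃ u ∈ (PushoutI.of (φ := φ) b).range, ∃ v ∈ (PushoutI.of (φ := φ) b).range,
      ∃ z, S φ d d z ∧ g = u * z * v := by
  rcases exhaust g with ⟨c, rfl⟩ | ⟨i, j, h⟩
  · exact absurd ⟨φ b c, PushoutI.of_apply_eq_base φ b c⟩ hg
  · rcases h.strip hbd with h | ⟨v, hv, z, hz, rfl⟩
    · exact absurd h hg
    · rcases hz.inv.strip hbd with h | ⟨u, hu, z', hz', h⟩
      · exact absurd (mul_mem (inv_mem_iff.mp h) hv) hg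
      · refine ⟨u⁻¹, inv_mem hu, v, hv, z'⁻¹, hz'.inv, ?_⟩
        rw [← mul_inv_rev, ← h, inv_inv]

theorem T.toS {i : Bool} {x : PushoutI φ} (h : T φ i x) : S φ i i x := by
  induction h with
  | single x h => exact S.single x h
  | wrap x y hx _ hij hy ih =>
    exact S.snoc _ ((S.single x hx).mul hij ih) hij.symm hy

theorem T.mul_two {i j : Bool} {z : PushoutI φ} (h : T φ i z) (hij : i ≠ j) (u : G j) (v : G i)
    (hu : u ∉ (φ j).range) (hv : v ∉ (φ i).range) :
    T φ i (z * PushoutI.of j u * PushoutI.of i v) := by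
  induction h generalizing j with
  | single x hx => exact T.wrap x v hx (T.single u hu) hij hv
  | @wrap i k r x y hx hr hik hy ih =>
    have hk : k = j := by cases i <;> cases j <;> cases k <;> simp_all
    subst hk
    have := T.wrap x v hx (ih hik.symm y u hy hu) hik hv
    simpa only [mul_assoc] using this

theorem S.toT_aux {i j : Bool} {z : PushoutI φ} (h : S φ i j z) :
    (i = j → T φ i z) ∧
      (i ≠ j → ∃ w, T φ i w ∧ ∃ u : G j, u ∉ (φ j).range ∧ z = w * PushoutI.of j u) := by
  induction h with
  | single x hx => exact ⟨fun _ => T.single x hx, fun h => absurd rfl h⟩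
  | @snoc j k z y hz hne hy ih =>
    constructor
    · rintro rfl
      obtain ⟨w, hw, u, hu, rfl⟩ := ih.2 hne.symm
      exact hw.mul_two hne.symm u y hu hy
    · intro hik
      have : i = j := by cases i <;> cases j <;> cases k <;> simp_all
      exact ⟨z, ih.1 this, y, hy, rfl⟩

theorem S.toT {i : Bool} {z : PushoutI φ} (h : S φ i i z) : T φ i z := h.toT_aux.1 rfl

theorem W_pow {A : Type} [Group A] (D : Subgroup A) (a : A) (l : ℕ) :
    W D a (l + 1) 0 true (a ^ (l + 1)) := by
  induction l with
  | zero => simpa using W.pos0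
  | succ l ih => simpa [pow_succ] using W.pos ih (one_mem D) (by simp)

theorem wrap_pow {i j : Bool} (hij : i ≠ j) (x y : G i) (hx : x ∉ (φ i).range)
    (hy : y ∉ (φ i).range) (hyx : y * x ∉ (φ i).range) {r : PushoutI φ} (hr : S φ j j r) (l : ℕ) :
    ∃ Z, S φ i j Z ∧
      (PushoutI.of i x * r * PushoutI.of i y) ^ (l + 1) = Z * PushoutI.of i y := by
  induction l with
  | zero => exact ⟨_, (S.single x hx).mul hij hr, by simp⟩
  | succ l ih =>
    obtain ⟨Z, hZ, h⟩ := ih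
    refine ⟨Z * PushoutI.of i (y * x) * r, ((hZ.snoc _ hij.symm hyx).mul hij hr), ?_⟩
    rw [pow_succ, h]
    simp [mul_assoc]

theorem T.pow {n : ℕ∞} (hn : 2 ≤ n) (hRF : ∀ i, ∀ a : G i, a ∉ (φ i).range → RF' (φ i).range n a)
    {i : Bool} {z : PushoutI φ} (h : T φ i z) (c : C) (l : ℕ) (hl : ((l + 1 : ℕ) : ℕ∞) < n) :
    S φ i i ((z * PushoutI.base φ c) ^ (l + 1)) := by
  have hn0 : ((0 : ℕ) : ℕ∞) < n := lt_of_lt_of_le (by norm_num) hn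
  induction h generalizing c with
  | @single i x hx =>
    rw [← PushoutI.of_apply_eq_base φ i, ← map_mul, ← map_pow]
    have hx' := mem_mul_base c hx
    exact S.single _ (hRF i _ hx' _ _ _ _ (W_pow _ _ l) hl hn0)
  | @wrap i j r x y hx hr hij hy ih =>
    rw [← PushoutI.of_apply_eq_base φ i, mul_assoc, ← map_mul]
    have hy' := mem_mul_base c hy
    set y' := y * φ i c
    by_cases hyx : y' * x ∈ (φ i).range
    · obtain ⟨c', hc'⟩ := hyx
      have hy2 : PushoutI.of i y' = PushoutI.base φ c' * (PushoutI.of (φ := φ) i x)⁻¹ := by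
        rw [← PushoutI.of_apply_eq_base φ i, hc']; simp
      have : PushoutI.of i x * r * PushoutI.of i y' =
          PushoutI.of i x * (r * PushoutI.base φ c') * (PushoutI.of (φ := φ) i x)⁻¹ := by
        rw [hy2]; simp only [mul_assoc]
      rw [this, conj_pow]
      exact ((S.single x hx).mul hij (ih c')).mul hij.symm (S.single x hx).inv
    · obtain ⟨Z, hZ, h⟩ := wrap_pow hij x y' hx hy' hyx hr.toS l
      rw [h]
      exact (S.snoc _ hZ hij.symm hy')

/-- products `x a y` with `x,y ∈ G d` and `a ∈ G b`. -/
theorem sandwich {b d : Bool} (hbd : b ≠ d) (x y : G d) (hx : x ∉ (φ d).range)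
    (hy : y ∉ (φ d).range) (a : G b)
    (h : ∀ c, a = φ b c → x * φ d c * y ∉ (φ d).range) :
    S φ d d (PushoutI.of d x * PushoutI.of b a * PushoutI.of d y) := by
  by_cases ha : a ∈ (φ b).range
  · obtain ⟨c, rfl⟩ := ha
    rw [PushoutI.of_apply_eq_base φ b c, ← PushoutI.of_apply_eq_base φ d c, ← map_mul, ← map_mul]
    exact S.single _ (h c rfl)
  · exact ((S.single x hx).snoc _ hbd.symm ha).snoc _ hbd hy

theorem sandwich_conj {b d : Bool} (hbd : b ≠ d) {n : ℕ∞} (hn : 2 ≤ n)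
    (hφ : ∀ i, Function.Injective (φ i)) (hRF : ∀ a : G d, a ∉ (φ d).range → RF' (φ d).range n a)
    (x : G d) (hx : x ∉ (φ d).range) (a : G b) (ha : PushoutI.of (φ := φ) b a ≠ 1) :
    S φ d d (PushoutI.of d x * PushoutI.of b a * (PushoutI.of d x)⁻¹) := by
  rw [← map_inv]
  refine sandwich hbd x x⁻¹ hx (by simpa using hx) a ?_
  rintro c rfl
  refine RF'_malnormal hn (hRF x hx) ⟨c, rfl⟩ ?_
  intro h1
  apply ha
  rw [PushoutI.of_apply_eq_base, ← PushoutI.of_apply_eq_base φ d, h1, map_one]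

/-- Case 1: a single letter. -/
theorem case_one {b d : Bool} (hbd : b ≠ d) {n : ℕ∞}
    (hRF : ∀ a : G d, a ∉ (φ d).range → RF' (φ d).range n a)
    (x : G d) (hx : x ∉ (φ d).range) {p q : ℕ} {s : Bool} {z : PushoutI φ}
    (h : W (PushoutI.of (φ := φ) b).range (PushoutI.of d x) p q s z)
    (hp : (p : ℕ∞) < n) (hq : (q : ℕ∞) < n) :
    ∃ p' ≤ p, ∃ q' ≤ q, ∃ Z y, W (φ d).range x p' q' s y ∧ z = Z * PushoutI.of d y ∧
      (Z = 1 ∨ S φ d b Z) := by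
  have mono : ∀ {m k : ℕ}, m ≤ k → (k : ℕ∞) < n → (m : ℕ∞) < n := by
    intro m k h h'
    exact lt_of_le_of_lt (by exact_mod_cast h) h'
  induction h with
  | pos0 => exact ⟨1, le_rfl, 0, le_rfl, 1, x, W.pos0, by simp, Or.inl rfl⟩
  | neg0 => exact ⟨0, le_rfl, 1, le_rfl, 1, x⁻¹, W.neg0, by simp, Or.inl rfl⟩
  | @pos p q s z c hw hc hs ih =>
    obtain ⟨p', hp', q', hq', Z, y, hy, rfl, hZ⟩ := ih (mono (by omega) hp) hq
    obtain ⟨a, rfl⟩ := hc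
    by_cases ha : a ∈ (φ b).range
    · obtain ⟨c, rfl⟩ := ha
      rw [PushoutI.of_apply_eq_base, ← PushoutI.of_apply_eq_base φ d] at hs ⊢
      refine ⟨p' + 1, by omega, q', hq', Z, y * φ d c * x, W.pos hy ⟨c, rfl⟩ ?_, ?_, hZ⟩
      · intro h h1; exact hs h (by rw [h1, map_one])
      · simp [mul_assoc]
    · have hyC := hRF x hx _ _ _ _ hy (mono (by omega) hp) (mono hq' hq)
      refine ⟨1, by omega, 0, by omega, Z * PushoutI.of d y * PushoutI.of b a, x, W.pos0,
        rfl, Or.inr ?_⟩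
      rcases hZ with rfl | hZ
      · rw [one_mul]; exact (S.single y hyC).snoc _ hbd.symm ha
      · exact (hZ.snoc _ hbd hyC).snoc _ hbd.symm ha
  | @neg p q s z c hw hc hs ih =>
    obtain ⟨p', hp', q', hq', Z, y, hy, rfl, hZ⟩ := ih hp (mono (by omega) hq)
    obtain ⟨a, rfl⟩ := hc
    by_cases ha : a ∈ (φ b).range
    · obtain ⟨c, rfl⟩ := ha
      rw [PushoutI.of_apply_eq_base, ← PushoutI.of_apply_eq_base φ d] at hs ⊢
      refine ⟨p', hp', q' + 1, by omega, Z, y * φ d c * x⁻¹, W.neg hy ⟨c, rfl⟩ ?_, ?_, hZ⟩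
      · intro h h1; exact hs h (by rw [h1, map_one])
      · simp [mul_assoc]
    · have hyC := hRF x hx _ _ _ _ hy (mono hp' hp) (mono (by omega) hq)
      refine ⟨0, by omega, 1, by omega, Z * PushoutI.of d y * PushoutI.of b a, x⁻¹, W.neg0,
        by simp, Or.inr ?_⟩
      rcases hZ with rfl | hZ
      · rw [one_mul]; exact (S.single y hyC).snoc _ hbd.symm ha
      · exact (hZ.snoc _ hbd hyC).snoc _ hbd.symm ha

/-- Case 2: no cancellation between `y` and `x`. -/
theorem case_two {b d : Bool} (hbd : b ≠ d) {n : ℕ∞} (hn : 2 ≤ n)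
    (hφ : ∀ i, Function.Injective (φ i))
    (hRF : ∀ a : G d, a ∉ (φ d).range → RF' (φ d).range n a)
    (x y : G d) (hx : x ∉ (φ d).range) (hy : y ∉ (φ d).range) {r : PushoutI φ} (hr : S φ b b r)
    (hyx : ∀ c, y * φ d c * x ∉ (φ d).range) {p q : ℕ} {s : Bool} {z : PushoutI φ}
    (h : W (PushoutI.of (φ := φ) b).range (PushoutI.of d x * r * PushoutI.of d y) p q s z) :
    ∃ Z, S φ d b Z ∧ z = Z * (if s then PushoutI.of d y else (PushoutI.of d x)⁻¹) := by
  have hx' : x⁻¹ ∉ (φ d).range := by simpa using hx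
  have hy' : y⁻¹ ∉ (φ d).range := by simpa using hy
  induction h with
  | pos0 => exact ⟨_, (S.single x hx).mul hbd.symm hr, by simp⟩
  | neg0 =>
    refine ⟨_, (S.single y hy).inv.mul hbd.symm hr.inv, by simp [mul_assoc]⟩
  | @pos p q s z c hw hc hs ih =>
    obtain ⟨Z, hZ, rfl⟩ := ih
    obtain ⟨a, rfl⟩ := hc
    have hM : S φ d d ((if s then PushoutI.of d y else (PushoutI.of d x)⁻¹) * PushoutI.of b a *
        PushoutI.of d x) := by
      cases s
      · simpa using sandwich_conj hbd hn hφ hRF x⁻¹ hx' a (hs rfl)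
      · simpa using sandwich hbd y x hy hx a (fun c _ => hyx c)
    refine ⟨_, (hZ.mul hbd hM).mul hbd.symm hr, ?_⟩
    simp [mul_assoc]
  | @neg p q s z c hw hc hs ih =>
    obtain ⟨Z, hZ, rfl⟩ := ih
    obtain ⟨a, rfl⟩ := hc
    have hM : S φ d d ((if s then PushoutI.of d y else (PushoutI.of d x)⁻¹) * PushoutI.of b a *
        (PushoutI.of d y)⁻¹) := by
      cases s
      · have := sandwich (φ := φ) hbd x⁻¹ y⁻¹ hx' hy' a (fun c _ h => hyx c⁻¹ (by
          simpa [mul_assoc] using inv_mem h))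
        simpa using this
      · simpa using sandwich_conj hbd hn hφ hRF y hy a (hs rfl)
    refine ⟨_, (hZ.mul hbd hM).mul hbd.symm hr.inv, ?_⟩
    simp [mul_assoc]

/-- Case 3: a conjugate. -/
theorem case_three {b d : Bool} (hbd : b ≠ d) {n : ℕ∞} (hn : 2 ≤ n)
    (hφ : ∀ i, Function.Injective (φ i))
    (hRF : ∀ a : G d, a ∉ (φ d).range → RF' (φ d).range n a)
    (x : G d) (hx : x ∉ (φ d).range) {r : PushoutI φ}
    (hr : ∀ l : ℕ, ((l + 1 : ℕ) : ℕ∞) < n → S φ b b (r ^ (l + 1)))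
    {p q : ℕ} {s : Bool} {z : PushoutI φ}
    (h : W (PushoutI.of (φ := φ) b).range (PushoutI.of d x * r * (PushoutI.of d x)⁻¹) p q s z)
    (hp : (p : ℕ∞) < n) (hq : (q : ℕ∞) < n) :
    ∃ Z l, l + 1 ≤ (if s then p else q) ∧ S φ d d Z ∧
      z = Z * (if s then r else r⁻¹) ^ (l + 1) * (PushoutI.of d x)⁻¹ := by
  have mono : ∀ {m k : ℕ}, m ≤ k → (k : ℕ∞) < n → (m : ℕ∞) < n := by
    intro m k h h'
    exact lt_of_le_of_lt (by exact_mod_cast h) h'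
  have hx' : x⁻¹ ∉ (φ d).range := by simpa using hx
  have hr' : ∀ (s : Bool) (l : ℕ), ((l + 1 : ℕ) : ℕ∞) < n →
      S φ b b ((if s then r else r⁻¹) ^ (l + 1)) := by
    intro s l hl
    cases s
    · simpa using (hr l hl).inv
    · simpa using hr l hl
  induction h with
  | pos0 => exact ⟨_, 0, by simp, S.single x hx, by simp⟩
  | neg0 => exact ⟨_, 0, by simp, S.single x hx, by simp [mul_assoc]⟩
  | @pos p q s z c hw hc hs ih =>
    obtain ⟨Z, l, hl, hZ, rfl⟩ := ih (mono (by omega) hp) hq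
    obtain ⟨a, rfl⟩ := hc
    by_cases ha : PushoutI.of (φ := φ) b a = 1
    · have hst : s = true := by cases s <;> simp_all
      subst hst
      refine ⟨Z, l + 1, by simpa using hl, hZ, ?_⟩
      rw [ha]
      simp [pow_succ, mul_assoc]
    · have hM : S φ d d ((PushoutI.of d x)⁻¹ * PushoutI.of b a * PushoutI.of d x) := by
        simpa using sandwich_conj hbd hn hφ hRF x⁻¹ hx' a ha
      have hln : ((l + 1 : ℕ) : ℕ∞) < n := by
        cases s
        · exact mono hl hq
        · exact mono (Nat.le_succ_of_le hl) hp
      refine ⟨_, 0, by simp, (hZ.mul hbd.symm (hr' s l hln)).mul hbd hM, ?_⟩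
      simp [mul_assoc]
  | @neg p q s z c hw hc hs ih =>
    obtain ⟨Z, l, hl, hZ, rfl⟩ := ih hp (mono (by omega) hq)
    obtain ⟨a, rfl⟩ := hc
    by_cases ha : PushoutI.of (φ := φ) b a = 1
    · have hst : s = false := by cases s <;> simp_all
      subst hst
      refine ⟨Z, l + 1, by simpa using hl, hZ, ?_⟩
      rw [ha]
      simp [pow_succ, mul_assoc]
    · have hM : S φ d d ((PushoutI.of d x)⁻¹ * PushoutI.of b a * PushoutI.of d x) := by
        simpa using sandwich_conj hbd hn hφ hRF x⁻¹ hx' a ha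
      have hln : ((l + 1 : ℕ) : ℕ∞) < n := by
        cases s
        · exact mono (Nat.le_succ_of_le hl) hq
        · exact mono hl hp
      refine ⟨_, 0, by simp, (hZ.mul hbd.symm (hr' s l hln)).mul hbd hM, ?_⟩
      simp [mul_assoc]

theorem RF'_T {b d : Bool} (hbd : b ≠ d) {n : ℕ∞} (hn : 2 ≤ n)
    (hφ : ∀ i, Function.Injective (φ i))
    (hRF : ∀ i, ∀ a : G i, a ∉ (φ i).range → RF' (φ i).range n a)
    {g : PushoutI φ} (hg : T φ d g) : RF' (PushoutI.of (φ := φ) b).range n g := by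
  have mono : ∀ {m k : ℕ}, m ≤ k → (k : ℕ∞) < n → (m : ℕ∞) < n := by
    intro m k h h'
    exact lt_of_le_of_lt (by exact_mod_cast h) h'
  cases hg with
  | single x hx =>
    intro p q s z hz hp hq
    obtain ⟨p', hp', q', hq', Z, y, hy, rfl, hZ⟩ := case_one hbd (hRF d) x hx hz hp hq
    have hyC := hRF d x hx _ _ _ _ hy (mono hp' hp) (mono hq' hq)
    refine S.not_mem_of hφ hbd ?_
    rcases hZ with rfl | hZ
    · rw [one_mul]; exact S.single y hyC
    · exact hZ.snoc _ hbd hyC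
  | @wrap _ j r x y hx hr hij hy =>
    have hj : j = b := by cases j <;> cases b <;> cases d <;> simp_all
    subst hj
    by_cases hyx : ∀ c, y * φ d c * x ∉ (φ d).range
    · intro p q s z hz hp hq
      obtain ⟨Z, hZ, rfl⟩ := case_two hbd hn hφ (hRF d) x y hx hy hr.toS hyx hz
      refine S.not_mem_of hφ hbd ?_
      cases s
      · exact hZ.mul hbd (S.single x hx).inv
      · exact hZ.snoc _ hbd hy
    · push Not at hyx
      obtain ⟨c, c', hc'⟩ := hyx
      have hy2 : PushoutI.of d y = PushoutI.base φ c' * (PushoutI.of (φ := φ) d x)⁻¹ *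
          (PushoutI.base φ c)⁻¹ := by
        rw [← PushoutI.of_apply_eq_base φ d, ← PushoutI.of_apply_eq_base φ d, hc']
        simp [mul_assoc]
      have hg' : PushoutI.of d x * r * PushoutI.of d y = 1 * (PushoutI.of d x *
          (r * PushoutI.base φ c') * (PushoutI.of (φ := φ) d x)⁻¹) * (PushoutI.base φ c)⁻¹ := by
        rw [hy2]; simp only [mul_assoc, one_mul]
      rw [hg']
      refine RF'_coset (one_mem _)
        (inv_mem ⟨φ j c, PushoutI.of_apply_eq_base φ j c⟩) ?_
      intro p q s z hz hp hq
      have hpow : ∀ l : ℕ, ((l + 1 : ℕ) : ℕ∞) < n →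
        S φ j j ((r * PushoutI.base φ c') ^ (l + 1)) := fun l hl => hr.pow hn hRF c' l hl
      obtain ⟨Z, l, hl, hZ, rfl⟩ := case_three hbd hn hφ (hRF d) x hx hpow hz hp hq
      refine S.not_mem_of hφ hbd ?_
      have h1 : S φ j j ((if s then r * PushoutI.base φ c' else (r * PushoutI.base φ c')⁻¹) ^
          (l + 1)) := by
        cases s
        · rw [if_neg (by simp), inv_pow]; exact (hpow l (mono hl hq)).inv
        · exact hpow l (mono hl hp)
      exact (hZ.mul hbd.symm h1).mul hbd (S.single x hx).inv

theorem RF_main {b : Bool} {n : ℕ∞} (hn : 2 ≤ n)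
    (hφ : ∀ i, Function.Injective (φ i))
    (hRF : ∀ i, ∀ a : G i, a ∉ (φ i).range → IsRF (φ i).range n a)
    (g : PushoutI φ) (hg : g ∉ (PushoutI.of (φ := φ) b).range) :
    IsRF (PushoutI.of (φ := φ) b).range n g := by
  have hbd : b ≠ !b := by cases b <;> simp
  obtain ⟨u, hu, v, hv, z, hz, rfl⟩ := exists_coset hbd hg
  exact IsRF_of_RF' (RF'_coset hu hv
    (RF'_T hbd hn hφ (fun i a ha => RF'_of_IsRF ha (hRF i a ha)) hz.toT))

end Pushout

end RFAmalgam

/-- If both `(A, φA(C))` and `(B, φB(C))` are `n`-RF, then the pairs `(A ∗_C B, ι_A(A))` and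
`(A ∗_C B, ι_B(B))` are `n`-RF. -/
theorem stmt10 {C A B : Type} [Group C] [Group A] [Group B]
    (φA : C →* A) (φB : C →* B)
    (hφA : Function.Injective φA) (hφB : Function.Injective φB)
    (n : ℕ∞) (hn : 2 ≤ n)
    (hA : ∀ a : A, a ∉ φA.range → IsRF φA.range n a)
    (hB : ∀ b : B, b ∉ φB.range → IsRF φB.range n b) :
    (∀ g : Amalgam φA φB, g ∉ (iotaA φA φB).range → IsRF (iotaA φA φB).range n g) ∧
    (∀ g : Amalgam φA φB, g ∉ (iotaB φA φB).range → IsRF (iotaB φA φB).range n g) := by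
  have hφ : ∀ i, Function.Injective (amalgamHom φA φB i) := by
    intro i
    cases i
    · exact hφB
    · exact hφA
  have hRF : ∀ i, ∀ a : cond i A B, a ∉ (amalgamHom φA φB i).range →
      IsRF (amalgamHom φA φB i).range n a := by
    intro i
    cases i
    · exact hB
    · exact hA
  exact ⟨RFAmalgam.RF_main (b := true) hn hφ hRF, RFAmalgam.RF_main (b := false) hn hφ hRF⟩
end

section
/- Let G = A ∗_C B be the amalgamated free product via injective homomorphisms φ_A : C → A, φ_B : C → B. Let r ≥ 1 and let g ∈ G be the product g = ι(x_{−r}) ι(x_{−r+1}) ⋯ ι(x_0) ⋯ ι(x_{r−1}) ι(x_r), where for each −r ≤ i ≤ r the element x_i lies in A \ φ_A(C) if i ≡ r (mod 2) and in B \ φ_B(C) otherwise, and ι denotes the canonical map ι_A or ι_B as appropriate. Suppose x_{−r} and x_r are 2-RF relative to φ_A(C) in A, and x_0 is n-RTF relative to φ_A(C) in A (if r is even) or relative to φ_B(C) in B (if r is odd), for some 2 ≤ n ≤ ∞. Then g ∉ ι_B(B) and g is n-RF relative to the subgroup ι_B(B) of G. -/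
namespace RFProof

open Monoid

/-- Left-to-right product of the first `n` terms of a sequence. -/
def pr {G : Type} [Group G] (f : ℕ → G) : ℕ → G
  | 0 => 1
  | n + 1 => pr f n * f n

theorem pr_congr {G : Type} [Group G] {f g : ℕ → G} {n : ℕ} (h : ∀ i < n, f i = g i) :
    pr f n = pr g n := by
  induction n with
  | zero => rfl
  | succ n ih =>
    simp only [pr]
    rw [ih (fun i hi => h i (by omega)), h n (by omega)]

theorem pr_add {G : Type} [Group G] (f : ℕ → G) (a b : ℕ) :
    pr f (a + b) = pr f a * pr (fun i => f (a + i)) b := by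
  induction b with
  | zero => simp [pr]
  | succ b ih => rw [← add_assoc, pr, ih]; simp only [pr, mul_assoc]

theorem pr_succ' {G : Type} [Group G] (f : ℕ → G) (b : ℕ) :
    pr f (b + 1) = f 0 * pr (fun i => f (i + 1)) b := by
  rw [add_comm b 1, pr_add]
  simp [pr, add_comm]

theorem ofFn_prod {G : Type} [Group G] (n : ℕ) (f : Fin n → G) (f' : ℕ → G)
    (h : ∀ i : Fin n, f i = f' i) : (List.ofFn f).prod = pr f' n := by
  induction n with
  | zero => simp [pr]
  | succ n ih =>
    rw [List.ofFn_succ_last, List.prod_append, ih _ (fun i => h i.castSucc)]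
    simp [pr, h]

section Abstract

variable {G : Type} [Group G] (K : Subgroup G) (S : Bool → Subgroup G)

/-- Letter of type `s`. -/
def Ltr (s : Bool) (g : G) : Prop := g ∈ S s ∧ g ∉ K

/-- Reduced alternating products with prescribed first and last types. -/
inductive Alt : Bool → Bool → G → Prop
  | single {s : Bool} {g : G} : Ltr K S s g → Alt s s g
  | cons {s t : Bool} {g h : G} : Ltr K S s g → Alt (!s) t h → Alt s t (g * h)

/-- In the base or alternating. -/
def QQ (s : Bool) (g : G) : Prop := g ∈ K ∨ Alt K S s s g

variable {K S}

theorem Ltr.inv {s : Bool} {g : G} (h : Ltr K S s g) : Ltr K S s g⁻¹ :=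
  ⟨inv_mem h.1, fun h' => h.2 (by simpa using h')⟩

theorem Alt.mul {s t u v : Bool} {g h : G} (hg : Alt K S s t g) (hh : Alt K S u v h)
    (htu : u = !t) : Alt K S s v (g * h) := by
  induction hg with
  | single hl => subst htu; exact Alt.cons hl hh
  | cons hl _ ih => rw [mul_assoc]; exact Alt.cons hl (ih htu)

theorem sandwich {s : Bool} {y z p : G} (hy : Ltr K S (!s) y) (hz : Ltr K S (!s) z)
    (hp : Alt K S s s p) : Alt K S (!s) (!s) (y * p * z) := by
  have h1 : Alt K S (!s) s (y * p) := Alt.cons hy (by simpa using hp)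
  exact h1.mul (Alt.single hz) rfl

theorem sandwichQ (hK : ∀ s, K ≤ S s) {s : Bool} {y z p : G} (hy : Ltr K S (!s) y)
    (hz : Ltr K S (!s) z)
    (hp : QQ K S s p) : QQ K S (!s) (y * p * z) := by
  rcases hp with hp | hp
  · by_cases h : y * p * z ∈ K
    · exact Or.inl h
    · exact Or.inr (Alt.single ⟨mul_mem (mul_mem hy.1 (hK _ hp)) hz.1, h⟩)
  · exact Or.inr (sandwich hy hz hp)

theorem chainQ (hK : ∀ s, K ≤ S s) (y z Y Z : ℕ → G) (b : G) (r : ℕ)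
    (hY0 : Y 0 = 1) (hZ0 : Z 0 = 1) (hY : ∀ i < r, Y (i + 1) = y i * Y i)
    (hZ : ∀ i < r, Z (i + 1) = Z i * z i)
    (hy : ∀ i < r, Ltr K S (i + 1).bodd (y i)) (hz : ∀ i < r, Ltr K S (i + 1).bodd (z i))
    (hb : QQ K S false b) : QQ K S r.bodd (Y r * b * Z r) := by
  have : ∀ i ≤ r, QQ K S i.bodd (Y i * b * Z i) := by
    intro i
    induction i with
    | zero => intro _; simpa [hY0, hZ0] using hb
    | succ i ih =>
      intro hi
      have h1 := ih (by omega)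
      have h2 := hy i (by omega)
      have h3 := hz i (by omega)
      rw [Nat.bodd_succ] at h2 h3 ⊢
      have := sandwichQ hK h2 h3 h1
      rw [hY i (by omega), hZ i (by omega)]
      simpa only [mul_assoc] using this
  exact this r le_rfl

theorem chainA (hK : ∀ s, K ≤ S s) (y Y : ℕ → G) (b : G) (r : ℕ) (hr : 1 ≤ r)
    (hY0 : Y 0 = 1) (hY : ∀ i < r, Y (i + 1) = y i * Y i)
    (hy : ∀ i < r, Ltr K S (i + 1).bodd (y i))
    (hb : b ∈ S false) (hb1 : b ≠ 1)
    (hrf : ∀ c ∈ K, y 0 * c * (y 0)⁻¹ ∈ K → c = 1) :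
    Alt K S r.bodd r.bodd (Y r * b * (Y r)⁻¹) := by
  have : ∀ i < r, Alt K S (i + 1).bodd (i + 1).bodd (Y (i + 1) * b * (Y (i + 1))⁻¹) := by
    intro i
    induction i with
    | zero =>
      intro h0
      have h2 := hy 0 h0
      rw [hY 0 h0, hY0]
      simp only [mul_one]
      by_cases hbK : b ∈ K
      · refine Alt.single ⟨mul_mem (mul_mem h2.1 (hK _ hbK)) (inv_mem h2.1), fun h => hb1 ?_⟩
        exact hrf b hbK h
      · exact sandwich (s := false) h2 h2.inv (Alt.single ⟨hb, hbK⟩)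
    | succ i ih =>
      intro hi
      have h1 := ih (by omega)
      have h2 := hy (i + 1) (by omega)
      rw [Nat.bodd_succ] at h2 ⊢
      have := sandwich h2 h2.inv h1
      rw [hY (i + 1) (by omega)]
      simpa only [mul_assoc, mul_inv_rev] using this
  obtain ⟨r', rfl⟩ : ∃ r', r = r' + 1 := ⟨r - 1, by omega⟩
  exact this r' (by omega)

variable (K) in
/-- Elements of `K X K X ⋯ X K` with `l` occurrences of `X`. -/
inductive Run (X : G) : ℕ → G → Prop
  | one {c : G} : c ∈ K → Run X 0 c
  | succ {l : ℕ} {R c : G} : Run X l R → c ∈ K → Run X (l + 1) (R * X * c)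

theorem Run.prepend {X R c : G} {l : ℕ} (h : Run K X l R) (hc : c ∈ K) :
    Run K X (l + 1) (c * X * R) := by
  induction h with
  | one h' => exact Run.succ (Run.one hc) h'
  | succ _ hc' ih => simpa only [mul_assoc] using Run.succ ih hc'

theorem Run.inv {X R : G} {l : ℕ} (h : Run K X l R) : Run K X⁻¹ l R⁻¹ := by
  induction h with
  | one h' => exact Run.one (inv_mem h')
  | succ _ hc' ih => simpa only [mul_assoc, mul_inv_rev] using Run.prepend ih (inv_mem hc')

theorem Run.mem {X R : G} {l : ℕ} (h : Run K X l R) {H : Subgroup G} (hX : X ∈ H) (hK : K ≤ H) :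
    R ∈ H := by
  induction h with
  | one h' => exact hK h'
  | succ _ hc' ih => exact mul_mem (mul_mem ih hX) (hK hc')

theorem Run.exists_seq {X R : G} {l : ℕ} (h : Run K X l R) :
    ∃ c0 ∈ K, ∃ c : ℕ → G, (∀ i, c i ∈ K) ∧ R = c0 * pr (fun i => X * c i) l := by
  induction h with
  | @one c h' => exact ⟨c, h', fun _ => 1, fun _ => one_mem _, by simp [pr]⟩
  | @succ l R c _ hc' ih =>
    obtain ⟨c0, h0, d, hd, rfl⟩ := ih
    refine ⟨c0, h0, fun i => if i < l then d i else c, fun i => ?_, ?_⟩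
    · dsimp only; split_ifs
      exacts [hd i, hc']
    · simp only [pr]
      rw [pr_congr (f := fun i => X * if i < l then d i else c) (g := fun i => X * d i)]
      · simp [mul_assoc]
      · intro i hi; simp [hi]

theorem Run.not_mem {X R : G} {l : ℕ} {n : ℕ∞}
    (hX : ∀ k : ℕ, ((k + 1 : ℕ) : ℕ∞) < n → ∀ c : ℕ → G, (∀ i, c i ∈ K) →
      pr (fun i => X * c i) (k + 1) ≠ 1)
    (h : Run K X (l + 1) R) (hl : ((l + 1 : ℕ) : ℕ∞) < n) : R ∉ K := by
  intro hR
  cases h with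
  | @succ _ R' c h' hc =>
    obtain ⟨c0, h0, d, hd, rfl⟩ := h'.exists_seq
    set D := pr (fun i => X * d i) l with hD
    refine hX l hl (fun i => if i < l then d i else c * (c0 * D * X * c)⁻¹ * c0) (fun i => ?_) ?_
    · split_ifs
      exacts [hd i, mul_mem (mul_mem hc (inv_mem hR)) h0]
    · simp only [pr]
      rw [pr_congr (f := fun i => X * if i < l then d i else _) (g := fun i => X * d i), ← hD]
      · simp; group
      · intro i hi; simp [hi]

theorem core (hK : ∀ s, K ≤ S s) (hA : ∀ s t g, Alt K S s t g → g ∉ K)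
    (n : ℕ∞) (T : Bool) (X : G) (hXS : X ∈ S T)
    (hX : ∀ k : ℕ, ((k + 1 : ℕ) : ℕ∞) < n → ∀ c : ℕ → G, (∀ i, c i ∈ K) →
      pr (fun i => X * c i) (k + 1) ≠ 1)
    (N : ℕ) (e : ℕ → ℤ) (U : ℕ → G) (he : ∀ i, e i = 1 ∨ e i = -1)
    (hU : ∀ i, (U i ∈ K ∧ e (i + 1) = e i) ∨ Alt K S (!T) (!T) (U i))
    (hpe : ∀ i, e (N + 1 + i) = e i) (hpU : ∀ i, U (N + 1 + i) = U i)
    (hcount : ∀ ε : ℤ, ε = 1 ∨ ε = -1 →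
      ((Nat.count (fun i => e i = ε) (N + 1) : ℕ) : ℕ∞) < n) :
    pr (fun i => X ^ e i * U i) (N + 1) ≠ 1 := by
  -- runs of either sign avoid `K`
  have hrun : ∀ ε : ℤ, ε = 1 ∨ ε = -1 → ∀ l R, Run K (X ^ ε) (l + 1) R →
      ((l + 1 : ℕ) : ℕ∞) < n → R ∉ K := by
    rintro ε (rfl | rfl) l R h hl
    · rw [zpow_one] at h
      exact h.not_mem hX hl
    · rw [zpow_neg_one] at h
      have h' := h.inv
      rw [inv_inv] at h'
      intro hR
      exact h'.not_mem hX hl (inv_mem hR)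
  intro hone
  by_cases hall : ∀ i, U i ∈ K ∧ e (i + 1) = e i
  · have hec : ∀ i, e i = e 0 := by
      intro i
      induction i with
      | zero => rfl
      | succ i ih => rw [(hall i).2, ih]
    have hR : ∀ m, Run K (X ^ e 0) m (pr (fun i => X ^ e i * U i) m) := by
      intro m
      induction m with
      | zero => exact Run.one (one_mem _)
      | succ m ih =>
        have := Run.succ ih (hall m).1
        simp only [pr]
        rw [hec m]
        simpa only [mul_assoc] using this
    have hc := hcount (e 0) (he 0)
    have : Nat.count (fun i => e i = e 0) (N + 1) = N + 1 := by
      rw [Nat.count_iff_forall]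
      intro i _; exact hec i
    rw [this] at hc
    exact hrun (e 0) (he 0) N _ (hR (N + 1)) hc (by rw [hone]; exact one_mem _)
  · push Not at hall
    obtain ⟨j0, hj0⟩ := hall
    have hj : Alt K S (!T) (!T) (U j0) := by
      rcases hU j0 with h | h
      · exact absurd h.2 (hj0 h.1)
      · exact h
    -- rotate so that position `N` is `j0`
    set j := j0 + 1 with hjdef
    have hrot : pr (fun i => X ^ e (j + i) * U (j + i)) (N + 1) = 1 := by
      have h1 := pr_add (fun i => X ^ e i * U i) j (N + 1)
      have h2 := pr_add (fun i => X ^ e i * U i) (N + 1) j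
      rw [add_comm j (N + 1), h2, hone, one_mul] at h1
      rw [pr_congr (g := fun i => X ^ e i * U i) (fun i _ => by simp only [hpe, hpU])] at h1
      simpa using h1
    have hcnt : ∀ ε : ℤ, Nat.count (fun i => e (j + i) = ε) (N + 1)
        = Nat.count (fun i => e i = ε) (N + 1) := by
      intro ε
      have h1 := Nat.count_add (fun i => e i = ε) j (N + 1)
      have h2 := Nat.count_add (fun i => e i = ε) (N + 1) j
      simp only [hpe] at h2
      rw [add_comm j (N + 1)] at h1
      omega
    have hlast : Alt K S (!T) (!T) (U (j + N)) := by
      have : j + N = N + 1 + j0 := by omega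
      rw [this, hpU]; exact hj
    -- step lemma
    have hstep : ∀ m D ε l R, m < N + 1 → (D = 1 ∨ Alt K S T (!T) D) →
        (ε = 1 ∨ ε = -1) → Run K (X ^ ε) l R → ε = e (j + m) →
        l ≤ Nat.count (fun i => e (j + i) = ε) m → Alt K S (!T) (!T) (U (j + m)) →
        Alt K S T (!T) (D * R * (X ^ e (j + m) * U (j + m))) := by
      intro m D ε l R hm hD hε hR hεe hl hUm
      have h1 : Run K (X ^ ε) (l + 1) (R * X ^ ε) := by
        simpa using Run.succ hR (one_mem K)
      have h2 : l + 1 ≤ Nat.count (fun i => e (j + i) = ε) (N + 1) := by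
        calc l + 1 ≤ Nat.count (fun i => e (j + i) = ε) (m + 1) := by
              rw [Nat.count_succ, if_pos hεe.symm]; omega
          _ ≤ _ := Nat.count_monotone _ (by omega)
      have h3 : R * X ^ ε ∉ K := by
        refine hrun ε hε l _ h1 (lt_of_le_of_lt ?_ (hcount ε hε))
        rw [← hcnt]
        exact_mod_cast h2
      have h4 : Ltr K S T (R * X ^ ε) := ⟨h1.mem (zpow_mem hXS _) (hK _), h3⟩
      have h5 : Alt K S T (!T) (R * X ^ ε * U (j + m)) := Alt.cons h4 hUm
      rw [← hεe]
      rcases hD with rfl | hD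
      · simpa only [mul_assoc, one_mul] using h5
      · have := hD.mul h5 (by simp)
        simpa only [mul_assoc] using this
    have hinv : ∀ m, m < N + 1 → ∃ D ε l R, (D = 1 ∨ Alt K S T (!T) D) ∧
        (ε = 1 ∨ ε = -1) ∧ Run K (X ^ ε) l R ∧ ε = e (j + m) ∧
        l ≤ Nat.count (fun i => e (j + i) = ε) m ∧
        pr (fun i => X ^ e (j + i) * U (j + i)) m = D * R := by
      intro m
      induction m with
      | zero =>
        intro _
        exact ⟨1, e j, 0, 1, Or.inl rfl, he _, Run.one (one_mem _), rfl, by simp, by simp [pr]⟩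
      | succ m ih =>
        intro hm
        obtain ⟨D, ε, l, R, hD, hε, hR, hεe, hl, hpr⟩ := ih (by omega)
        rcases hU (j + m) with ⟨hUK, hee⟩ | hUm
        · refine ⟨D, ε, l + 1, R * X ^ ε * U (j + m), hD, hε, Run.succ hR hUK, ?_, ?_, ?_⟩
          · rw [← add_assoc, hee, hεe]
          · rw [Nat.count_succ, if_pos hεe.symm]; omega
          · simp only [pr]
            rw [hpr, hεe]; simp only [mul_assoc]
        · refine ⟨_, e (j + (m + 1)), 0, 1,
            Or.inr (hstep m D ε l R (by omega) hD hε hR hεe hl hUm), he _,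
            Run.one (one_mem _), rfl, by simp, ?_⟩
          simp only [pr]
          rw [hpr, mul_one]
    obtain ⟨D, ε, l, R, hD, hε, hR, hεe, hl, hpr⟩ := hinv N (by omega)
    have := hstep N D ε l R (by omega) hD hε hR hεe hl hlast
    rw [← hpr] at this
    refine hA _ _ _ this ?_
    have h' : pr (fun i => X ^ e (j + i) * U (j + i)) N * (X ^ e (j + N) * U (j + N)) = 1 := hrot
    rw [h']
    exact one_mem _

theorem main (hK : ∀ s, K ≤ S s) (hA : ∀ s t g, Alt K S s t g → g ∉ K)
    (n : ℕ∞) (r : ℕ) (hr : 1 ≤ r) (x : ℕ → G)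
    (hx : ∀ j ≤ 2 * r, Ltr K S (j + 1).bodd (x j))
    (hl : ∀ c ∈ K, (x 0)⁻¹ * c * x 0 ∈ K → c = 1)
    (hri : ∀ c ∈ K, x (2 * r) * c * (x (2 * r))⁻¹ ∈ K → c = 1)
    (hX : ∀ k : ℕ, ((k + 1 : ℕ) : ℕ∞) < n → ∀ c : ℕ → G, (∀ i, c i ∈ K) →
      pr (fun i => x r * c i) (k + 1) ≠ 1) :
    IsRF (S false) n (pr x (2 * r + 1)) := by
  intro N e0 c0 he0 hc0 hec0 hn1 hn2
  set h := pr x with hh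
  set X := x r with hXdef
  set h' : ℕ → G := fun i => pr (fun j => x (2 * r + 1 - i + j)) i with hh'
  have h0 : h 0 = 1 := rfl
  have h'0 : h' 0 = 1 := rfl
  have hs : ∀ i < r, h (i + 1) = h i * x i := fun i _ => rfl
  have h's : ∀ i < r, h' (i + 1) = x (2 * r - i) * h' i := by
    intro i hi
    simp only [hh']
    rw [pr_succ']
    have : 2 * r + 1 - (i + 1) + 0 = 2 * r - i := by omega
    rw [this]
    congr 1
    refine pr_congr (fun j _ => ?_)
    congr 1; omega
  have hg : pr x (2 * r + 1) = h r * X * h' r := by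
    have : 2 * r + 1 = r + 1 + r := by omega
    rw [this, pr_add]
    simp only [hh', pr]
    congr 1
    refine pr_congr (fun j _ => ?_)
    congr 1; omega
  set g := pr x (2 * r + 1) with hgdef
  -- types
  have hty : ∀ i < r, Ltr K S (i + 1).bodd (x i) := fun i hi => hx i (by omega)
  have hty' : ∀ i < r, Ltr K S (i + 1).bodd (x (2 * r - i)) := by
    intro i hi
    have := hx (2 * r - i) (by omega)
    have hb : (2 * r - i + 1).bodd = (i + 1).bodd := by
      have h1 : (2 * r - i + i).bodd = false := by
        rw [Nat.sub_add_cancel (by omega)]; simp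
      rw [Nat.bodd_add] at h1
      rw [Nat.bodd_succ, Nat.bodd_succ]
      revert h1
      cases (2 * r - i).bodd <;> cases i.bodd <;> simp
    rwa [hb] at this
  set e : ℕ → ℤ := fun i => e0 (Fin.ofNat (N + 1) i) with hedef
  set c : ℕ → G := fun i => c0 (Fin.ofNat (N + 1) i) with hcdef
  have he : ∀ i, e i = 1 ∨ e i = -1 := fun i => he0 _
  have hc : ∀ i, c i ∈ S false := fun i => hc0 _
  have hsucc : ∀ i, Fin.ofNat (N + 1) (i + 1) = Fin.ofNat (N + 1) i + 1 := by
    intro i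
    apply Fin.ext
    simp [Fin.val_add]
  have hec : ∀ i, e i = -(e (i + 1)) → c i ≠ 1 := by
    intro i hi
    apply hec0
    simpa only [hedef, hsucc] using hi
  have hper : ∀ i, Fin.ofNat (N + 1) (N + 1 + i) = Fin.ofNat (N + 1) i := by
    intro i
    apply Fin.ext
    simp
  have hpe : ∀ i, e (N + 1 + i) = e i := fun i => by simp only [hedef, hper]
  have hpc : ∀ i, c (N + 1 + i) = c i := fun i => by simp only [hcdef, hper]
  have hval : ∀ i : Fin (N + 1), Fin.ofNat (N + 1) (i : ℕ) = i := by
    intro i; apply Fin.ext; simp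
  rw [ofFn_prod (N + 1) _ (fun i => g ^ e i * c i) (fun i => by simp only [hedef, hcdef, hval]; rfl)]
  have hcard : ∀ ε : ℤ, (Finset.univ.filter (fun i => e0 i = ε)).card
      = Nat.count (fun i => e i = ε) (N + 1) := by
    intro ε
    rw [Nat.count_eq_card_filter_range]
    refine Finset.card_bij (fun i _ => (i : ℕ)) ?_ ?_ ?_
    · intro i hi
      simp only [Finset.mem_filter, Finset.mem_univ, true_and, Finset.mem_range] at hi ⊢
      exact ⟨i.2, by simp only [hedef, hval]; exact hi⟩
    · intro a _ b _ hab; exact Fin.ext hab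
    · intro b hb
      simp only [Finset.mem_filter, Finset.mem_range] at hb
      refine ⟨Fin.ofNat (N + 1) b, ?_, ?_⟩
      · rw [Finset.mem_filter]; exact ⟨Finset.mem_univ _, hb.2⟩
      · simp [Nat.mod_eq_of_lt hb.1]
  set Lf : ℤ → G := fun ε => if ε = 1 then h r else (h' r)⁻¹ with hLf
  set Rf : ℤ → G := fun ε => if ε = 1 then h' r else (h r)⁻¹ with hRf
  have hge : ∀ i, g ^ e i = Lf (e i) * X ^ e i * Rf (e i) := by
    intro i
    rcases he i with h1 | h1 <;> simp [h1, hLf, hRf, hg, mul_assoc]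
  set U : ℕ → G := fun i => Rf (e i) * c i * Lf (e (i + 1)) with hUdef
  have htel : ∀ m, pr (fun i => g ^ e i * c i) m
      = Lf (e 0) * pr (fun i => X ^ e i * U i) m * (Lf (e m))⁻¹ := by
    intro m
    induction m with
    | zero => simp [pr]
    | succ m ih =>
      simp only [pr]
      rw [ih, hge]
      simp only [hUdef]
      group
  have hXS := hx r (by omega)
  have hcore := core hK hA n (r + 1).bodd X hXS.1 hX N e U he ?_ hpe ?_ ?_
  · intro h1
    apply hcore
    have := htel (N + 1)
    rw [h1, show e (N + 1) = e 0 from hpe 0] at this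
    have h2 := congrArg (fun z => (Lf (e 0))⁻¹ * z * Lf (e 0)) this
    simp only [mul_one, inv_mul_cancel] at h2
    rw [h2]; group
  · intro i
    rw [Nat.bodd_succ, Bool.not_not]
    have hQ : QQ K S false (c i) := by
      by_cases hk : c i ∈ K
      · exact Or.inl hk
      · exact Or.inr (Alt.single ⟨hc i, hk⟩)
    rcases he i with h1 | h1 <;> rcases he (i + 1) with h2 | h2
    · have := chainQ hK (fun i => x (2 * r - i)) x h' h (c i) r h'0 h0 h's hs hty' hty hQ
      have hUi : U i = h' r * c i * h r := by simp [hUdef, hLf, hRf, h1, h2]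
      rw [hUi]
      exact this.imp (fun t => ⟨t, by rw [h1, h2]⟩) id
    · have := chainA hK (fun i => x (2 * r - i)) h' (c i) r hr h'0 h's hty' (hc i)
        (hec i (by rw [h1, h2]; norm_num)) hri
      have hUi : U i = h' r * c i * (h' r)⁻¹ := by simp [hUdef, hLf, hRf, h1, h2]
      rw [hUi]
      exact Or.inr this
    · have := chainA hK (fun i => (x i)⁻¹) (fun i => (h i)⁻¹) (c i) r hr (by simp [h0])
        (fun i hi => by rw [hs i hi]; simp) (fun i hi => (hty i hi).inv) (hc i)
        (hec i (by rw [h1, h2])) (by simpa using hl)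
      have hUi : U i = (h r)⁻¹ * c i * h r := by simp [hUdef, hLf, hRf, h1, h2]
      rw [hUi]
      simp only [inv_inv] at this
      exact Or.inr this
    · have := chainQ hK (fun i => (x i)⁻¹) (fun i => (x (2 * r - i))⁻¹)
        (fun i => (h i)⁻¹) (fun i => (h' i)⁻¹) (c i) r (by simp [h0]) (by simp [h'0])
        (fun i hi => by rw [hs i hi]; simp) (fun i hi => by rw [h's i hi]; simp)
        (fun i hi => (hty i hi).inv) (fun i hi => (hty' i hi).inv) hQ
      have hUi : U i = (h r)⁻¹ * c i * (h' r)⁻¹ := by simp [hUdef, hLf, hRf, h1, h2]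
      rw [hUi]
      exact this.imp (fun t => ⟨t, by rw [h1, h2]⟩) id
  · intro i
    simp only [hUdef]
    rw [add_assoc (N + 1) i 1, hpe, hpe, hpc]
  · rintro ε (rfl | rfl)
    · rw [← hcard]; exact hn1
    · rw [← hcard]; exact hn2

end Abstract

section Concrete

variable {ι H : Type} {G : ι → Type} [∀ i, Group (G i)] [Group H]

theorem of_mem_base {φ : ∀ i, H →* G i} (hφ : ∀ i, Function.Injective (φ i)) (i : ι) (x : G i) :
    PushoutI.of (φ := φ) i x ∈ (PushoutI.base φ).range ↔ x ∈ (φ i).range := by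
  constructor
  · rintro ⟨y, hy⟩
    rw [← PushoutI.of_apply_eq_base φ i] at hy
    exact ⟨y, PushoutI.of_injective hφ i hy⟩
  · rintro ⟨y, rfl⟩
    exact ⟨y, (PushoutI.of_apply_eq_base φ i y).symm⟩

theorem alt_not_mem {G : Bool → Type} [∀ i, Group (G i)]
    {φ : ∀ i, H →* G i} (hφ : ∀ i, Function.Injective (φ i)) (s t : Bool)
    (g : PushoutI φ)
    (h : Alt (PushoutI.base φ).range (fun i => (PushoutI.of (φ := φ) i).range) s t g) :
    g ∉ (PushoutI.base φ).range := by
  have : ∃ w : CoprodI.Word G, PushoutI.Reduced φ w ∧ w.fstIdx = some s ∧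
      PushoutI.ofCoprodI w.prod = g := by
    induction h with
    | @single s g hl =>
      obtain ⟨⟨x, rfl⟩, hx⟩ := hl
      rw [of_mem_base hφ] at hx
      have hx1 : x ≠ 1 := by rintro rfl; exact hx (one_mem _)
      refine ⟨CoprodI.Word.cons x CoprodI.Word.empty (by simp [CoprodI.Word.fstIdx]) hx1, ?_, by simp, by simp⟩
      intro y hy
      simp [CoprodI.Word.cons] at hy
      subst hy
      exact hx
    | @cons s t g h' hl _ ih =>
      obtain ⟨⟨x, rfl⟩, hx⟩ := hl
      rw [of_mem_base hφ] at hx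
      have hx1 : x ≠ 1 := by rintro rfl; exact hx (one_mem _)
      obtain ⟨w, hw, hf, rfl⟩ := ih
      refine ⟨CoprodI.Word.cons x w (by simp [hf]) hx1, ?_, by simp, by simp⟩
      intro y hy
      simp only [CoprodI.Word.cons, List.mem_cons] at hy
      rcases hy with rfl | hy
      · exact hx
      · exact hw y hy
  obtain ⟨w, hw, hf, rfl⟩ := this
  intro hmem
  have := hw.eq_empty_of_mem_range hφ hmem
  subst this
  simp [CoprodI.Word.fstIdx] at hf

theorem rtf_transfer {φ : ∀ i, H →* G i} (hφ : ∀ i, Function.Injective (φ i)) (i : ι) (x : G i)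
    (n : ℕ∞) (hx : IsRTF (φ i).range n x) :
    ∀ k : ℕ, ((k + 1 : ℕ) : ℕ∞) < n → ∀ c : ℕ → PushoutI φ,
      (∀ i, c i ∈ (PushoutI.base φ).range) →
      pr (fun j => PushoutI.of (φ := φ) i x * c j) (k + 1) ≠ 1 := by
  intro k hk c hc h1
  choose d hd using hc
  refine hx k hk (fun j => φ i (d j)) (fun j => ⟨_, rfl⟩) (PushoutI.of_injective hφ i ?_)
  rw [map_one, map_list_prod, List.map_ofFn, ← h1]
  refine ofFn_prod _ _ _ (fun j => ?_)
  simp [PushoutI.of_apply_eq_base, hd]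

end Concrete

theorem rf_two {A : Type} [Group A] {K : Subgroup A} {a : A} (h : IsRF K 2 a) :
    (∀ c ∈ K, a * c * a⁻¹ ∈ K → c = 1) := by
  intro c hc hc'
  by_contra hne
  refine h 1 ![1, -1] ![c, (a * c * a⁻¹)⁻¹] ?_ ?_ ?_ ?_ ?_ ?_
  · intro i; fin_cases i <;> simp
  · intro i; fin_cases i
    · exact hc
    · exact inv_mem hc'
  · intro i _; fin_cases i
    · exact hne
    · intro h1
      have h1' : (a * c * a⁻¹)⁻¹ = 1 := h1
      rw [inv_eq_one, conj_eq_one_iff] at h1'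
      exact hne h1'
  · have : (Finset.univ.filter (fun i : Fin 2 => (![1, -1] : Fin 2 → ℤ) i = 1)).card = 1 := by
      decide
    rw [this]; norm_num
  · have : (Finset.univ.filter (fun i : Fin 2 => (![1, -1] : Fin 2 → ℤ) i = -1)).card = 1 := by
      decide
    rw [this]; norm_num
  · simp [List.ofFn_succ]

theorem not_mem_of_rf {A : Type} [Group A] {K : Subgroup A} {a : A} {n : ℕ∞} (hn : 2 ≤ n)
    (h : IsRF K n a) : a ∉ K := by
  intro ha
  have h1 : (1 : ℕ∞) < n := lt_of_lt_of_le (by norm_num) hn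
  refine h 0 (fun _ => 1) (fun _ => a⁻¹) (fun _ => Or.inl rfl) (fun _ => inv_mem ha) ?_ ?_ ?_ ?_
  · intro i hi; norm_num at hi
  · simpa using h1
  · simpa using lt_of_lt_of_le (by norm_num) hn
  · simp

end RFProof

/-- Let `g = ι(x_{-r}) ⋯ ι(x_0) ⋯ ι(x_r)` be an alternating word in `G = A ∗_C B` (indexed here
by `j = i + r ∈ {0, …, 2r}`, so position `j` lies in `A` iff `j` is even), whose letters avoid
the amalgamated subgroup. If `x_{-r}` and `x_r` are `2`-RF rel `φA(C)` and `x_0` is `n`-RTF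
(rel `φA(C)` if `r` is even, rel `φB(C)` if `r` is odd), then `g ∉ ι_B(B)` and `g` is `n`-RF
relative to `ι_B(B)`. -/
theorem stmt11 {C A B : Type} [Group C] [Group A] [Group B]
    (φA : C →* A) (φB : C →* B)
    (hφA : Function.Injective φA) (hφB : Function.Injective φB)
    (n : ℕ∞) (hn : 2 ≤ n)
    (r : ℕ) (hr : 1 ≤ r) (xA : Fin (2 * r + 1) → A) (xB : Fin (2 * r + 1) → B)
    (hxA : ∀ j : Fin (2 * r + 1), (j : ℕ) % 2 = 0 → xA j ∉ φA.range)
    (hxB : ∀ j : Fin (2 * r + 1), (j : ℕ) % 2 = 1 → xB j ∉ φB.range)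
    (hleft : IsRF φA.range 2 (xA ⟨0, by omega⟩))
    (hright : IsRF φA.range 2 (xA ⟨2 * r, by omega⟩))
    (hmid : if r % 2 = 0 then IsRTF φA.range n (xA ⟨r, by omega⟩)
            else IsRTF φB.range n (xB ⟨r, by omega⟩)) :
    (List.ofFn fun j : Fin (2 * r + 1) =>
        if (j : ℕ) % 2 = 0 then iotaA φA φB (xA j) else iotaB φA φB (xB j)).prod
      ∉ (iotaB φA φB).range ∧
    IsRF (iotaB φA φB).range n
      (List.ofFn fun j : Fin (2 * r + 1) =>
        if (j : ℕ) % 2 = 0 then iotaA φA φB (xA j) else iotaB φA φB (xB j)).prod := by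
  have hφ : ∀ b, Function.Injective (amalgamHom φA φB b) := by
    rintro (_ | _)
    · exact hφB
    · exact hφA
  set K : Subgroup (Amalgam φA φB) := (Monoid.PushoutI.base (amalgamHom φA φB)).range with hKdef
  set S : Bool → Subgroup (Amalgam φA φB) :=
    fun b => (Monoid.PushoutI.of (φ := amalgamHom φA φB) b).range with hSdef
  have hKS : ∀ s, K ≤ S s := by
    rintro s _ ⟨y, rfl⟩
    exact ⟨amalgamHom φA φB s y, Monoid.PushoutI.of_apply_eq_base _ s y⟩
  have hmA : ∀ a : A, iotaA φA φB a ∈ K ↔ a ∈ φA.range := fun a => RFProof.of_mem_base hφ true a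
  have hmB : ∀ b : B, iotaB φA φB b ∈ K ↔ b ∈ φB.range := fun b => RFProof.of_mem_base hφ false b
  have hinjA : Function.Injective (iotaA φA φB) := Monoid.PushoutI.of_injective hφ true
  have hSA : ∀ a : A, iotaA φA φB a ∈ S true := fun a => ⟨a, rfl⟩
  have hSB : ∀ b : B, iotaB φA φB b ∈ S false := fun b => ⟨b, rfl⟩
  have hKA : ∀ c ∈ K, ∃ a ∈ φA.range, iotaA φA φB a = c := by
    rintro _ ⟨y, rfl⟩
    exact ⟨φA y, ⟨y, rfl⟩, Monoid.PushoutI.of_apply_eq_base (amalgamHom φA φB) true y⟩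
  set f : Fin (2 * r + 1) → Amalgam φA φB := fun j =>
    if (j : ℕ) % 2 = 0 then iotaA φA φB (xA j) else iotaB φA φB (xB j) with hf
  set x : ℕ → Amalgam φA φB := fun j => f (Fin.ofNat (2 * r + 1) j) with hxdef
  have hxj : ∀ j (hj : j < 2 * r + 1), x j = f ⟨j, hj⟩ := by
    intro j hj
    simp only [hxdef]
    congr 1
    apply Fin.ext
    simp [Nat.mod_eq_of_lt hj]
  have hprod : (List.ofFn f).prod = RFProof.pr x (2 * r + 1) :=
    RFProof.ofFn_prod _ _ _ (fun i => (hxj i i.2).symm)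
  have hconj : ∀ a : A, IsRF φA.range 2 a →
      ∀ c ∈ K, iotaA φA φB a * c * (iotaA φA φB a)⁻¹ ∈ K → c = 1 := by
    intro a ha c hc hc'
    obtain ⟨d, hd, rfl⟩ := hKA c hc
    rw [← map_inv, ← map_mul, ← map_mul, hmA] at hc'
    rw [RFProof.rf_two ha d hd hc', map_one]
  have key : IsRF (S false) n (RFProof.pr x (2 * r + 1)) := by
    refine RFProof.main (K := K) hKS (fun s t g h => RFProof.alt_not_mem hφ s t g h) n r hr x
      ?_ ?_ ?_ ?_
    · intro j hj
      rw [hxj j (by omega)]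
      rcases Nat.mod_two_eq_zero_or_one j with h0 | h0
      · have hb : (j + 1).bodd = true := by
          rw [Nat.bodd_succ]; have := Nat.mod_two_of_bodd j; rw [h0] at this
          cases hjb : j.bodd <;> simp [hjb] at this ⊢
        rw [hb]
        simp only [hf, h0, if_true]
        exact ⟨hSA _, by rw [hmA]; exact hxA _ h0⟩
      · have hb : (j + 1).bodd = false := by
          rw [Nat.bodd_succ]; have := Nat.mod_two_of_bodd j; rw [h0] at this
          cases hjb : j.bodd <;> simp [hjb] at this ⊢
        rw [hb]
        simp only [hf, h0, one_ne_zero, if_false]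
        exact ⟨hSB _, by rw [hmB]; exact hxB _ h0⟩
    · have hx0 : x 0 = iotaA φA φB (xA ⟨0, by omega⟩) := by
        rw [hxj 0 (by omega)]; exact if_pos rfl
      rw [hx0]
      intro c hc hc'
      have := hconj _ hleft _ hc' (by simpa [mul_assoc] using hc)
      rwa [mul_assoc, inv_mul_eq_one, eq_comm, mul_eq_right] at this
    · have hx0 : x (2 * r) = iotaA φA φB (xA ⟨2 * r, by omega⟩) := by
        rw [hxj (2 * r) (by omega)]; exact if_pos (Nat.mul_mod_right 2 r)
      rw [hx0]
      exact hconj _ hright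
    · rw [hxj r (by omega)]
      by_cases h0 : r % 2 = 0
      · rw [if_pos h0] at hmid
        simp only [hf, h0, if_true]
        exact RFProof.rtf_transfer (φ := amalgamHom φA φB) hφ true _ n hmid
      · rw [if_neg h0] at hmid
        simp only [hf, h0, if_false]
        exact RFProof.rtf_transfer (φ := amalgamHom φA φB) hφ false _ n hmid
  rw [hprod]
  exact ⟨RFProof.not_mem_of_rf hn key, key⟩
end
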